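/- For every n ≥ 3 and every formula φ such that AtMostOne(x_1, …, x_n) ⊢* φ (i.e., φ is derivable from AtMostOne(x_1, …, x_n) by idealized BVA), we have |φ| ≥ 3n − 6. -/

import Mathlib

namespace BVAPaper

/-- A literal is a propositional variable (a natural number) together with a
polarity: `true` for a positive literal, `false` for a negative one. -/
abbrev Lit := ℕ × Bool

/-- A clause is a finite set of literals (required to be pairwise
non-complementary via `IsClause`). -/
abbrev Clause := Finset Lit

/-- A formula is a finite set of clauses; its size is its number of clauses. -/
abbrev Formula := Finset Clause

/-- A genuine clause: it contains no pair of complementary literals. -/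
def IsClause (C : Clause) : Prop := ∀ v : ℕ, ¬ ((v, true) ∈ C ∧ (v, false) ∈ C)

/-- A 2-CNF formula: every member is a genuine clause with exactly two literals. -/
def Is2CNF (φ : Formula) : Prop := ∀ C ∈ φ, IsClause C ∧ C.card = 2

/-- The set of variables occurring in a formula. -/
def Vars (φ : Formula) : Finset ℕ := φ.biUnion (fun C => C.image Prod.fst)

/-- A literal is true under an assignment. -/
def LitTrue (τ : ℕ → Bool) (l : Lit) : Prop := τ l.1 = l.2

/-- An assignment satisfies a formula if it makes some literal of every clause true. -/
def Satisfies (τ : ℕ → Bool) (φ : Formula) : Prop := ∀ C ∈ φ, ∃ l ∈ C, LitTrue τ l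

/-- `φ` semantically implies the equivalence of the literals `l₁` and `l₂`. -/
def ImpliesEquiv (φ : Formula) (l₁ l₂ : Lit) : Prop :=
  ∀ τ : ℕ → Bool, Satisfies τ φ → (LitTrue τ l₁ ↔ LitTrue τ l₂)

/-- A simple 2-CNF formula: (a) no two distinct literals are implied equivalent,
(b) every clause contains a negative literal, (c) no two distinct clauses are over
the same pair of variables. -/
def IsSimple (φ : Formula) : Prop :=
  (∀ l₁ l₂ : Lit, l₁ ≠ l₂ → ¬ ImpliesEquiv φ l₁ l₂) ∧
  (∀ C ∈ φ, ∃ l ∈ C, l.2 = false) ∧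
  (∀ C₁ ∈ φ, ∀ C₂ ∈ φ, C₁.image Prod.fst = C₂.image Prod.fst → C₁ = C₂)

/-- A monotone formula: every literal occurring in it is positive. -/
def MonotoneFormula (φ : Formula) : Prop := ∀ C ∈ φ, ∀ l ∈ C, l.2 = true

/-- `𝒞 ⋈ 𝒟`: the set of clauses `C ∪ D` for `C ∈ 𝒞` and `D ∈ 𝒟`. -/
def JoinClauses (𝒞 𝒟 : Finset Clause) : Finset Clause :=
  (𝒞 ×ˢ 𝒟).image (fun p => p.1 ∪ p.2)

/-- One BVA step. -/
def BVAStep (φ φ' : Formula) : Prop :=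
  ∃ (𝒞 𝒟 : Finset Clause) (y : ℕ),
    (∀ C ∈ 𝒞, IsClause C ∧ C.Nonempty) ∧
    (∀ D ∈ 𝒟, IsClause D ∧ D.Nonempty) ∧
    JoinClauses 𝒞 𝒟 ⊆ φ ∧
    y ∉ Vars φ ∧
    φ' = (φ \ JoinClauses 𝒞 𝒟)
      ∪ 𝒞.image (fun C => insert ((y, true) : Lit) C)
      ∪ 𝒟.image (fun D => insert ((y, false) : Lit) D)

/-- Idealized BVA: the reflexive transitive closure of single BVA steps. -/
def BVAChain : Formula → Formula → Prop := Relation.ReflTransGen BVAStep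

/-- Negate the variables from `S` inside a literal. -/
def flipLit (S : Finset ℕ) (l : Lit) : Lit := if l.1 ∈ S then (l.1, !l.2) else l

/-- Negate the variables from `S` throughout a formula. -/
def flipFormula (S : Finset ℕ) (φ : Formula) : Formula :=
  φ.image (fun C => C.image (flipLit S))

/-- `φ ≅_W φ'`: `φ'` is obtained from `φ` by replacing some variables from `W`
by their negations wherever they appear. -/
def EquivW (W : Finset ℕ) (φ φ' : Formula) : Prop :=
  ∃ S ⊆ W, φ' = flipFormula S φ

/-- `φ'` encodes `φ` over the base variables `X`: for every assignment `τ` of `X`,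
`τ` satisfies `φ` iff `τ` extends to a satisfying assignment of `φ'`. -/
def Encodes (φ' φ : Formula) (X : Finset ℕ) : Prop :=
  ∀ τ : ℕ → Bool,
    Satisfies τ φ ↔ ∃ σ : ℕ → Bool, (∀ x ∈ X, σ x = τ x) ∧ Satisfies σ φ'

/-- The direct encoding of the at-most-one constraint on the variables `0, …, n-1`. -/
def atMostOne (n : ℕ) : Formula :=
  (((Finset.range n) ×ˢ (Finset.range n)).filter (fun p => p.1 < p.2)).image
    (fun p => ({(p.1, false), (p.2, false)} : Clause))

/-- A diagram: a graph with both undirected edges (represented as a symmetric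
set of ordered pairs) and directed edges. -/
structure Diagram where
  verts : Finset ℕ
  undir : Finset (ℕ × ℕ)
  dir : Finset (ℕ × ℕ)

/-- Well-formedness of a diagram: no loops, edges between vertices, the
undirected edge set is symmetric, and at most one edge between any two vertices. -/
def Diagram.WF (G : Diagram) : Prop :=
  (∀ e ∈ G.undir, e.1 ∈ G.verts ∧ e.2 ∈ G.verts ∧ e.1 ≠ e.2) ∧
  (∀ e ∈ G.dir, e.1 ∈ G.verts ∧ e.2 ∈ G.verts ∧ e.1 ≠ e.2) ∧
  (∀ u v : ℕ, (u, v) ∈ G.undir → (v, u) ∈ G.undir) ∧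
  (∀ u v : ℕ, (u, v) ∈ G.undir → (u, v) ∉ G.dir ∧ (v, u) ∉ G.dir) ∧
  (∀ u v : ℕ, (u, v) ∈ G.dir → (v, u) ∉ G.dir)

/-- The complete diagram `K_n` on vertices `0, …, n-1`: all edges undirected. -/
def completeDiagram (n : ℕ) : Diagram where
  verts := Finset.range n
  undir := ((Finset.range n) ×ˢ (Finset.range n)).filter (fun p => p.1 ≠ p.2)
  dir := ∅

/-- The diagram associated to a simple 2-CNF formula: an undirected edge
`{x, y}` for each clause `(¬x ∨ ¬y)` and a directed edge `(x, y)` for each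
clause `(¬x ∨ y)`. -/
def diagramOf (φ : Formula) : Diagram where
  verts := Vars φ
  undir := ((Vars φ) ×ˢ (Vars φ)).filter
    (fun p => ({(p.1, false), (p.2, false)} : Clause) ∈ φ)
  dir := ((Vars φ) ×ˢ (Vars φ)).filter
    (fun p => ({(p.1, false), (p.2, true)} : Clause) ∈ φ)

/-- A polarized diagram: a directed graph with a polarity on its edges
(`true` = `+`, `false` = `−`). -/
structure PolDiagram where
  verts : Finset ℕ
  edges : Finset (ℕ × ℕ)
  pol : ℕ × ℕ → Bool

/-- `(P, P.pol)` is a polarized diagram of the diagram `G`: every undirected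
edge of `G` is oriented (in exactly one way) with polarity `−`, and every
directed edge of `G` is kept with polarity `+`. -/
def IsPolarizationOf (P : PolDiagram) (G : Diagram) : Prop :=
  P.verts = G.verts ∧
  (∀ u v : ℕ, (u, v) ∈ G.dir ↔ ((u, v) ∈ P.edges ∧ P.pol (u, v) = true)) ∧
  (∀ u v : ℕ, (u, v) ∈ G.undir ↔
    (((u, v) ∈ P.edges ∧ P.pol (u, v) = false) ∨
     ((v, u) ∈ P.edges ∧ P.pol (v, u) = false))) ∧
  (∀ u v : ℕ, ¬ ((u, v) ∈ P.edges ∧ (v, u) ∈ P.edges))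

/-- A polarized rectifier network: base vertices, auxiliary vertices, directed
edges, and a polarity function (only meaningful on edges into base vertices). -/
structure PRN where
  base : Finset ℕ
  aux : Finset ℕ
  edges : Finset (ℕ × ℕ)
  pol : ℕ × ℕ → Bool

/-- Well-formedness of a PRN: base and auxiliary vertices are disjoint, and
edges are loopless edges between vertices. -/
def PRN.WF (R : PRN) : Prop :=
  Disjoint R.base R.aux ∧
  (∀ e ∈ R.edges, e.1 ∈ R.base ∪ R.aux ∧ e.2 ∈ R.base ∪ R.aux ∧ e.1 ≠ e.2)

/-- A valid walk from the base vertex `u` to the base vertex `v`: a sequence of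
length ≥ 2 of consecutive edges whose interior vertices are auxiliary. -/
def ValidWalk (R : PRN) (u v : ℕ) (π : List ℕ) : Prop :=
  2 ≤ π.length ∧
  π.head? = some u ∧ π.getLast? = some v ∧
  u ∈ R.base ∧ v ∈ R.base ∧
  List.Chain' (fun a b => (a, b) ∈ R.edges) π ∧
  (∀ i : ℕ, 0 < i → i + 1 < π.length → π.getD i 0 ∈ R.aux)

/-- The polarity of a walk: the polarity of its last edge. -/
def walkPol (R : PRN) (π : List ℕ) : Bool :=
  R.pol (π.getD (π.length - 2) 0, π.getD (π.length - 1) 0)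

/-- A strict polarized rectifier network: (1) for distinct base vertices `u, v`
there is at most one valid walk from `u` to `v` or from `v` to `u` in total, and
(2) every auxiliary vertex belongs to some valid walk. -/
def IsSPRN (R : PRN) : Prop :=
  (∀ u ∈ R.base, ∀ v ∈ R.base, u ≠ v →
    ∀ π₁ π₂ : List ℕ,
      (ValidWalk R u v π₁ ∨ ValidWalk R v u π₁) →
      (ValidWalk R u v π₂ ∨ ValidWalk R v u π₂) → π₁ = π₂) ∧
  (∀ a ∈ R.aux, ∃ u v : ℕ, ∃ π : List ℕ, ValidWalk R u v π ∧ a ∈ π)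

/-- The PRN `R` realizes the polarized diagram `P`. -/
def RealizesPol (R : PRN) (P : PolDiagram) : Prop :=
  R.base = P.verts ∧
  ∀ u ∈ P.verts, ∀ v ∈ P.verts,
    ((u, v) ∈ P.edges ↔ ∃ π : List ℕ, ValidWalk R u v π ∧ walkPol R π = P.pol (u, v))

/-- The PRN `R` realizes the diagram `G`: it realizes some polarized diagram of `G`. -/
def RealizesDiagram (R : PRN) (G : Diagram) : Prop :=
  ∃ P : PolDiagram, IsPolarizationOf P G ∧ RealizesPol R P

/-- The 2-CNF formula `F_R` associated to a PRN `R`. -/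
def PRN.formula (R : PRN) : Formula :=
  R.edges.image (fun e =>
    if e.2 ∈ R.base ∧ R.pol e = false
    then ({(e.1, false), (e.2, false)} : Clause)
    else ({(e.1, false), (e.2, true)} : Clause))

/-- The PRN associated to a polarized diagram (no auxiliary vertices). -/
def prnOfPol (P : PolDiagram) : PRN :=
  ⟨P.verts, ∅, P.edges, P.pol⟩

/-- A coherent biclique `(X, Y)` of a PRN. -/
def CoherentBiclique (R : PRN) (X Y : Finset ℕ) : Prop :=
  X.Nonempty ∧ Y.Nonempty ∧ Disjoint X Y ∧
  X ⊆ R.base ∪ R.aux ∧ Y ⊆ R.base ∪ R.aux ∧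
  (∀ x ∈ X, ∀ y ∈ Y, (x, y) ∈ R.edges) ∧
  (∀ y ∈ Y, y ∈ R.base → ∀ x₁ ∈ X, ∀ x₂ ∈ X, R.pol (x₁, y) = R.pol (x₂, y))

/-- `R'` is the biclique reduction of `R` with respect to some coherent biclique. -/
def BicliqueStep (R R' : PRN) : Prop :=
  ∃ (X Y : Finset ℕ) (z : ℕ),
    CoherentBiclique R X Y ∧
    z ∉ R.base ∪ R.aux ∧
    R'.base = R.base ∧
    R'.aux = insert z R.aux ∧
    R'.edges = (R.edges \ (X ×ˢ Y)) ∪ (X ×ˢ ({z} : Finset ℕ)) ∪ (({z} : Finset ℕ) ×ˢ Y) ∧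
    (∀ y ∈ Y, y ∈ R.base → ∀ x ∈ X, R'.pol (z, y) = R.pol (x, y)) ∧
    (∀ e ∈ R.edges \ (X ×ˢ Y), e.2 ∈ R.base → R'.pol e = R.pol e)

/-- `R ↪* R'`: the reflexive transitive closure of biclique reduction. -/
def BicliqueChain : PRN → PRN → Prop := Relation.ReflTransGen BicliqueStep

/-- The total degree (in-degree plus out-degree) of a vertex in a PRN. -/
def totalDeg (R : PRN) (v : ℕ) : ℕ :=
  (R.edges.filter (fun e => e.1 = v)).card + (R.edges.filter (fun e => e.2 = v)).card

/-- The complementary label: labels `2 * x` and `2 * x + 1` are complementary. -/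
def ng (a : ℕ) : ℕ := if a % 2 = 0 then a + 1 else a - 1

@[simp] theorem ng_ng (a : ℕ) : ng (ng a) = a := by
  unfold ng; split_ifs <;> omega

theorem ng_ne (a : ℕ) : ng a ≠ a := by
  unfold ng; split_ifs <;> omega

theorem ng_inj {a b : ℕ} : ng a = ng b ↔ a = b :=
  ⟨fun h => by rw [← ng_ng a, h, ng_ng], fun h => by rw [h]⟩

theorem ng_eq_comm {a b : ℕ} : ng a = b ↔ a = ng b :=
  ⟨fun h => by rw [← h, ng_ng], fun h => by rw [h, ng_ng]⟩

/-- The implication arcs of a set of binary clauses over labels. -/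
def Arc (L : Finset (Sym2 ℕ)) (q q' : ℕ) : Prop := s(ng q, q') ∈ L

/-- Reachability along implication arcs. -/
abbrev Reach (L : Finset (Sym2 ℕ)) : ℕ → ℕ → Prop := Relation.ReflTransGen (Arc L)

/-- Reachability by a walk all of whose vertices lie in `S`. -/
def ReachIn (L : Finset (Sym2 ℕ)) (S : Set ℕ) (a b : ℕ) : Prop :=
  a ∈ S ∧ Relation.ReflTransGen (fun x y => Arc L x y ∧ y ∈ S) a b

/-- A walk from `ng v` to `w` with nonempty interior, all of which lies in `S`. -/
def Detour (L : Finset (Sym2 ℕ)) (S : Set ℕ) (v w : ℕ) : Prop :=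
  ∃ q r, s(v, q) ∈ L ∧ s(w, r) ∈ L ∧ ReachIn L S q (ng r)

/-- Labels outside `Mu` that are reached from a base label through labels outside `Mu`. -/
inductive Live (X Mu : Finset ℕ) (L : Finset (Sym2 ℕ)) : ℕ → Prop
  | base {v : ℕ} : v ∈ X → v ∉ Mu → Live X Mu L v
  | step {v a : ℕ} : v ∉ Mu → s(ng v, a) ∈ L → Live X Mu L a → Live X Mu L v

theorem Live.not_mem {X Mu : Finset ℕ} {L : Finset (Sym2 ℕ)} {v : ℕ} (h : Live X Mu L v) :
    v ∉ Mu := by cases h <;> assumption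

/-- A network of binary clauses that makes the base labels `X` pairwise exclusive, in which
two internally disjoint walks never join two live labels. -/
structure Network (X Mu : Finset ℕ) (L : Finset (Sym2 ℕ)) : Prop where
  not_mem_ng : ∀ v ∈ X, ∀ a, s(ng v, a) ∉ L
  reach : ∀ v ∈ X, ∀ w ∈ X, v ≠ w → Reach L (ng v) w
  not_reach : ∀ v ∈ X, ¬ Reach L (ng v) v
  acyclic : ∀ a, ¬ Relation.TransGen (Arc L) a a
  no_detour : ∀ v w, Live X Mu L v → Live X Mu L w → ∀ S₁ S₂ : Set ℕ, Disjoint S₁ S₂ →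
    Detour L S₁ v w → ¬ (Detour L S₂ v w ∨ s(v, w) ∈ L)

section
variable {X X' Mu Mu' : Finset ℕ} {L L' : Finset (Sym2 ℕ)}

theorem Arc.symm {a b : ℕ} (h : Arc L a b) : Arc L (ng b) (ng a) := by
  unfold Arc at *; rw [ng_ng, Sym2.eq_swap]; exact h

theorem Reach.symm {a b : ℕ} (h : Reach L a b) : Reach L (ng b) (ng a) := by
  induction h with
  | refl => exact .refl
  | tail _ h ih => exact .head h.symm ih

theorem Reach.mono {a b : ℕ} (hL : L ⊆ L') (h : Reach L a b) : Reach L' a b :=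
  Relation.ReflTransGen.mono (fun _ _ h => hL h) _ _ h

theorem arc_ng {a b : ℕ} : Arc L (ng a) b ↔ s(a, b) ∈ L := by simp [Arc]

theorem ReachIn.reach {S : Set ℕ} {a b : ℕ} (h : ReachIn L S a b) : Reach L a b :=
  Relation.ReflTransGen.mono (fun _ _ h => h.1) _ _ h.2

theorem ReachIn.mem_right {S : Set ℕ} {a b : ℕ} (h : ReachIn L S a b) : b ∈ S := by
  obtain ⟨ha, h⟩ := h
  induction h with
  | refl => exact ha
  | tail _ h _ => exact h.2

theorem ReachIn.refl {S : Set ℕ} {a : ℕ} (h : a ∈ S) : ReachIn L S a a := ⟨h, .refl⟩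

theorem ReachIn.tail {S : Set ℕ} {a b c : ℕ} (h : ReachIn L S a b) (h' : Arc L b c)
    (hc : c ∈ S) : ReachIn L S a c := ⟨h.1, h.2.tail ⟨h', hc⟩⟩

theorem ReachIn.trans {S : Set ℕ} {a b c : ℕ} (h : ReachIn L S a b) (h' : ReachIn L S b c) :
    ReachIn L S a c := ⟨h.1, h.2.trans h'.2⟩

theorem ReachIn.head {S : Set ℕ} {a b c : ℕ} (ha : a ∈ S) (h : Arc L a b)
    (h' : ReachIn L S b c) : ReachIn L S a c :=
  ⟨ha, h'.2.head ⟨h, h'.1⟩⟩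

theorem ReachIn.mono {S S' : Set ℕ} {a b : ℕ} (h : ReachIn L S a b) (hL : L ⊆ L')
    (hS : S ⊆ S') : ReachIn L' S' a b :=
  ⟨hS h.1, Relation.ReflTransGen.mono (fun _ _ h => ⟨hL h.1, hS h.2⟩) _ _ h.2⟩

/-- A walk can be confined to the vertices between its ends. -/
theorem ReachIn.confine {S S' : Set ℕ} {a b : ℕ} (h : ReachIn L S a b)
    (hS : ∀ x ∈ S, Reach L a x → Reach L x b → x ∈ S') : ReachIn L S' a b := by
  have key : ∀ x, ReachIn L S a x → Reach L x b → ReachIn L S' a x := by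
    rintro x ⟨ha, hx⟩
    induction hx with
    | refl => exact fun h => .refl (hS _ ha .refl h)
    | @tail y z hy hyz ih =>
      intro hz
      refine (ih (hz.head hyz.1)).tail hyz.1 (hS _ hyz.2 ?_ hz)
      exact (ReachIn.tail ⟨ha, hy⟩ hyz.1 hyz.2).reach
  exact key b h .refl

theorem Reach.reachIn {S : Set ℕ} {a b : ℕ} (h : Reach L a b)
    (hS : ∀ x, Reach L a x → Reach L x b → x ∈ S) : ReachIn L S a b :=
  ReachIn.confine (S := Set.univ)
      ⟨trivial, Relation.ReflTransGen.mono (fun _ _ h => ⟨h, trivial⟩) _ _ h⟩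
    fun x _ => hS x

theorem ReachIn.symm {S : Set ℕ} {a b : ℕ} (h : ReachIn L S a b) :
    ReachIn L (ng ⁻¹' S) (ng b) (ng a) := by
  obtain ⟨ha, h⟩ := h
  induction h with
  | refl => exact .refl (by simpa using ha)
  | tail _ h ih => exact ih.head (by simpa using h.2) h.1.symm

theorem Detour.symm {S : Set ℕ} {v w : ℕ} (h : Detour L S v w) :
    Detour L (ng ⁻¹' S) w v := by
  obtain ⟨q, r, hq, hr, h⟩ := h
  exact ⟨r, q, hr, hq, by simpa using h.symm⟩

theorem Detour.mono {S S' : Set ℕ} {v w : ℕ} (h : Detour L S v w) (hL : L ⊆ L')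
    (hS : S ⊆ S') : Detour L' S' v w := by
  obtain ⟨q, r, hq, hr, h⟩ := h
  exact ⟨q, r, hL hq, hL hr, h.mono hL hS⟩

theorem Network.restrict (h : Network X Mu L) (hX : X' ⊆ X) (hL : L' ⊆ L)
    (hlive : ∀ v, Live X' Mu' L' v → Live X Mu L v)
    (hreach : ∀ v ∈ X', ∀ w ∈ X', v ≠ w → Reach L' (ng v) w) : Network X' Mu' L' where
  not_mem_ng v hv a ha := h.not_mem_ng v (hX hv) a (hL ha)
  reach := hreach
  not_reach v hv h' := h.not_reach v (hX hv) (Reach.mono hL h')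
  acyclic a ha := h.acyclic a (Relation.TransGen.mono (fun _ _ h => hL h) _ _ ha)
  no_detour v w hv hw S₁ S₂ hS h₁ h₂ :=
    h.no_detour v w (hlive v hv) (hlive w hw) S₁ S₂ hS (h₁.mono hL subset_rfl)
      (h₂.imp (fun h => h.mono hL subset_rfl) (fun h => hL h))

theorem Live.mono (hX : X' ⊆ X) (hM : Mu ⊆ Mu') (hL : L' ⊆ L) {v : ℕ}
    (h : Live X' Mu' L' v) : Live X Mu L v := by
  induction h with
  | base h h' => exact .base (hX h) fun h => h' (hM h)
  | step h h' _ ih => exact .step (fun h' => h (hM h')) (hL h') ih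

theorem Network.mono_multi (h : Network X Mu L) (hM : Mu ⊆ Mu') : Network X Mu' L :=
  h.restrict subset_rfl subset_rfl (fun _ => .mono subset_rfl hM subset_rfl) h.reach

theorem Network.reach_ng_ne (h : Network X Mu L) {v a : ℕ} (hv : v ∈ X)
    (ha : Reach L a (ng v)) : a = ng v := by
  rcases Relation.ReflTransGen.cases_tail ha with h' | ⟨b, -, hb⟩
  · exact h'.symm
  · exact absurd (by rw [Sym2.eq_swap]; exact hb) (h.not_mem_ng v hv (ng b))

/-- Removing a base label together with its incident clauses. -/
theorem Network.delete (h : Network X Mu L) {v : ℕ} (hv : v ∈ X) :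
    Network (X.erase v) (Mu.erase v) (L.filter (v ∉ ·)) := by
  have hL : L.filter (v ∉ ·) ⊆ L := Finset.filter_subset _ _
  refine h.restrict (Finset.erase_subset _ _) hL ?_ ?_
  · intro w hw
    have : Live X Mu L w ∧ w ≠ v := by
      induction hw with
      | @base w h1 h2 =>
        have := Finset.ne_of_mem_erase h1
        refine ⟨.base (Finset.mem_of_mem_erase h1) fun h' => h2 ?_, this⟩
        exact Finset.mem_erase.2 ⟨this, h'⟩
      | @step w a h1 h2 _ ih =>
        have : w ≠ v := by
          rintro rfl
          exact h.not_mem_ng w hv _ (hL h2)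
        exact ⟨.step (fun h' => h1 (Finset.mem_erase.2 ⟨this, h'⟩)) (hL h2) ih.1, this⟩
    exact this.1
  · intro w hw w' hw' hne
    obtain ⟨hwv, hw⟩ := Finset.mem_erase.1 hw
    obtain ⟨hwv', hw'⟩ := Finset.mem_erase.1 hw'
    have key : ∀ y, Reach L (ng w) y → y ≠ v → Reach (L.filter (v ∉ ·)) (ng w) y := by
      intro y hy
      induction hy with
      | refl => exact fun _ => .refl
      | @tail x y hx hxy ih =>
        intro hyv
        refine (ih ?_).tail ?_
        · rintro rfl
          exact h.not_mem_ng x hv _ hxy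
        · refine Finset.mem_filter.2 ⟨hxy, ?_⟩
          rw [Sym2.mem_iff]
          rintro (h' | h')
          · have hxe : x = ng v := by rw [h', ng_ng]
            have := h.reach_ng_ne hv (hxe ▸ hx)
            exact hwv (ng_inj.1 this)
          · exact hyv h'.symm
    exact key w' (h.reach w hw w' hw' hne) hwv'

/-- A clause off all base-to-base walks is superfluous. -/
theorem Network.erase (h : Network X Mu L) {a b : ℕ}
    (hab : ∀ v ∈ X, ∀ w ∈ X, Reach L (ng v) (ng a) → ¬ Reach L b w) :
    Network X Mu (L.erase s(a, b)) := by
  have hL : L.erase s(a, b) ⊆ L := Finset.erase_subset _ _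
  refine h.restrict subset_rfl hL (fun _ => .mono subset_rfl subset_rfl hL) ?_
  intro v hv w hw hne
  have key : ∀ y, Reach L (ng v) y → Reach L y w → Reach (L.erase s(a, b)) (ng v) y := by
    intro y hy
    induction hy with
    | refl => exact fun _ => .refl
    | @tail x y hx hxy ih =>
      intro hyw
      refine (ih (hyw.head hxy)).tail (Finset.mem_erase.2 ⟨?_, hxy⟩)
      rw [Ne, Sym2.eq_iff]
      rintro (⟨rfl, rfl⟩ | ⟨rfl, rfl⟩)
      · exact hab v hv w hw (by simpa using hx) hyw
      · exact hab w hw v hv hyw.symm (by simpa using Reach.symm hx)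
  exact key w (h.reach v hv w hw hne) .refl

end

section
variable {X X' Mu Mu' : Finset ℕ} {L L' : Finset (Sym2 ℕ)}

theorem Detour.confine {S : Set ℕ} {v w : ℕ} (hA : ∀ a, ¬ Relation.TransGen (Arc L) a a)
    (h : Detour L S v w) : Detour L (S \ {ng v, w}) v w := by
  obtain ⟨q, r, hq, hr, h⟩ := h
  refine ⟨q, r, hq, hr, h.confine ?_⟩
  intro x hx hqx hxr
  refine ⟨hx, ?_⟩
  rintro (rfl | rfl)
  · exact hA _ (.head' (arc_ng.2 hq) hqx)
  · refine hA _ (.tail' hxr ?_)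
    simpa [Arc, Sym2.eq_swap] using hr

/-- Identify the literal `ng p` with `b`, and `p` with `ng b`. -/
def fold (p b a : ℕ) : ℕ := if a = ng p then b else if a = p then ng b else a

theorem Detour.unfold_left {S : Set ℕ} {p b w : ℕ} (he : s(p, b) ∈ L)
    (h : Detour L S (ng p) w ∨ s(ng p, w) ∈ L) : Detour L (insert p S) b w := by
  have he' : s(b, p) ∈ L := by rwa [Sym2.eq_swap]
  rcases h with ⟨q, r, hq, hr, h⟩ | h
  · exact ⟨p, r, he', hr, (h.mono subset_rfl (Set.subset_insert _ _)).head
      (Set.mem_insert _ _) hq⟩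
  · exact ⟨p, ng p, he', by rwa [Sym2.eq_swap], by simpa using .refl (Set.mem_insert _ _)⟩

theorem Detour.join {S₁ S₂ : Set ℕ} {p b v₁ v₂ w₁ w₂ : ℕ} (he : s(p, b) ∈ L)
    (hS : Disjoint S₁ S₂)
    (hv : v₁ = v₂ ∨ p ∉ S₁ ∧ p ∉ S₂ ∧ (v₁ = b ∧ v₂ = ng p ∨ v₁ = ng p ∧ v₂ = b))
    (h₁ : Detour L S₁ v₁ w₁) (h₂ : Detour L S₂ v₂ w₂ ∨ s(v₂, w₂) ∈ L) :
    ∃ v, (v = v₁ ∨ v = v₂) ∧ ∃ T₁ T₂ : Set ℕ, Disjoint T₁ T₂ ∧ T₁ ⊆ insert p S₁ ∧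
      T₂ ⊆ insert p S₂ ∧ Detour L T₁ v w₁ ∧ (Detour L T₂ v w₂ ∨ s(v, w₂) ∈ L) := by
  rcases hv with rfl | ⟨hp₁, hp₂, ⟨rfl, rfl⟩ | ⟨rfl, rfl⟩⟩
  · exact ⟨v₁, .inl rfl, S₁, S₂, hS, Set.subset_insert _ _, Set.subset_insert _ _, h₁, h₂⟩
  · exact ⟨v₁, .inl rfl, S₁, insert p S₂, by simp [hp₁, hS], Set.subset_insert _ _, subset_rfl,
      h₁, .inl (Detour.unfold_left he h₂)⟩
  · exact ⟨v₂, .inr rfl, insert p S₁, S₂, by simp [hp₂, hS], subset_rfl, Set.subset_insert _ _,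
      Detour.unfold_left he (.inl h₁), h₂⟩

theorem Network.contract (h : Network X Mu L) {p b : ℕ} (hpX : p ∉ X) (hbp : b ≠ p)
    (he : s(p, b) ∈ L) (hu : ∀ a, s(p, a) ∈ L → a = b) :
    Network X (Mu.image (fold p b)) ((L.erase s(p, b)).image (Sym2.map (fold p b))) := by
  set F := fold p b with hF
  set L' := (L.erase s(p, b)).image (Sym2.map F) with hL'
  have hbn : b ≠ ng p := by
    rintro rfl
    exact h.acyclic (ng p) (.single (by simpa [Arc] using he))
  have hpn : p ≠ ng p := (ng_ne p).symm
  have hnb : ng b ≠ p := fun h => hbn (ng_eq_comm.1 h)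
  have hnbn : ng b ≠ ng p := fun h => hbp (ng_inj.1 h)
  have Fp : F p = ng b := by simp [hF, fold, hpn]
  have Fn : F (ng p) = b := by simp [hF, fold]
  have Fo : ∀ a, a ≠ p → a ≠ ng p → F a = a := fun a h1 h2 => by simp [hF, fold, h1, h2]
  have Fng : ∀ a, F (ng a) = ng (F a) := by
    intro a
    by_cases h1 : a = p
    · subst h1; rw [Fp, Fn, ng_ng]
    by_cases h2 : a = ng p
    · subst h2; rw [Fn, ng_ng, Fp]
    rw [Fo a h1 h2, Fo]
    · exact fun h => h2 (ng_eq_comm.1 h)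
    · exact fun h => h1 (ng_inj.1 h)
  have Fcase : ∀ a, a ≠ p → F a = a ∨ a = ng p ∧ F a = b := by
    intro a h1
    by_cases h2 : a = ng p
    · exact .inr ⟨h2, h2 ▸ Fn⟩
    · exact .inl (Fo a h1 h2)
  have FF : ∀ a, F (F a) = F a := by
    intro a
    by_cases h1 : a = p
    · rw [h1, Fp, Fo _ hnb hnbn]
    rcases Fcase a h1 with h2 | ⟨-, h2⟩
    · rw [h2, h2]
    · rw [h2, Fo _ hbp hbn]
  have Fne : ∀ a, F a ≠ p ∧ F a ≠ ng p := by
    intro a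
    by_cases h1 : a = p
    · rw [h1, Fp]; exact ⟨hnb, hnbn⟩
    by_cases h2 : a = ng p
    · rw [h2, Fn]; exact ⟨hbp, hbn⟩
    rw [Fo a h1 h2]; exact ⟨h1, h2⟩
  have arcp : Arc L (ng b) p := by simpa [Arc, Sym2.eq_swap] using he
  have arcn : Arc L (ng p) b := by simpa [Arc] using he
  have edge : ∀ x y, s(x, y) ∈ L' → ∃ x₀ y₀, s(x₀, y₀) ∈ L ∧ x₀ ≠ p ∧ y₀ ≠ p ∧
      F x₀ = x ∧ F y₀ = y := by
    intro x y hxy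
    obtain ⟨e, he', hexy⟩ := Finset.mem_image.1 hxy
    induction e using Sym2.inductionOn with
    | hf x₀ y₀ =>
      obtain ⟨hne, hmem⟩ := Finset.mem_erase.1 he'
      have h1 : x₀ ≠ p := by
        rintro rfl
        exact hne (by rw [hu _ hmem])
      have h2 : y₀ ≠ p := by
        rintro rfl
        rw [Sym2.eq_swap] at hmem hne
        exact hne (by rw [hu _ hmem])
      rw [Sym2.map_mk, Sym2.eq_iff] at hexy
      rcases hexy with ⟨h3, h4⟩ | ⟨h3, h4⟩
      · exact ⟨x₀, y₀, hmem, h1, h2, h3, h4⟩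
      · exact ⟨y₀, x₀, by rwa [Sym2.eq_swap], h2, h1, h4, h3⟩
  have arcF : ∀ x y, Arc L x y → F x = F y ∨ Arc L' (F x) (F y) := by
    intro x y hxy
    by_cases h1 : ng x = p
    · have hy : y = b := hu y (by rw [← h1]; exact hxy)
      have hx : x = ng p := ng_eq_comm.1 h1
      left; rw [hx, hy, Fn, Fo b hbp hbn]
    by_cases h2 : y = p
    · have hx : ng x = b := hu _ (by rw [← h2, Sym2.eq_swap]; exact hxy)
      left; rw [h2, ng_eq_comm.1 hx, Fp, Fo _ hnb hnbn]
    right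
    refine Finset.mem_image.2 ⟨s(ng x, y), Finset.mem_erase.2 ⟨?_, hxy⟩, ?_⟩
    · rw [Ne, Sym2.eq_iff]; tauto
    · rw [Sym2.map_mk, Fng]
  have reachF : ∀ x y, Reach L x y → Reach L' (F x) (F y) := by
    intro x y hxy
    induction hxy with
    | refl => exact .refl
    | tail _ h' ih =>
      rcases arcF _ _ h' with h' | h'
      · rwa [← h']
      · exact ih.tail h'
  have up : ∀ S : Set ℕ, ∀ x, x ≠ p → F x ∈ S → ReachIn L (F ⁻¹' S) x (F x) := by
    intro S x hx hS
    have hxS : x ∈ F ⁻¹' S := hS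
    rcases Fcase x hx with h1 | ⟨h1, h2⟩
    · rw [h1]; exact .refl hxS
    · rw [h2]; exact (ReachIn.refl hxS).tail (h1 ▸ arcn) (by rwa [Set.mem_preimage, Fo b hbp hbn, ← h2])
  have down : ∀ S : Set ℕ, ∀ x, x ≠ ng p → F x ∈ S → ReachIn L (F ⁻¹' S) (F x) x := by
    intro S x hx hS
    have hxS : x ∈ F ⁻¹' S := hS
    by_cases h1 : x = p
    · subst h1
      exact (ReachIn.refl (by rwa [Set.mem_preimage, FF])).tail (by rwa [Fp]) hxS
    · rw [Fo x h1 hx]; exact .refl hxS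
  have lift : ∀ S : Set ℕ, ∀ x y, F x = x → ReachIn L' S x y → ReachIn L (F ⁻¹' S) x y := by
    rintro S x y hFx ⟨hx, hxy⟩
    have hFS : ReachIn L' S x y := ⟨hx, hxy⟩
    induction hxy with
    | refl => exact .refl (by rwa [Set.mem_preimage, hFx])
    | @tail y z hy hyz ih =>
      obtain ⟨x₀, y₀, h0, h1, h2, h3, h4⟩ := edge _ _ hyz.1
      have hyS : y ∈ S := (show ReachIn L' S x y from ⟨hx, hy⟩).mem_right
      have hy' : F (ng x₀) = y := by rw [Fng, h3, ng_ng]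
      have a1 := down S (ng x₀) (fun h => h1 (ng_inj.1 h)) (hy' ▸ hyS)
      have a2 := up S y₀ h2 (h4 ▸ hyz.2)
      rw [hy'] at a1
      rw [h4] at a2
      exact ((ih ⟨hx, hy⟩).trans a1).trans (a2.head a1.mem_right (by simpa [Arc] using h0))
  have detour : ∀ S : Set ℕ, ∀ v w, Detour L' S v w → ∃ v₀ w₀, v₀ ≠ p ∧ w₀ ≠ p ∧ F v₀ = v ∧
      F w₀ = w ∧ Detour L (F ⁻¹' S) v₀ w₀ := by
    rintro S v w ⟨q, r, hq, hr, hqr⟩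
    obtain ⟨v₀, q₀, h0, h1, h2, h3, h4⟩ := edge _ _ hq
    obtain ⟨w₀, r₀, k0, k1, k2, k3, k4⟩ := edge _ _ hr
    refine ⟨v₀, w₀, h1, k1, h3, k3, q₀, r₀, h0, k0, ?_⟩
    have hr' : F (ng r₀) = ng r := by rw [Fng, k4]
    have a1 := up S q₀ h2 (h4 ▸ hqr.1)
    have a2 := down S (ng r₀) (fun h => k2 (ng_inj.1 h)) (hr' ▸ hqr.mem_right)
    rw [h4] at a1
    rw [hr'] at a2
    exact (a1.trans (lift S q _ (by rw [← h4, FF]) hqr)).trans a2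
  have arcT : ∀ x y, Arc L' x y → Relation.TransGen (Arc L) x y := by
    intro x y hxy
    obtain ⟨x₀, y₀, h0, h1, h2, h3, h4⟩ := edge _ _ hxy
    have a1 := (down Set.univ (ng x₀) (fun h => h1 (ng_inj.1 h)) trivial).reach
    have a2 := (up Set.univ y₀ h2 trivial).reach
    rw [Fng, h3, ng_ng] at a1
    rw [h4] at a2
    exact (Relation.TransGen.tail' a1 (by simpa [Arc] using h0)).trans_left a2
  have acyc : ∀ a, ¬ Relation.TransGen (Arc L') a a := by
    intro a ha
    refine h.acyclic a ?_
    have : ∀ y, Relation.TransGen (Arc L') a y → Relation.TransGen (Arc L) a y := by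
      intro y hy
      induction hy with
      | single h => exact arcT _ _ h
      | tail _ h ih => exact ih.trans (arcT _ _ h)
    exact this a ha
  have FX : ∀ v ∈ X, F v = v ∧ F (ng v) = ng v := by
    intro v hv
    have h1 : v ≠ p := fun h => hpX (h ▸ hv)
    have h2 : v ≠ ng p := by
      rintro rfl
      exact h.not_mem_ng _ hv b (by rwa [ng_ng])
    exact ⟨Fo v h1 h2, by rw [Fng, Fo v h1 h2]⟩
  have live : ∀ v, Live X (Mu.image F) L' v → Live X Mu L v ∧ (v = b → Live X Mu L (ng p)) := by
    have mu : ∀ v, F v ∉ Mu.image F → v ∉ Mu := fun v hv h => hv (Finset.mem_image_of_mem F h)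
    have second : ∀ v, v ∉ Mu.image F → Live X Mu L v → v = b → Live X Mu L (ng p) := by
      rintro v hv hl rfl
      exact .step (mu _ (by rwa [Fn])) (by rwa [ng_ng]) hl
    intro v hv
    induction hv with
    | @base v h1 h2 =>
      have : Live X Mu L v := .base h1 (mu v (by rwa [(FX v h1).1]))
      exact ⟨this, second v h2 this⟩
    | @step v a h1 h2 _ ih =>
      obtain ⟨x₀, y₀, k0, k1, k2, k3, k4⟩ := edge _ _ h2
      have hFv : F v = v := by
        have := FF x₀
        rw [k3, Fng] at this
        exact ng_inj.1 this
      have hvM : v ∉ Mu := mu v (by rwa [hFv])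
      have hy : Live X Mu L y₀ := by
        rcases Fcase y₀ k2 with h4 | ⟨h4, h5⟩
        · rw [← h4, k4]; exact ih.1
        · rw [h4]; exact ih.2 (by rw [← k4, h5])
      have : Live X Mu L v := by
        rcases Fcase x₀ k1 with h4 | ⟨h4, h5⟩
        · rw [h4] at k3
          exact .step hvM (k3 ▸ k0) hy
        · have hvb : ng v = b := by rw [← k3, h5]
          have hpM : p ∉ Mu := mu p (by rwa [Fp, ← hvb, ng_ng])
          refine .step hvM (a := p) (by rw [hvb, Sym2.eq_swap]; exact he) ?_
          exact .step hpM (h4 ▸ k0) hy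
      exact ⟨this, second v h1 this⟩
  refine ⟨?_, ?_, ?_, acyc, ?_⟩
  · intro v hv a ha
    obtain ⟨x₀, y₀, h0, h1, h2, h3, h4⟩ := edge _ _ ha
    rcases Fcase x₀ h1 with h5 | ⟨h5, h6⟩
    · exact h.not_mem_ng v hv y₀ (by rwa [← h3, h5])
    · exact h.not_mem_ng v hv p (by rw [← h3, h6, Sym2.eq_swap]; exact he)
  · intro v hv w hw hne
    have := reachF _ _ (h.reach v hv w hw hne)
    rwa [(FX v hv).2, (FX w hw).1] at this
  · intro v hv hr
    refine h.not_reach v hv ?_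
    have : ∀ y, Reach L' (ng v) y → Reach L (ng v) y := by
      intro y hy
      induction hy with
      | refl => exact .refl
      | tail _ h ih => exact ih.trans (arcT _ _ h).to_reflTransGen
    exact this v hr
  · intro v w hv hw S₁ S₂ hS h₁ h₂
    have h₁ := h₁.confine acyc
    replace h₂ := h₂.imp_left (fun h => h.confine acyc)
    obtain ⟨v₁, w₁, a1, a2, a3, a4, D₁⟩ := detour _ _ _ h₁
    obtain ⟨v₂, w₂, b1, b2, b3, b4, D₂⟩ : ∃ v₂ w₂, v₂ ≠ p ∧ w₂ ≠ p ∧ F v₂ = v ∧ F w₂ = w ∧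
        (Detour L (F ⁻¹' (S₂ \ {ng v, w})) v₂ w₂ ∨ s(v₂, w₂) ∈ L) := by
      rcases h₂ with h₂ | h₂
      · obtain ⟨v₂, w₂, b1, b2, b3, b4, D₂⟩ := detour _ _ _ h₂
        exact ⟨v₂, w₂, b1, b2, b3, b4, .inl D₂⟩
      · obtain ⟨v₂, w₂, h0, h1, h2, h3, h4⟩ := edge _ _ h₂
        exact ⟨v₂, w₂, h1, h2, h3, h4, .inr h0⟩
    have hD : Disjoint (F ⁻¹' (S₁ \ {ng v, w})) (F ⁻¹' (S₂ \ {ng v, w})) :=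
      Disjoint.preimage _ (hS.mono Set.sdiff_subset Set.sdiff_subset)
    have fib : ∀ x y z, x ≠ p → y ≠ p → F x = z → F y = z →
        x = y ∨ z = b ∧ (x = b ∧ y = ng p ∨ x = ng p ∧ y = b) := by
      intro x y z hx hy hxz hyz
      rcases Fcase x hx with h1 | ⟨h1, h1'⟩ <;> rcases Fcase y hy with h2 | ⟨h2, h2'⟩
      · left; rw [← h1, hxz, ← hyz, h2]
      · right
        have : z = b := by rw [← hyz, h2']
        exact ⟨this, .inl ⟨by rw [← h1, hxz, this], h2⟩⟩
      · right
        have : z = b := by rw [← hxz, h1']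
        exact ⟨this, .inr ⟨h1, by rw [← h2, hyz, this]⟩⟩
      · left; rw [h1, h2]
    have llive : ∀ x z, x ≠ p → F x = z → Live X (Mu.image F) L' z → Live X Mu L x := by
      intro x z hx hxz hz
      rcases Fcase x hx with h1 | ⟨h1, h1'⟩
      · rw [← h1, hxz]; exact (live z hz).1
      · rw [h1]; exact (live z hz).2 (by rw [← hxz, h1'])
    obtain ⟨v', hv', T₁, T₂, hT, hT₁, hT₂, E₁, E₂⟩ := Detour.join (p := p) (b := b) he hD (by
      rcases fib v₁ v₂ v a1 b1 a3 b3 with h | ⟨h, h'⟩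
      · exact .inl h
      · refine .inr ⟨?_, ?_, h'⟩ <;> simp [Fp, h]) D₁ D₂
    have E₂' : Detour L (ng ⁻¹' T₂) w₂ v' ∨ s(w₂, v') ∈ L :=
      E₂.imp (·.symm) (fun h => by rwa [Sym2.eq_swap])
    obtain ⟨w', hw', U₁, U₂, hU, -, -, G₁, G₂⟩ := Detour.join (p := p) (b := b) he
      (hT.preimage ng) (by
      rcases fib w₁ w₂ w a2 b2 a4 b4 with h | ⟨h, h'⟩
      · exact .inl h
      · refine .inr ⟨?_, ?_, h'⟩
        · intro hh
          rcases hT₁ hh with h3 | h3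
          · exact ng_ne p h3
          · simp [Fn, h] at h3
        · intro hh
          rcases hT₂ hh with h3 | h3
          · exact ng_ne p h3
          · simp [Fn, h] at h3) E₁.symm E₂'
    refine h.no_detour w' v' ?_ ?_ U₁ U₂ hU G₁ G₂
    · rcases hw' with rfl | rfl
      · exact llive _ _ a2 a4 hw
      · exact llive _ _ b2 b4 hw
    · rcases hv' with rfl | rfl
      · exact llive _ _ a1 a3 hv
      · exact llive _ _ b1 b3 hv

end

section
variable {X X' Mu Mu' : Finset ℕ} {L L' : Finset (Sym2 ℕ)}

theorem reach_of_unique {v q : ℕ}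
    (hu : ∀ a, s(v, a) ∈ L → a = q) {y : ℕ} (hy : Reach L (ng v) y) : y = ng v ∨ Reach L q y := by
  rcases Relation.ReflTransGen.cases_head hy with h' | ⟨b, hb, hb'⟩
  · exact .inl h'.symm
  · rw [arc_ng] at hb
    exact .inr (hu b hb ▸ hb')

theorem Network.exists_edge (h : Network X Mu L) (hX : 3 ≤ X.card) {v : ℕ} (hv : v ∈ X) :
    ∃ a, s(v, a) ∈ L := by
  obtain ⟨w, hw⟩ : (X \ {v, ng v}).Nonempty := by
    rw [← Finset.card_pos]
    have := Finset.le_card_sdiff {v, ng v} X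
    have := Finset.card_le_two (a := v) (b := ng v)
    omega
  simp only [Finset.mem_sdiff, Finset.mem_insert, Finset.mem_singleton, not_or] at hw
  rcases Relation.ReflTransGen.cases_head (h.reach v hv w hw.1 (Ne.symm hw.2.1)) with h' | ⟨b, hb, -⟩
  · exact absurd h'.symm hw.2.2
  · exact ⟨b, arc_ng.1 hb⟩

theorem Network.ng_not_mem (h : Network X Mu L) {v a : ℕ} (hva : s(v, a) ∈ L) : ng v ∉ X :=
  fun hv => h.not_mem_ng _ hv a (by rwa [ng_ng])

theorem Network.reduce_pendant (h : Network X Mu L) (hX : 3 ≤ X.card) {v q : ℕ} (hv : v ∈ X)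
    (hu : ∀ a, s(v, a) ∈ L → a = q) :
    ∃ Mu' L', Network X Mu' L' ∧ L'.card < L.card ∧ Mu'.card ≤ Mu.card := by
  have hvq : s(v, q) ∈ L := by
    obtain ⟨a, ha⟩ := h.exists_edge hX hv
    exact hu a ha ▸ ha
  have hnv := h.ng_not_mem hvq
  have thr : ∀ w ∈ X, w ≠ v → Reach L q w := by
    intro w hw hwv
    rcases reach_of_unique hu (h.reach v hv w hw hwv.symm) with rfl | h'
    · exact absurd hw hnv
    · exact h'
  have hqv : v ≠ q := by
    rintro rfl
    exact h.not_reach v hv (.single (arc_ng.2 hvq))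
  have hqX : q ∉ X := by
    intro hq
    obtain ⟨w, hw⟩ : (X \ {v, q}).Nonempty := by
      rw [← Finset.card_pos]
      have := Finset.le_card_sdiff {v, q} X
      have := Finset.card_le_two (a := v) (b := q)
      omega
    simp only [Finset.mem_sdiff, Finset.mem_insert, Finset.mem_singleton, not_or] at hw
    rcases Relation.ReflTransGen.cases_head (thr w hw.1 hw.2.1) with h' | ⟨b, hb, -⟩
    · exact hw.2.2 h'.symm
    · exact h.not_mem_ng q hq b hb
  have hqv' : s(q, v) ∈ L := by rwa [Sym2.eq_swap]
  by_cases hb : ∃ b, b ≠ v ∧ s(q, b) ∈ L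
  · obtain ⟨b, hbv, hb⟩ := hb
    refine ⟨Mu, _, h.erase (a := q) (b := b) ?_, Finset.card_erase_lt_of_mem hb, le_rfl⟩
    intro x hx w hw h1 h2
    have hbq : Arc L (ng b) q := by rw [arc_ng, Sym2.eq_swap]; exact hb
    have h3 : Reach L (ng w) (ng b) := Reach.symm h2
    by_cases hwv : w = v
    · subst hwv
      rcases reach_of_unique hu h3 with h4 | h4
      · exact hbv (ng_inj.1 h4)
      · exact h.acyclic q (.tail' h4 hbq)
    · exact h.not_reach w hw ((h3.tail hbq).trans (thr w hw hwv))
  · push Not at hb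
    refine ⟨_, _, h.contract hqX hqv hqv' (fun a ha => by
      by_contra hne; exact hb a hne ha), ?_, Finset.card_image_le⟩
    exact Finset.card_image_le.trans_lt (Finset.card_erase_lt_of_mem hqv')

/-- The number of clauses containing a label. -/
def deg (L : Finset (Sym2 ℕ)) (v : ℕ) : ℕ := (L.filter (v ∈ ·)).card

theorem exists_of_deg_le_one {v : ℕ} (h : deg L v ≤ 1) : ∃ q, ∀ a, s(v, a) ∈ L → a = q := by
  by_cases hq : ∃ q, s(v, q) ∈ L
  · obtain ⟨q, hq⟩ := hq
    refine ⟨q, fun a ha => ?_⟩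
    have := Finset.card_le_one.1 h s(v, a) (by simp [ha]) s(v, q) (by simp [hq])
    exact Sym2.congr_right.1 this
  · push Not at hq
    exact ⟨0, fun a ha => absurd ha (hq a)⟩

theorem exists_of_deg_eq_two {v : ℕ} (h : deg L v = 2) :
    ∃ a b, a ≠ b ∧ ∀ c, s(v, c) ∈ L ↔ c = a ∨ c = b := by
  obtain ⟨e, f, hef, h⟩ := Finset.card_eq_two.1 h
  have he : e ∈ L.filter (v ∈ ·) := by simp [h]
  have hf : f ∈ L.filter (v ∈ ·) := by simp [h]
  obtain ⟨he, a, rfl⟩ := Finset.mem_filter.1 he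
  obtain ⟨hf, b, rfl⟩ := Finset.mem_filter.1 hf
  refine ⟨a, b, fun hab => hef (by rw [hab]), fun c => ⟨fun hc => ?_, ?_⟩⟩
  · have : s(v, c) ∈ L.filter (v ∈ ·) := by simp [hc]
    rw [h, Finset.mem_insert, Finset.mem_singleton] at this
    simpa only [Sym2.congr_right] using this
  · rintro (rfl | rfl) <;> assumption

theorem exists_of_deg_le_two {p v : ℕ} (h : deg L p ≤ 2) (hv : s(p, v) ∈ L) :
    (∀ a, s(p, a) ∈ L → a = v) ∨
      ∃ b, b ≠ v ∧ s(p, b) ∈ L ∧ ∀ a, s(p, a) ∈ L → a = v ∨ a = b := by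
  by_cases hb : ∃ b, b ≠ v ∧ s(p, b) ∈ L
  · obtain ⟨b, hbv, hb⟩ := hb
    refine .inr ⟨b, hbv, hb, fun a ha => ?_⟩
    by_contra! hne
    have h3 : ({s(p, v), s(p, b), s(p, a)} : Finset (Sym2 ℕ)) ⊆ L.filter (p ∈ ·) := by
      intro e he
      simp only [Finset.mem_insert, Finset.mem_singleton] at he
      rcases he with rfl | rfl | rfl <;> simp [*]
    have := Finset.card_le_card h3
    rw [Finset.card_eq_three.2 ⟨_, _, _, ?_, ?_, ?_, rfl⟩] at this
    · unfold deg at h; omega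
    all_goals rw [Ne, Sym2.congr_right]; tauto
  · push Not at hb
    exact .inl fun a ha => by by_contra hne; exact hb a hne ha

theorem sum_deg_le (V : Finset ℕ) : ∑ v ∈ V, deg L v ≤ 2 * L.card := by
  unfold deg
  have := Finset.sum_card_bipartiteAbove_eq_sum_card_bipartiteBelow (s := V) (t := L)
    (r := fun v e => v ∈ e)
  simp only [Finset.bipartiteAbove, Finset.bipartiteBelow] at this
  rw [this, mul_comm, ← smul_eq_mul, ← Finset.sum_const]
  refine Finset.sum_le_sum fun e _ => ?_
  induction e using Sym2.inductionOn with
  | hf a b =>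
    refine (Finset.card_le_card (t := {a, b}) ?_).trans Finset.card_le_two
    intro x hx
    simpa using (Finset.mem_filter.1 hx).2

theorem card_filter_not_mem (v : ℕ) : (L.filter (v ∉ ·)).card + deg L v = L.card := by
  have := Finset.card_filter_add_card_filter_not (s := L) (v ∈ ·)
  unfold deg; omega

theorem Network.exists_interior (h : Network X Mu L)
    (hbb : ∀ u ∈ X, ∀ v ∈ X, s(u, v) ∉ L) {u v : ℕ} (hu : u ∈ X) (hv : v ∈ X) (huv : u ≠ v)
    (ha : ∃ a, s(u, a) ∈ L) : ∃ q r, s(u, q) ∈ L ∧ s(v, r) ∈ L ∧ Reach L q (ng r) := by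
  obtain ⟨a, ha⟩ := ha
  rcases Relation.ReflTransGen.cases_head (h.reach u hu v hv huv) with h1 | ⟨q, hq, h1⟩
  · exact absurd (h1 ▸ hv) (h.ng_not_mem ha)
  rw [arc_ng] at hq
  rcases Relation.ReflTransGen.cases_tail h1 with h2 | ⟨r, h2, hr⟩
  · exact absurd (h2 ▸ hq) (hbb u hu v hv)
  · exact ⟨q, ng r, hq, by rw [Sym2.eq_swap]; exact hr, by rwa [ng_ng]⟩

/-- Two base labels with a common neighbour have no other shared neighbours. -/
theorem Network.not_shared (h : Network X Mu L) (hM : ∀ v ∈ X, v ∉ Mu)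
    (hbb : ∀ u ∈ X, ∀ v ∈ X, s(u, v) ∉ L) {x y w p c e g : ℕ}
    (hx : x ∈ X) (hy : y ∈ X) (hw : w ∈ X) (hxy : x ≠ y) (hwx : w ≠ x)
    (hxL : ∀ a, s(x, a) ∈ L ↔ a = p ∨ a = c) (hyL : ∀ a, s(y, a) ∈ L ↔ a = p ∨ a = e)
    (hwL : ∀ a, s(w, a) ∈ L ↔ a = c ∨ a = g) : False := by
  have bad : ∀ v ∈ X, ∀ q r, s(v, q) ∈ L → s(v, r) ∈ L → ¬ Reach L q (ng r) := by
    intro v hv q r hq hr hqr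
    refine h.not_reach v hv ((hqr.head (arc_ng.2 hq)).tail ?_)
    rw [arc_ng, Sym2.eq_swap]; exact hr
  have h1 : Reach L c (ng e) := by
    obtain ⟨q, r, hq, hr, hqr⟩ := h.exists_interior hbb hx hy hxy ⟨p, by simp [hxL]⟩
    have hq' := hq
    have hr' := hr
    rw [hxL] at hq
    rw [hyL] at hr
    rcases hr with rfl | rfl
    · exact absurd hqr (bad x hx _ _ hq' (by simp [hxL]))
    · rcases hq with rfl | rfl
      · exact absurd hqr (bad y hy _ _ (by simp [hyL]) hr')
      · exact hqr
  have h2 : Reach L g (ng p) := by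
    obtain ⟨q, r, hq, hr, hqr⟩ := h.exists_interior hbb hw hx hwx ⟨c, by simp [hwL]⟩
    have hq' := hq
    have hr' := hr
    rw [hwL] at hq
    rw [hxL] at hr
    rcases hq with rfl | rfl
    · exact absurd hqr (bad x hx _ _ (by simp [hxL]) hr')
    · rcases hr with rfl | rfl
      · exact hqr
      · exact absurd hqr (bad w hw _ _ hq' (by simp [hwL]))
  refine h.no_detour w y (.base hw (hM w hw)) (.base hy (hM y hy)) {u | Reach L c u}
    {u | Reach L c u}ᶜ disjoint_compl_right ⟨c, e, by simp [hwL], by simp [hyL], ?_⟩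
    (.inl ⟨g, p, by simp [hwL], by simp [hyL], ?_⟩)
  · exact Reach.reachIn h1 fun u hu _ => hu
  · exact Reach.reachIn h2 fun u _ hu hcu =>
      bad x hx c p (by simp [hxL]) (by simp [hxL]) (hcu.trans hu)

theorem Network.three_mul_le (h : Network X Mu L) : 3 * X.card ≤ L.card + Mu.card + 6 := by
  induction hN : X.card + L.card using Nat.strong_induction_on generalizing X Mu L with
  | _ N ih =>
  by_contra! hc
  have hX : 3 ≤ X.card := by omega
  have small : ∀ L' Mu', Network X Mu' L' → L'.card < L.card → Mu'.card ≤ Mu.card → False := by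
    intro L' Mu' h' h1 h2
    have := ih _ (by omega) h' rfl
    omega
  have drop : ∀ v ∈ X, ∀ L' Mu', Network (X.erase v) Mu' L' → L'.card + 3 ≤ L.card →
      Mu'.card ≤ Mu.card → False := by
    intro v hv L' Mu' h' h1 h2
    have h3 := Finset.card_erase_of_mem hv
    have := ih _ (by omega) h' rfl
    omega
  have loop : ∀ p, s(p, p) ∉ L := by
    intro p hp
    refine small _ _ (h.erase (a := p) (b := p) ?_) (Finset.card_erase_lt_of_mem hp) le_rfl
    intro v hv w hw h1 h2
    exact h.not_reach v hv ((h1.tail (arc_ng.2 hp)).trans (by simpa using Reach.symm h1))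
  have degX : ∀ v ∈ X, deg L v = 2 ∧ v ∉ Mu := by
    intro v hv
    have h1 : ¬ deg L v ≤ 1 := by
      intro h1
      obtain ⟨q, hq⟩ := exists_of_deg_le_one h1
      obtain ⟨Mu', L', h', h2, h3⟩ := h.reduce_pendant hX hv hq
      exact small _ _ h' h2 h3
    have h2 := card_filter_not_mem (L := L) v
    have h3 := ih _ (by have := Finset.card_erase_of_mem hv; omega) (h.delete hv) rfl
    rw [Finset.card_erase_of_mem hv] at h3
    have h4 := Finset.card_erase_le (s := Mu) (a := v)
    refine ⟨by omega, fun hvM => ?_⟩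
    rw [Finset.card_erase_of_mem hvM] at h3
    have := Finset.card_pos.2 ⟨v, hvM⟩
    omega
  have hsum : 2 * X.card ≤ 2 * L.card := by
    refine le_trans ?_ (sum_deg_le X)
    rw [Finset.sum_congr rfl fun v hv => (degX v hv).1]
    simp [mul_comm]
  have hX4 : 4 ≤ X.card := by omega
  have cardE : ∀ v ∈ X, (X.erase v).card + 1 = X.card := fun v hv =>
    Finset.card_erase_add_one hv
  have cardL : ∀ v ∈ X, (L.filter (v ∉ ·)).card + 2 = L.card := fun v hv => by
    rw [← (degX v hv).1]; exact card_filter_not_mem v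
  have nbr : ∀ v ∈ X, ∀ q, s(v, q) ∈ L → ∃ c, c ≠ q ∧ ∀ a, s(v, a) ∈ L ↔ a = q ∨ a = c := by
    intro v hv q hq
    obtain ⟨a, b, hab, h'⟩ := exists_of_deg_eq_two (degX v hv).1
    rcases (h' q).1 hq with rfl | rfl
    · exact ⟨b, hab.symm, h'⟩
    · exact ⟨a, hab, fun c => (h' c).trans Or.comm⟩
  have hbb : ∀ u ∈ X, ∀ v ∈ X, s(u, v) ∉ L := by
    intro v hv w hw hvw
    have hne : w ≠ v := by rintro rfl; exact loop _ hvw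
    obtain ⟨c, hc1, hc2⟩ := nbr w hw v (by rwa [Sym2.eq_swap])
    obtain ⟨Mu', L', h', h1, h2⟩ := (h.delete hv).reduce_pendant (v := w) (q := c)
      (by have := cardE v hv; omega) (Finset.mem_erase.2 ⟨hne, hw⟩) (by
        intro a ha
        obtain ⟨ha, ha'⟩ := Finset.mem_filter.1 ha
        rw [Sym2.mem_iff] at ha'
        rcases (hc2 a).1 ha with rfl | rfl
        · exact absurd (.inr rfl) ha'
        · rfl)
    refine drop v hv _ _ h' ?_ (h2.trans (Finset.card_erase_le))
    have := cardL v hv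
    omega
  have degN : ∀ v ∈ X, ∀ p, s(v, p) ∈ L → 3 ≤ deg L p := by
    intro v hv p hvp
    by_contra! hd
    have hpX : p ∉ X := fun hp => hbb v hv p hp hvp
    have hpv : s(p, v) ∈ L := by rwa [Sym2.eq_swap]
    have hvp' : v ≠ p := by rintro rfl; exact hpX hv
    rcases exists_of_deg_le_two (by omega) hpv with h1 | ⟨b, hb, hpb, h1⟩
    · refine small _ _ (h.contract hpX hvp' hpv h1) ?_ Finset.card_image_le
      exact Finset.card_image_le.trans_lt (Finset.card_erase_lt_of_mem hpv)
    · have hbp : b ≠ p := by rintro rfl; exact loop _ hpb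
      have hmem : s(p, b) ∈ L.filter (v ∉ ·) := by
        simp [hpb, hvp', hb.symm]
      refine drop v hv _ _ ((h.delete hv).contract (fun hp => hpX (Finset.mem_of_mem_erase hp)) hbp
        hmem ?_) ?_ (Finset.card_image_le.trans Finset.card_erase_le)
      · intro a ha
        obtain ⟨ha, ha'⟩ := Finset.mem_filter.1 ha
        rcases h1 a ha with rfl | rfl
        · simp at ha'
        · rfl
      · have h2 := cardL v hv
        have h3 := Finset.card_erase_lt_of_mem hmem
        have h4 := Finset.card_image_le (s := (L.filter (v ∉ ·)).erase s(p, b))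
          (f := Sym2.map (fold p b))
        omega
  choose! α β hαβ hnb using fun v hv => exists_of_deg_eq_two (degX v hv).1
  set N : Finset ℕ := X.biUnion fun v => {α v, β v} with hNdef
  have memN : ∀ p, p ∈ N ↔ ∃ v ∈ X, s(v, p) ∈ L := by
    intro p
    simp only [hNdef, Finset.mem_biUnion, Finset.mem_insert, Finset.mem_singleton]
    exact exists_congr fun v => and_congr_right fun hv => (hnb v hv p).symm
  have hdisj : Disjoint X N := by
    rw [Finset.disjoint_right]
    intro p hp hpX
    obtain ⟨v, hv, hvp⟩ := (memN p).1 hp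
    exact hbb v hv p hpX hvp
  let H : ℕ → Finset ℕ := fun p => X.filter (s(·, p) ∈ L)
  have sumH : ∑ p ∈ N, (H p).card = 2 * X.card := by
    have := Finset.sum_card_bipartiteAbove_eq_sum_card_bipartiteBelow (s := X) (t := N)
      (r := fun v p => s(v, p) ∈ L)
    simp only [Finset.bipartiteAbove, Finset.bipartiteBelow] at this
    rw [← this, mul_comm, ← smul_eq_mul, ← Finset.sum_const]
    refine Finset.sum_congr rfl fun v hv => ?_
    rw [← Finset.card_pair (hαβ v hv)]
    congr 1
    ext p
    simp only [Finset.mem_filter, memN, Finset.mem_insert, Finset.mem_singleton]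
    rw [hnb v hv p]
    exact ⟨fun h => h.2, fun h => ⟨⟨v, hv, (hnb v hv p).2 h⟩, h⟩⟩
  have degH : ∀ p ∈ N, (H p).card + (if (H p).card = 1 then 2 else 0) ≤ deg L p := by
    intro p hp
    split_ifs with h1
    · obtain ⟨v, hv, hvp⟩ := (memN p).1 hp
      have := degN v hv p hvp
      omega
    · rw [add_zero]
      refine Finset.card_le_card_of_injOn (fun v => s(v, p)) ?_ ?_
      · intro v hv
        have hv := Finset.mem_coe.1 hv
        simp only [H, Finset.mem_filter] at hv
        simp [hv.2]
      · intro v _ w _ hvw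
        exact Sym2.congr_left.1 hvw
  have single : ∀ v ∈ X, ∃ p ∈ N, H p = {v} := by
    intro v hv
    have own : ∀ p, s(v, p) ∈ L → (∀ w ∈ X, s(w, p) ∈ L → w = v) → p ∈ N ∧ H p = {v} := by
      intro p hp hw
      refine ⟨(memN p).2 ⟨v, hv, hp⟩, ?_⟩
      ext w
      simp only [H, Finset.mem_filter, Finset.mem_singleton]
      exact ⟨fun h => hw w h.1 h.2, by rintro rfl; exact ⟨hv, hp⟩⟩
    by_contra! hno
    have h1 : s(v, α v) ∈ L := (hnb v hv _).2 (.inl rfl)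
    have h2 : s(v, β v) ∈ L := (hnb v hv _).2 (.inr rfl)
    obtain ⟨y, hy, hyp, hyv⟩ : ∃ y ∈ X, s(y, α v) ∈ L ∧ y ≠ v := by
      by_contra! hh
      obtain ⟨h3, h4⟩ := own _ h1 hh
      exact hno _ h3 h4
    obtain ⟨w, hw, hwp, hwv⟩ : ∃ y ∈ X, s(y, β v) ∈ L ∧ y ≠ v := by
      by_contra! hh
      obtain ⟨h3, h4⟩ := own _ h2 hh
      exact hno _ h3 h4
    obtain ⟨e, -, he⟩ := nbr y hy _ hyp
    obtain ⟨g, -, hg⟩ := nbr w hw _ hwp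
    exact h.not_shared (fun v hv => (degX v hv).2) hbb hv hy hw hyv.symm hwv (hnb v hv) he hg
  choose! f hfN hfH using single
  have count : X.card ≤ (N.filter fun p => (H p).card = 1).card := by
    refine Finset.card_le_card_of_injOn f ?_ ?_
    · intro v hv
      simp [hfN v hv, hfH v hv]
    · intro v hv w hw hvw
      have h1 := hfH v hv
      rw [hvw, hfH w hw] at h1
      exact (Finset.singleton_injective h1).symm
  have total := sum_deg_le (L := L) (X ∪ N)
  rw [Finset.sum_union hdisj, Finset.sum_congr rfl fun v hv => (degX v hv).1] at total
  have h5 := Finset.sum_le_sum degH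
  rw [Finset.sum_add_distrib, sumH, ← Finset.sum_filter, Finset.sum_const] at h5
  simp only [Finset.sum_const, smul_eq_mul] at total h5
  omega

end

section
variable {X X' Mu Mu' : Finset ℕ} {L L' : Finset (Sym2 ℕ)}

/-- Routing a biclique of clauses through a fresh label. -/
theorem Network.biclique (h : Network X Mu L) {A B : Finset ℕ} (hA : A.Nonempty)
    (hB : B.Nonempty) (hAB : ∀ c ∈ A, ∀ d ∈ B, s(c, d) ∈ L) (hloop : ∀ a, s(a, a) ∉ L) {ζ : ℕ}
    (hζL : ∀ a, s(ζ, a) ∉ L ∧ s(ng ζ, a) ∉ L) (hζX : ζ ∉ X ∧ ng ζ ∉ X)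
    (hsub : ∀ e ∈ L', e ∈ L ∨ (∃ c ∈ A, e = s(c, ζ)) ∨ ∃ d ∈ B, e = s(d, ng ζ))
    (hkeep : ∀ e ∈ L, e ∈ L' ∨ ∃ c ∈ A, ∃ d ∈ B, e = s(c, d))
    (hA' : ∀ c ∈ A, s(c, ζ) ∈ L') (hB' : ∀ d ∈ B, s(d, ng ζ) ∈ L')
    (hrem : ∀ c ∈ A, ∀ d ∈ B, c ∉ Mu → d ∉ Mu → s(c, d) ∉ L') : Network X Mu L' := by
  have hnn : ng ζ ≠ ζ := ng_ne ζ
  have hBA : ∀ d ∈ B, ∀ c ∈ A, s(d, c) ∈ L := fun d hd c hc => by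
    rw [Sym2.eq_swap]; exact hAB c hc d hd
  have oldL : ∀ a b, s(a, b) ∈ L → a ≠ ζ ∧ a ≠ ng ζ := by
    intro a b hab
    constructor <;> rintro rfl
    exacts [(hζL b).1 hab, (hζL b).2 hab]
  have oldA : ∀ c ∈ A, c ≠ ζ ∧ c ≠ ng ζ := fun c hc => oldL _ _ (hAB c hc _ hB.choose_spec)
  have oldB : ∀ d ∈ B, d ≠ ζ ∧ d ≠ ng ζ := fun d hd => oldL _ _ (hBA d hd _ hA.choose_spec)
  have oldN : ∀ a, a ≠ ζ ∧ a ≠ ng ζ → ng a ≠ ζ ∧ ng a ≠ ng ζ := fun a ha =>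
    ⟨fun h => ha.2 (ng_eq_comm.1 h), fun h => ha.1 (ng_inj.1 h)⟩
  have edgeζ : ∀ a, s(ζ, a) ∈ L' → a ∈ A := by
    intro a ha
    rcases hsub _ ha with h' | ⟨c, hc, h'⟩ | ⟨d, hd, h'⟩
    · exact absurd h' (hζL a).1
    · rw [Sym2.eq_swap, Sym2.congr_left] at h'; exact h' ▸ hc
    · rw [Sym2.eq_iff] at h'
      rcases h' with ⟨h1, -⟩ | ⟨h1, -⟩
      · exact absurd h1.symm (oldB d hd).1
      · exact absurd h1.symm hnn
  have edgen : ∀ a, s(ng ζ, a) ∈ L' → a ∈ B := by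
    intro a ha
    rcases hsub _ ha with h' | ⟨c, hc, h'⟩ | ⟨d, hd, h'⟩
    · exact absurd h' (hζL a).2
    · rw [Sym2.eq_iff] at h'
      rcases h' with ⟨h1, -⟩ | ⟨h1, -⟩
      · exact absurd h1.symm (oldA c hc).2
      · exact absurd h1 hnn
    · rw [Sym2.eq_swap, Sym2.congr_left] at h'; exact h' ▸ hd
  have edgeζ' : ∀ a, s(a, ζ) ∈ L' → a ∈ A := fun a ha => edgeζ a (by rwa [Sym2.eq_swap])
  have edgen' : ∀ a, s(a, ng ζ) ∈ L' → a ∈ B := fun a ha => edgen a (by rwa [Sym2.eq_swap])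
  have edgeo : ∀ a b, a ≠ ζ ∧ a ≠ ng ζ → b ≠ ζ ∧ b ≠ ng ζ → s(a, b) ∈ L' → s(a, b) ∈ L := by
    intro a b ha hb hab
    rcases hsub _ hab with h' | ⟨c, hc, h'⟩ | ⟨d, hd, h'⟩
    · exact h'
    all_goals
      rw [Sym2.eq_iff] at h'
      exfalso
      tauto
  have split : ∀ a, (a ≠ ζ ∧ a ≠ ng ζ) ∨ a = ζ ∨ a = ng ζ := by intro a; tauto
  have sim : ∀ S : Set ℕ, ∀ q, (q ≠ ζ ∧ q ≠ ng ζ) → ∀ y, ReachIn L' S q y →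
      ((y ≠ ζ ∧ y ≠ ng ζ) → ReachIn L S q y) ∧ (y = ζ → ∃ c ∈ A, ReachIn L S q (ng c)) ∧
      (y = ng ζ → ∃ d ∈ B, ReachIn L S q (ng d)) := by
    rintro S q hq y ⟨hqS, hy⟩
    induction hy with
    | refl => exact ⟨fun _ => .refl hqS, fun h => absurd h hq.1, fun h => absurd h hq.2⟩
    | @tail y z _ hyz ih =>
      obtain ⟨hyz, hz⟩ := hyz
      unfold Arc at hyz
      refine ⟨fun hzo => ?_, ?_, ?_⟩
      · rcases split y with hy | rfl | rfl
        · exact (ih.1 hy).tail (edgeo _ _ (oldN y hy) hzo hyz) hz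
        · obtain ⟨c, hc, hqc⟩ := ih.2.1 rfl
          exact hqc.tail (arc_ng.2 (hAB c hc z (edgen z hyz))) hz
        · obtain ⟨d, hd, hqd⟩ := ih.2.2 rfl
          rw [ng_ng] at hyz
          exact hqd.tail (arc_ng.2 (hBA d hd z (edgeζ z hyz))) hz
      · rintro rfl
        have hy := edgeζ' _ hyz
        refine ⟨_, hy, ?_⟩
        rw [ng_ng]
        exact ih.1 (by simpa using oldN _ (oldA _ hy))
      · rintro rfl
        have hy := edgen' _ hyz
        refine ⟨_, hy, ?_⟩
        rw [ng_ng]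
        exact ih.1 (by simpa using oldN _ (oldB _ hy))
  have simR : ∀ q, (q ≠ ζ ∧ q ≠ ng ζ) → ∀ y, (y ≠ ζ ∧ y ≠ ng ζ) →
      Relation.TransGen (Arc L') q y → Relation.TransGen (Arc L) q y := by
    intro q hq y hy hqy
    obtain ⟨x, hqx, hxy⟩ := Relation.TransGen.tail'_iff.1 hqy
    have := sim Set.univ q hq x (Reach.reachIn hqx fun _ _ _ => trivial)
    unfold Arc at hxy
    rcases split x with hx | rfl | rfl
    · exact .tail' (this.1 hx).reach (edgeo _ _ (oldN x hx) hy hxy)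
    · obtain ⟨c, hc, hqc⟩ := this.2.1 rfl
      exact .tail' hqc.reach (arc_ng.2 (hAB c hc y (edgen y hxy)))
    · obtain ⟨d, hd, hqd⟩ := this.2.2 rfl
      rw [ng_ng] at hxy
      exact .tail' hqd.reach (arc_ng.2 (hBA d hd y (edgeζ y hxy)))
  have oldX : ∀ v ∈ X, v ≠ ζ ∧ v ≠ ng ζ := fun v hv =>
    ⟨fun h => hζX.1 (h ▸ hv), fun h => hζX.2 (h ▸ hv)⟩
  have acyc : ∀ a, ¬ Relation.TransGen (Arc L') a a := by
    have old : ∀ a, (a ≠ ζ ∧ a ≠ ng ζ) → ¬ Relation.TransGen (Arc L') a a := fun a ha h' =>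
      h.acyclic a (simR a ha a ha h')
    intro a ha
    rcases split a with hao | hao
    · exact old a hao ha
    obtain ⟨y, hay, hya⟩ := Relation.TransGen.head'_iff.1 ha
    refine old y ?_ (.tail' hya hay)
    unfold Arc at hay
    rcases hao with rfl | rfl
    · exact oldB _ (edgen _ hay)
    · rw [ng_ng] at hay
      exact oldA _ (edgeζ _ hay)
  have live : ∀ v, Live X Mu L' v → ((v ≠ ζ ∧ v ≠ ng ζ) → Live X Mu L v) ∧
      (v = ng ζ → ∃ c ∈ A, Live X Mu L c) ∧ (v = ζ → ∃ d ∈ B, Live X Mu L d) := by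
    intro v hv
    induction hv with
    | base h1 h2 =>
      exact ⟨fun _ => .base h1 h2, fun h => absurd h (oldX _ h1).2, fun h => absurd h (oldX _ h1).1⟩
    | @step v a h1 h2 _ ih =>
      refine ⟨fun hv => ?_, ?_, ?_⟩
      · rcases split a with ha | rfl | rfl
        · exact .step h1 (edgeo _ _ (oldN _ hv) ha h2) (ih.1 ha)
        · obtain ⟨d, hd, hl⟩ := ih.2.2 rfl
          exact .step h1 (hAB _ (edgeζ' _ h2) d hd) hl
        · obtain ⟨c, hc, hl⟩ := ih.2.1 rfl
          exact .step h1 (hBA _ (edgen' _ h2) c hc) hl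
      · rintro rfl
        rw [ng_ng] at h2
        exact ⟨a, edgeζ _ h2, ih.1 (oldA _ (edgeζ _ h2))⟩
      · rintro rfl
        exact ⟨a, edgen _ h2, ih.1 (oldB _ (edgen _ h2))⟩
  let Lift : ℕ → ℕ → Prop := fun v v' =>
    (v ≠ ζ ∧ v ≠ ng ζ) ∧ v' = v ∨ v = ng ζ ∧ v' ∈ A ∨ v = ζ ∧ v' ∈ B
  have liftOld : ∀ v v', Lift v v' → (v ≠ ζ ∧ v ≠ ng ζ) → v' = v := by
    rintro v v' (⟨-, hv⟩ | ⟨hv, -⟩ | ⟨hv, -⟩) hvo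
    exacts [hv, absurd hv hvo.2, absurd hv hvo.1]
  have exlift : ∀ v, Live X Mu L' v → ∃ v', Lift v v' ∧ Live X Mu L v' := by
    intro v hv
    obtain ⟨h1, h2, h3⟩ := live v hv
    rcases split v with hvo | rfl | rfl
    · exact ⟨v, .inl ⟨hvo, rfl⟩, h1 hvo⟩
    · obtain ⟨d, hd, hl⟩ := h3 rfl
      exact ⟨d, .inr (.inr ⟨rfl, hd⟩), hl⟩
    · obtain ⟨c, hc, hl⟩ := h2 rfl
      exact ⟨c, .inr (.inl ⟨rfl, hc⟩), hl⟩
  have edgeLift : ∀ v v' w w', Lift v v' → Lift w w' → s(v, w) ∈ L' → s(v', w') ∈ L := by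
    intro v v' w w' hv hw hvw
    rcases hv with ⟨hv, rfl⟩ | ⟨rfl, hv⟩ | ⟨rfl, hv⟩
    · rcases hw with ⟨hw, rfl⟩ | ⟨rfl, hw⟩ | ⟨rfl, hw⟩
      · exact edgeo _ _ hv hw hvw
      · exact hBA _ (edgen' _ hvw) _ hw
      · exact hAB _ (edgeζ' _ hvw) _ hw
    · have hwB := edgen _ hvw
      rcases hw with ⟨-, rfl⟩ | ⟨rfl, hw⟩ | ⟨rfl, hw⟩
      · exact hAB _ hv _ hwB
      · exact absurd rfl (oldB _ hwB).2
      · exact absurd rfl (oldB _ hwB).1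
    · have hwA := edgeζ _ hvw
      rcases hw with ⟨-, rfl⟩ | ⟨rfl, hw⟩ | ⟨rfl, hw⟩
      · exact hBA _ hv _ hwA
      · exact absurd rfl (oldA _ hwA).2
      · exact absurd rfl (oldA _ hwA).1
  have left : ∀ S v v' q t, Lift v v' → s(v, q) ∈ L' → ReachIn L' S q t →
      (∃ q', (q' ≠ ζ ∧ q' ≠ ng ζ) ∧ s(v', q') ∈ L ∧ ReachIn L' S q' t) ∨
      (v ∈ A ∧ t = ζ ∧ ζ ∈ S) ∨ (v ∈ B ∧ t = ng ζ ∧ ng ζ ∈ S) := by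
    intro S v v' q t hv hvq hqt
    rcases split q with hq | rfl | rfl
    · exact .inl ⟨q, hq, edgeLift v v' q q hv (.inl ⟨hq, rfl⟩) hvq, hqt⟩
    · have hvA := edgeζ' _ hvq
      have hvv : v' = v := liftOld _ _ hv (oldA v hvA)
      rcases Relation.ReflTransGen.cases_head hqt.2 with rfl | ⟨d, hd, hdt⟩
      · exact .inr (.inl ⟨hvA, rfl, hqt.1⟩)
      · have hdB := edgen d hd.1
        exact .inl ⟨d, oldB d hdB, hvv ▸ hAB v hvA d hdB, hd.2, hdt⟩
    · have hvB := edgen' _ hvq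
      have hvv : v' = v := liftOld _ _ hv (oldB v hvB)
      rcases Relation.ReflTransGen.cases_head hqt.2 with rfl | ⟨c, hc, hct⟩
      · exact .inr (.inr ⟨hvB, rfl, hqt.1⟩)
      · have hcA := edgeζ c (by simpa [Arc] using hc.1)
        exact .inl ⟨c, oldA c hcA, hvv ▸ hBA v hvB c hcA, hc.2, hct⟩
  have detour : ∀ S v v' w w', Lift v v' → Lift w w' → Detour L' S v w → Detour L S v' w' ∨
      (v ∈ A ∧ w ∈ B ∧ ζ ∈ S) ∨ (v ∈ B ∧ w ∈ A ∧ ng ζ ∈ S) := by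
    rintro S v v' w w' hv hw ⟨q, r, hvq, hwr, hqr⟩
    rcases left S v v' q _ hv hvq hqr with ⟨q', hq', hvq', hq'r⟩ | ⟨h1, h2, h3⟩ | ⟨h1, h2, h3⟩
    · obtain ⟨s1, s2, s3⟩ := sim S q' hq' _ hq'r
      refine .inl ?_
      rcases split r with hr | rfl | rfl
      · exact ⟨q', r, hvq', edgeLift w w' r r hw (.inl ⟨hr, rfl⟩) hwr, s1 (oldN r hr)⟩
      · obtain ⟨d, hd, hqd⟩ := s3 rfl
        have hwA := edgeζ' _ hwr
        have hww : w' = w := liftOld _ _ hw (oldA w hwA)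
        exact ⟨q', d, hvq', hww ▸ hAB w hwA d hd, hqd⟩
      · obtain ⟨c, hc, hqc⟩ := s2 (ng_ng ζ)
        have hwB := edgen' _ hwr
        have hww : w' = w := liftOld _ _ hw (oldB w hwB)
        exact ⟨q', c, hvq', hww ▸ hBA w hwB c hc, hqc⟩
    · rw [ng_eq_comm.1 h2] at hwr
      exact .inr (.inl ⟨h1, edgen' _ hwr, h3⟩)
    · rw [ng_inj.1 h2] at hwr
      exact .inr (.inr ⟨h1, edgeζ' _ hwr, h3⟩)
  refine ⟨?_, ?_, ?_, acyc, ?_⟩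
  · intro v hv a ha
    have hnv := oldN v (oldX v hv)
    rcases split a with hao | rfl | rfl
    · exact h.not_mem_ng v hv a (edgeo _ _ hnv hao ha)
    · exact h.not_mem_ng v hv _ (hAB _ (edgeζ' _ ha) _ hB.choose_spec)
    · exact h.not_mem_ng v hv _ (hBA _ (edgen' _ ha) _ hA.choose_spec)
  · intro v hv w hw hne
    have : ∀ y, Reach L (ng v) y → Reach L' (ng v) y := by
      intro y hy
      induction hy with
      | refl => exact .refl
      | @tail x y _ hxy ih =>
        rcases hkeep _ hxy with h' | ⟨c, hc, d, hd, h'⟩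
        · exact ih.tail h'
        · rw [Sym2.eq_iff] at h'
          rcases h' with ⟨h1, rfl⟩ | ⟨h1, rfl⟩
          · refine (ih.tail (b := x) (c := ζ) ?_).tail ?_
            · rw [Arc, h1]; exact hA' c hc
            · rw [Arc, Sym2.eq_swap]; exact hB' _ hd
          · refine (ih.tail (b := x) (c := ng ζ) ?_).tail ?_
            · rw [Arc, h1]; exact hB' d hd
            · rw [Arc, Sym2.eq_swap, ng_ng]; exact hA' _ hc
    exact this w (h.reach v hv w hw hne)
  · intro v hv hr
    exact h.not_reach v hv ((sim Set.univ _ (oldN v (oldX v hv)) _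
      (Reach.reachIn hr fun _ _ _ => trivial)).1 (oldX v hv)).reach
  · intro v w hv hw S₁ S₂ hS D₁ D₂
    obtain ⟨v', hv', hlv⟩ := exlift v hv
    obtain ⟨w', hw', hlw⟩ := exlift w hw
    have nd := h.no_detour v' w' hlv hlw
    have cross : (v ∈ A ∧ w ∈ B ∨ v ∈ B ∧ w ∈ A) → s(v', w') ∈ L ∧ s(v, w) ∉ L' := by
      rintro (⟨h1, h2⟩ | ⟨h1, h2⟩)
      · have e1 : v' = v := liftOld _ _ hv' (oldA v h1)
        have e2 : w' = w := liftOld _ _ hw' (oldB w h2)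
        exact ⟨e1 ▸ e2 ▸ hAB v h1 w h2, hrem v h1 w h2 hv.not_mem hw.not_mem⟩
      · have e1 : v' = v := liftOld _ _ hv' (oldB v h1)
        have e2 : w' = w := liftOld _ _ hw' (oldA w h2)
        refine ⟨e1 ▸ e2 ▸ hBA v h1 w h2, ?_⟩
        rw [Sym2.eq_swap]
        exact hrem w h2 v h1 hw.not_mem hv.not_mem
    have notboth : ∀ a, a ∈ A → a ∈ B → False := fun a ha hb => hloop a (hAB a ha a hb)
    rcases detour S₁ v v' w w' hv' hw' D₁ with D₁ | E₁
    · rcases D₂ with D₂ | D₂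
      · rcases detour S₂ v v' w w' hv' hw' D₂ with D₂ | E₂
        · exact nd S₁ S₂ hS D₁ (.inl D₂)
        · exact nd S₁ S₂ hS D₁ (.inr (cross (E₂.imp (fun h => ⟨h.1, h.2.1⟩) (fun h => ⟨h.1, h.2.1⟩))).1)
      · exact nd S₁ S₂ hS D₁ (.inr (edgeLift v v' w w' hv' hw' D₂))
    · have hc := cross (E₁.imp (fun h => ⟨h.1, h.2.1⟩) (fun h => ⟨h.1, h.2.1⟩))
      rcases D₂ with D₂ | D₂
      · rcases detour S₂ v v' w w' hv' hw' D₂ with D₂ | E₂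
        · exact nd S₂ S₁ hS.symm D₂ (.inr hc.1)
        · rcases E₁ with ⟨a1, a2, a3⟩ | ⟨a1, a2, a3⟩ <;> rcases E₂ with ⟨b1, b2, b3⟩ | ⟨b1, b2, b3⟩
          · exact Set.disjoint_left.1 hS a3 b3
          · exact notboth v a1 b1
          · exact notboth v b1 a1
          · exact Set.disjoint_left.1 hS a3 b3
      · exact hc.2 D₂

end

section
variable {S T K K' A B F : Finset ℕ} {𝒦 : Set (Finset ℕ)}

/-- The (at most) two least elements of a set. -/
def low (S : Finset ℕ) : Finset ℕ := S.filter fun x => (S.filter (· < x)).card < 2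

theorem low_subset (S : Finset ℕ) : low S ⊆ S := Finset.filter_subset _ _

theorem mem_low_of_le {x y : ℕ} (hx : x ∈ low S) (hy : y ∈ S) (hyx : y ≤ x) : y ∈ low S := by
  refine Finset.mem_filter.2 ⟨hy, lt_of_le_of_lt (Finset.card_le_card ?_) (Finset.mem_filter.1 hx).2⟩
  exact Finset.monotone_filter_right _ fun z _ (hz : z < y) => hz.trans_le hyx

theorem lt_of_mem_low {x y : ℕ} (hx : x ∈ low S) (hy : y ∈ S) (hy' : y ∉ low S) : x < y := by
  by_contra! h
  exact hy' (mem_low_of_le hx hy h)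

theorem card_low (hS : 2 ≤ S.card) : (low S).card = 2 := by
  have hne : S.Nonempty := Finset.card_pos.1 (by omega)
  have hu := S.min'_mem hne
  set u := S.min' hne with hu'
  have hne' : (S.erase u).Nonempty := Finset.card_pos.1 (by rw [Finset.card_erase_of_mem hu]; omega)
  have hv := (S.erase u).min'_mem hne'
  set v := (S.erase u).min' hne' with hv'
  obtain ⟨hvu, hvS⟩ := Finset.mem_erase.1 hv
  have huv : u < v := lt_of_le_of_ne (S.min'_le v hvS) hvu.symm
  have hle : ∀ x ∈ S, x ≠ u → v ≤ x := fun x hx hxu =>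
    (S.erase u).min'_le x (Finset.mem_erase.2 ⟨hxu, hx⟩)
  have : low S = {u, v} := by
    ext x
    simp only [low, Finset.mem_filter, Finset.mem_insert, Finset.mem_singleton]
    constructor
    · rintro ⟨hx, hc⟩
      by_contra! hxx
      have hvx := lt_of_le_of_ne (hle x hx hxx.1) hxx.2.symm
      have : ({u, v} : Finset ℕ) ⊆ S.filter (· < x) := by
        intro y hy
        simp only [Finset.mem_insert, Finset.mem_singleton] at hy
        rcases hy with rfl | rfl
        · exact Finset.mem_filter.2 ⟨hu, huv.trans hvx⟩
        · exact Finset.mem_filter.2 ⟨hvS, hvx⟩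
      have := Finset.card_le_card this
      rw [Finset.card_pair huv.ne] at this
      omega
    · have h1 : S.filter (· < v) ⊆ {u} := by
        intro y hy
        obtain ⟨hy, hyv⟩ := Finset.mem_filter.1 hy
        by_contra hyu
        exact absurd (hle y hy (by simpa using hyu)) (by omega)
      have h2 := Finset.card_le_card h1
      rw [Finset.card_singleton] at h2
      rintro (rfl | rfl)
      · refine ⟨hu, lt_of_le_of_lt (Finset.card_le_card ?_) (lt_of_le_of_lt h2 one_lt_two)⟩
        exact Finset.monotone_filter_right _ fun z _ (hz : z < u) => hz.trans huv
      · exact ⟨hvS, by omega⟩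
  rw [this, Finset.card_pair huv.ne]

theorem two_le_of_card_low (h : (low S).card = 2) : 2 ≤ S.card :=
  h ▸ Finset.card_le_card (low_subset S)

/-- A two-element set below all other elements consists of the two least elements. -/
theorem low_eq_of_lt {M : Finset ℕ} (hM : M ⊆ S) (hc : M.card = 2)
    (h : ∀ x ∈ M, ∀ y ∈ S, y ∉ M → x < y) : low S = M := by
  have hS : (low S).card = 2 := card_low (hc ▸ Finset.card_le_card hM)
  refine Finset.eq_of_subset_of_card_le ?_ (by omega)
  intro y hy
  by_contra hyM
  have : M ⊂ low S := by
    refine ⟨fun x hx => mem_low_of_le hy (hM hx) (h x hx y (low_subset S hy) hyM).le, fun h' => ?_⟩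
    exact hyM (h' hy)
  have := Finset.card_lt_card this
  omega

theorem low_eq_low (hT : low S ⊆ T) (hTS : T ⊆ S) (hS : 2 ≤ S.card) : low T = low S :=
  low_eq_of_lt hT (card_low hS) fun _ hx _ hy hy' => lt_of_mem_low hx (hTS hy) hy'

theorem low_pair {a b : ℕ} (hab : a ≠ b) : low {a, b} = {a, b} :=
  low_eq_of_lt subset_rfl (Finset.card_pair hab) fun _ _ _ hy hy' => absurd hy hy'

theorem low_union_fresh (hB : 2 ≤ B.card) (h : ∀ x ∈ B, ∀ f ∈ F, x < f) :
    low (B ∪ F) = low B := by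
  refine low_eq_of_lt ((low_subset B).trans Finset.subset_union_left) (card_low hB) ?_
  intro x hx y hy hy'
  rcases Finset.mem_union.1 hy with hy | hy
  · exact lt_of_mem_low hx hy hy'
  · exact h x (low_subset B hx) y hy

theorem low_singleton_union_fresh {d : ℕ} (hF : F.Nonempty) (h : ∀ f ∈ F, d < f) :
    low ({d} ∪ F) = {d, F.min' hF} := by
  have hm := F.min'_mem hF
  refine low_eq_of_lt ?_ (Finset.card_pair (h _ hm).ne) ?_
  · intro x hx
    simp only [Finset.mem_insert, Finset.mem_singleton] at hx
    rcases hx with rfl | rfl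
    · simp
    · exact Finset.mem_union_right _ hm
  · intro x hx y hy hy'
    simp only [Finset.mem_insert, Finset.mem_singleton, not_or] at hx hy'
    rcases Finset.mem_union.1 hy with hyd | hyF
    · exact absurd (Finset.mem_singleton.1 hyd) hy'.1
    · have := F.min'_le y hyF
      rcases hx with hx | hx
      · exact hx ▸ h y hyF
      · omega

/-- Two label sets whose pairs of least labels interact only in a controlled way. -/
structure Compat (K K' : Finset ℕ) : Prop where
  inter : Disjoint (low K) K' ∨ Disjoint (low K') K ∨ low K ∩ K' = low K' ∩ K
  low_eq : ∀ y ∈ K, y ∈ K' → y ∉ low K → y ∉ low K' → ¬ Disjoint (low K) (low K') →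
    low K = low K'

theorem Compat.symm (h : Compat K K') : Compat K' K where
  inter := by rcases h.inter with h | h | h; exacts [.inr (.inl h), .inl h, .inr (.inr h.symm)]
  low_eq y h1 h2 h3 h4 h5 := (h.low_eq y h2 h1 h4 h3 fun h => h5 h.symm).symm

theorem Compat.of_low_eq (h : low K = low K') : Compat K K' where
  inter := by
    right; right
    rw [Finset.inter_eq_left.2 (h ▸ low_subset K'), Finset.inter_eq_left.2 (h ▸ low_subset K), h]
  low_eq _ _ _ _ _ _ := h

theorem Compat.mem_iff (h : Compat K K') {x y : ℕ} (hx : x ∈ low K) (hx' : x ∈ K')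
    (hy : y ∈ low K') (hy' : y ∈ K) {z : ℕ} : z ∈ low K ∧ z ∈ K' ↔ z ∈ low K' ∧ z ∈ K := by
  rcases h.inter with h | h | h
  · exact absurd hx' (Finset.disjoint_left.1 h hx)
  · exact absurd hy' (Finset.disjoint_left.1 h hy)
  · rw [← Finset.mem_inter, ← Finset.mem_inter, h]

theorem Compat.of_cover
    (h : ∀ y ∈ S, ∃ K, y ∈ K ∧ K ⊆ S ∧ low K = low S ∧ Compat K K') : Compat S K' where
  inter := by
    by_cases h1 : Disjoint (low S) K'
    · exact .inl h1
    by_cases h2 : Disjoint (low K') S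
    · exact .inr (.inl h2)
    refine .inr (.inr ?_)
    obtain ⟨x, hx, hxK⟩ := Finset.not_disjoint_iff.1 h1
    obtain ⟨y, hy, hyS⟩ := Finset.not_disjoint_iff.1 h2
    have key : ∀ y ∈ low K', y ∈ S → ∃ K ⊆ S, y ∈ K ∧
        ∀ z, z ∈ low S ∧ z ∈ K' ↔ z ∈ low K' ∧ z ∈ K := by
      intro y hy hyS
      obtain ⟨K, hyK, hKS, hl, hc⟩ := h y hyS
      refine ⟨K, hKS, hyK, fun z => ?_⟩
      rw [← hl]
      exact hc.mem_iff (hl ▸ hx) hxK hy hyK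
    ext z
    rw [Finset.mem_inter, Finset.mem_inter]
    constructor
    · intro hz
      obtain ⟨K, hKS, -, hK⟩ := key y hy hyS
      exact ⟨((hK z).1 hz).1, hKS ((hK z).1 hz).2⟩
    · rintro ⟨hz, hzS⟩
      obtain ⟨K, hKS, hzK, hK⟩ := key z hz hzS
      exact (hK z).2 ⟨hz, hzK⟩
  low_eq y hy hy' h1 h2 h3 := by
    obtain ⟨K, hyK, hKS, hl, hc⟩ := h y hy
    rw [← hl] at h1 h3 ⊢
    exact hc.low_eq y hyK hy' h1 h2 h3

/-- A family of label sets with at least two elements each that are pairwise compatible. -/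
structure Coherent (𝒦 : Set (Finset ℕ)) : Prop where
  two_le : ∀ K ∈ 𝒦, 2 ≤ K.card
  compat : ∀ K ∈ 𝒦, ∀ K' ∈ 𝒦, Compat K K'

theorem Coherent.union (h : Coherent 𝒦) {𝒮 : Set (Finset ℕ)} (h2 : ∀ S ∈ 𝒮, 2 ≤ S.card)
    (h𝒦 : ∀ S ∈ 𝒮, ∀ K ∈ 𝒦, Compat S K) (h𝒮 : ∀ S ∈ 𝒮, ∀ T ∈ 𝒮, Compat S T) :
    Coherent (𝒦 ∪ 𝒮) where
  two_le K hK := hK.elim (h.two_le K) (h2 K)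
  compat K hK K' hK' := by
    rcases hK with hK | hK <;> rcases hK' with hK' | hK'
    · exact h.compat K hK K' hK'
    · exact (h𝒦 K' hK' K hK).symm
    · exact h𝒦 K hK K' hK'
    · exact h𝒮 K hK K' hK'

/-- The sets that are unions of members with the same two least labels. -/
def Covered (𝒦 : Set (Finset ℕ)) (S : Finset ℕ) : Prop :=
  S.Nonempty ∧ ∀ y ∈ S, ∃ K ∈ 𝒦, y ∈ K ∧ K ⊆ S ∧ low K = low S

theorem Coherent.union_covered (h : Coherent 𝒦) {𝒮 : Set (Finset ℕ)}
    (hS : ∀ S ∈ 𝒮, Covered 𝒦 S) : Coherent (𝒦 ∪ 𝒮) := by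
  have h1 : ∀ S ∈ 𝒮, ∀ K ∈ 𝒦, Compat S K := fun S hS' K hK =>
    .of_cover fun y hy => by
      obtain ⟨K₁, h1, h2, h3, h4⟩ := (hS S hS').2 y hy
      exact ⟨K₁, h2, h3, h4, h.compat K₁ h1 K hK⟩
  refine h.union ?_ h1 ?_
  · intro S hS'
    obtain ⟨y, hy⟩ := (hS S hS').1
    obtain ⟨K₁, h1, h2, h3, h4⟩ := (hS S hS').2 y hy
    exact (h.two_le K₁ h1).trans (Finset.card_le_card h3)
  · intro S hS' T hT
    refine .of_cover fun y hy => ?_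
    obtain ⟨K₁, g1, h2, h3, h4⟩ := (hS S hS').2 y hy
    exact ⟨K₁, h2, h3, h4, (h1 T hT K₁ g1).symm⟩

/-- The sets obtained from `𝒦` by adjoining the unions of the members of `𝒜` with `Z`. -/
def adj (𝒦 : Set (Finset ℕ)) (𝒜 : Finset (Finset ℕ)) (Z : Finset ℕ) : Set (Finset ℕ) :=
  𝒦 ∪ {S | ∃ A ∈ 𝒜, S = A ∪ Z}

/-- Conditions under which fresh labels can be added to the members of `ℬ`. -/
structure Extendable (𝒦 : Set (Finset ℕ)) (ℬ : Finset (Finset ℕ)) : Prop where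
  dom : ∀ B ∈ ℬ, 2 ≤ B.card → ∃ K ∈ 𝒦, B ⊆ K ∧ low K = low B
  not_mem : ∀ d, {d} ∈ ℬ → ∀ B ∈ ℬ, 2 ≤ B.card → d ∉ low B
  low_eq : ∀ B ∈ ℬ, ∀ B' ∈ ℬ, 2 ≤ B.card → 2 ≤ B'.card → ¬ Disjoint (low B) (low B') →
    low B = low B'

theorem Coherent.adj_fresh (h : Coherent 𝒦) {ℬ : Finset (Finset ℕ)} (hne : ∀ B ∈ ℬ, B.Nonempty)
    (hE : Extendable 𝒦 ℬ) (hF : F.Nonempty) (hf𝒦 : ∀ K ∈ 𝒦, ∀ x ∈ K, ∀ f ∈ F, x < f)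
    (hfℬ : ∀ B ∈ ℬ, ∀ x ∈ B, ∀ f ∈ F, x < f)
    (hs : F.card = 1 ∨ ∀ d d', {d} ∈ ℬ → {d'} ∈ ℬ → d = d') : Coherent (adj 𝒦 ℬ F) := by
  have hFK : ∀ K ∈ 𝒦, ∀ x ∈ F, x ∉ K := fun K hK x hx hxK => lt_irrefl x (hf𝒦 K hK x hxK x hx)
  have hFB : ∀ B ∈ ℬ, ∀ x ∈ F, x ∉ B := fun B hB x hx hxK => lt_irrefl x (hfℬ B hB x hxK x hx)
  have hm := F.min'_mem hF
  have lowS : ∀ d, {d} ∈ ℬ → low ({d} ∪ F) = {d, F.min' hF} := fun d hd =>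
    low_singleton_union_fresh hF (hfℬ _ hd d (Finset.mem_singleton_self d))
  have lowB : ∀ B ∈ ℬ, 2 ≤ B.card → low (B ∪ F) = low B := fun B hB hB2 =>
    low_union_fresh hB2 (hfℬ B hB)
  have cases : ∀ B ∈ ℬ, (∃ d, B = {d}) ∨ 2 ≤ B.card := by
    intro B hB
    have := Finset.card_pos.2 (hne B hB)
    rcases Nat.lt_or_ge B.card 2 with h' | h'
    · exact .inl (Finset.card_eq_one.1 (by omega))
    · exact .inr h'
  have mixed : ∀ d, {d} ∈ ℬ → ∀ B ∈ ℬ, 2 ≤ B.card → Compat ({d} ∪ F) (B ∪ F) := by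
    intro d hd B hB hB2
    have hdis : Disjoint (low (B ∪ F)) ({d} ∪ F) := by
      rw [lowB B hB hB2, Finset.disjoint_right]
      intro x hx hxB
      rcases Finset.mem_union.1 hx with hx | hx
      · exact hE.not_mem d hd B hB hB2 (Finset.mem_singleton.1 hx ▸ hxB)
      · exact hFB B hB x hx (low_subset B hxB)
    exact ⟨.inr (.inl hdis), fun y _ _ _ _ hn =>
      absurd (hdis.symm.mono_left (low_subset _)) hn⟩
  refine h.union ?_ ?_ ?_
  · rintro _ ⟨B, hB, rfl⟩
    obtain ⟨x, hx⟩ := hne B hB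
    obtain ⟨f, hf⟩ := hF
    have : ({x, f} : Finset ℕ) ⊆ B ∪ F := by
      intro y hy
      simp only [Finset.mem_insert, Finset.mem_singleton] at hy
      rcases hy with rfl | rfl <;> simp [hx, hf]
    have := Finset.card_le_card this
    rwa [Finset.card_pair (hfℬ B hB x hx f hf).ne] at this
  · rintro _ ⟨B, hB, rfl⟩ K hK
    rcases cases B hB with ⟨d, rfl⟩ | hB2
    · refine ⟨?_, ?_⟩
      · rw [lowS d hB]
        by_cases hdK : d ∈ low K
        · refine .inr (.inr ?_)
          ext x
          simp only [Finset.mem_inter, Finset.mem_insert, Finset.mem_singleton, Finset.mem_union]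
          constructor
          · rintro ⟨rfl | rfl, hx⟩
            · exact ⟨hdK, .inl rfl⟩
            · exact absurd hx (hFK K hK _ hm)
          · rintro ⟨hx, rfl | hxF⟩
            · exact ⟨.inl rfl, low_subset K hx⟩
            · exact absurd (low_subset K hx) (hFK K hK _ hxF)
        · refine .inr (.inl ?_)
          rw [Finset.disjoint_right]
          intro x hx hxK
          rcases Finset.mem_union.1 hx with hx | hx
          · exact hdK (Finset.mem_singleton.1 hx ▸ hxK)
          · exact hFK K hK _ hx (low_subset K hxK)
      · intro y hy hyK hy1
        rw [lowS d hB] at hy1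
        rcases Finset.mem_union.1 hy with hy | hy
        · simp only [Finset.mem_singleton] at hy; simp [hy] at hy1
        · exact absurd hyK (hFK K hK y hy)
    · obtain ⟨K₀, hK₀, hBK, hl⟩ := hE.dom B hB hB2
      have hc := h.compat K₀ hK₀ K hK
      have hmem : ∀ y ∈ K, y ∈ B ∪ F → y ∈ B := fun y hy hyB =>
        (Finset.mem_union.1 hyB).resolve_right fun hyF => hFK K hK y hyF hy
      refine ⟨?_, ?_⟩
      · rw [lowB B hB hB2, ← hl]
        rcases hc.inter with h1 | h1 | h1
        · exact .inl h1
        · refine .inr (.inl ?_)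
          rw [Finset.disjoint_left] at h1 ⊢
          exact fun x hx hxB => h1 hx (hBK (hmem x (low_subset K hx) hxB))
        · refine .inr (.inr ?_)
          ext x
          have hx := Finset.ext_iff.1 h1 x
          simp only [Finset.mem_inter] at hx ⊢
          constructor
          · intro hx'
            refine ⟨(hx.1 hx').1, Finset.mem_union_left _ ?_⟩
            exact low_subset B (hl ▸ hx'.1)
          · rintro ⟨h3, h4⟩
            exact hx.2 ⟨h3, hBK (hmem x (low_subset K h3) h4)⟩
      · intro y hy hyK
        rw [lowB B hB hB2, ← hl]
        exact hc.low_eq y (hBK (hmem y hyK hy)) hyK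
  · rintro _ ⟨B, hB, rfl⟩ _ ⟨B', hB', rfl⟩
    rcases cases B hB with ⟨d, rfl⟩ | hB2 <;> rcases cases B' hB' with ⟨d', rfl⟩ | hB2'
    · by_cases hdd : d = d'
      · subst hdd; exact .of_low_eq rfl
      obtain ⟨f, rfl⟩ := Finset.card_eq_one.1 (hs.resolve_right fun h' => hdd (h' d d' hB hB'))
      have l1 := lowS d hB
      have l2 := lowS d' hB'
      rw [Finset.min'_singleton] at l1 l2
      have e1 := (hfℬ _ hB d (Finset.mem_singleton_self d) f (Finset.mem_singleton_self f)).ne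
      have e2 := (hfℬ _ hB' d' (Finset.mem_singleton_self d') f (Finset.mem_singleton_self f)).ne
      refine ⟨.inr (.inr ?_), ?_⟩
      · rw [l1, l2]
        ext x
        simp only [Finset.mem_inter, Finset.mem_insert, Finset.mem_singleton, Finset.mem_union]
        omega
      · intro y hy hy'
        rw [l1]
        simp only [Finset.mem_insert, Finset.mem_singleton, Finset.mem_union] at hy hy' ⊢
        omega
    · exact mixed d hB B' hB' hB2'
    · exact (mixed d' hB' B hB hB2).symm
    · by_cases hl : low B = low B'
      · exact .of_low_eq (by rw [lowB B hB hB2, lowB B' hB' hB2', hl])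
      have hdis : Disjoint (low B) (low B') := by
        by_contra hd; exact hl (hE.low_eq B hB B' hB' hB2 hB2' hd)
      obtain ⟨K, hK, hBK, hlK⟩ := hE.dom B hB hB2
      obtain ⟨K', hK', hBK', hlK'⟩ := hE.dom B' hB' hB2'
      have up : ∀ B₁ ∈ ℬ, ∀ B₂ : Finset ℕ, Disjoint (low B₁) B₂ → Disjoint (low B₁) (B₂ ∪ F) := by
        intro B₁ hB₁ B₂ h'
        rw [Finset.disjoint_union_right]
        refine ⟨h', Finset.disjoint_left.2 fun x hx hxF => ?_⟩
        exact hFB B₁ hB₁ x hxF (low_subset _ hx)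
      refine ⟨?_, ?_⟩ <;> rw [lowB B hB hB2, lowB B' hB' hB2']
      · rcases (h.compat K hK K' hK').inter with h1 | h1 | h1
        · rw [hlK] at h1
          exact .inl (up B hB B' (h1.mono_right hBK'))
        · rw [hlK'] at h1
          exact .inr (.inl (up B' hB' B (h1.mono_right hBK)))
        · rw [hlK, hlK'] at h1
          refine .inl (up B hB B' (Finset.disjoint_left.2 fun x hx hxB => ?_))
          have := Finset.mem_inter.1 (h1 ▸ Finset.mem_inter.2 ⟨hx, hBK' hxB⟩)
          exact Finset.disjoint_left.1 hdis hx this.1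
      · exact fun _ _ _ _ _ hn => absurd hdis hn

end

section
variable {K K' A A₀ A' B B₀ B' : Finset ℕ} {𝒦 : Set (Finset ℕ)} {𝒜 ℬ : Finset (Finset ℕ)}
  {S T : Finset ℕ → Finset ℕ} {ζ b c d : ℕ}

theorem Compat.mem_of_ne (h : Compat K K') (hne : low K ≠ low K')
    (hd : ¬ Disjoint (low K) (low K')) {y : ℕ} (hy : y ∈ K) (hy' : y ∈ K') :
    y ∈ low K ∧ y ∈ low K' := by
  obtain ⟨x, hx, hx'⟩ := Finset.not_disjoint_iff.1 hd
  have key := h.mem_iff hx (low_subset _ hx') hx' (low_subset _ hx) (z := y)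
  by_cases h1 : y ∈ low K
  · exact ⟨h1, (key.1 ⟨h1, hy'⟩).1⟩
  by_cases h2 : y ∈ low K'
  · exact ⟨(key.2 ⟨h2, hy⟩).1, h2⟩
  · exact absurd (h.low_eq y hy hy' h1 h2 hd) hne

theorem Compat.card_le_one (h : Compat K K') (hne : low K ≠ low K') (hK : 2 ≤ K.card)
    (hK' : 2 ≤ K'.card) (hd : ¬ Disjoint (low K) (low K')) (hA : A ⊆ K) (hA' : A ⊆ K') :
    A.card ≤ 1 := by
  by_contra! hc
  have h1 : A ⊆ low K := fun y hy => (h.mem_of_ne hne hd (hA hy) (hA' hy)).1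
  have h2 : A ⊆ low K' := fun y hy => (h.mem_of_ne hne hd (hA hy) (hA' hy)).2
  have e1 := Finset.eq_of_subset_of_card_le h1 (by rw [card_low hK]; omega)
  have e2 := Finset.eq_of_subset_of_card_le h2 (by rw [card_low hK']; omega)
  exact hne (e1.symm.trans e2)

theorem low_eq_of_cover {S M : Finset ℕ} (hS : S.Nonempty)
    (h : ∀ y ∈ S, ∃ K, y ∈ K ∧ K ⊆ S ∧ low K = M ∧ 2 ≤ K.card) : low S = M := by
  obtain ⟨y, hy⟩ := hS
  obtain ⟨K, -, hKS, rfl, hK⟩ := h y hy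
  refine low_eq_of_lt ((low_subset K).trans hKS) (card_low hK) fun x hx z hz hz' => ?_
  obtain ⟨K', hzK, -, hl, -⟩ := h z hz
  rw [← hl] at hx hz'
  exact lt_of_mem_low hx hzK hz'

/-- All unions of a member of `𝒜` and a member of `ℬ` belong to the coherent family `𝒦`. -/
structure Join (𝒦 : Set (Finset ℕ)) (𝒜 ℬ : Finset (Finset ℕ)) : Prop where
  coh : Coherent 𝒦
  left_ne : 𝒜.Nonempty
  right_ne : ℬ.Nonempty
  nonempty_left : ∀ A ∈ 𝒜, A.Nonempty
  nonempty_right : ∀ B ∈ ℬ, B.Nonempty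
  mem : ∀ A ∈ 𝒜, ∀ B ∈ ℬ, A ∪ B ∈ 𝒦

theorem Join.symm (h : Join 𝒦 𝒜 ℬ) : Join 𝒦 ℬ 𝒜 :=
  ⟨h.coh, h.right_ne, h.left_ne, h.nonempty_right, h.nonempty_left,
    fun B hB A hA => Finset.union_comm A B ▸ h.mem A hA B hB⟩

theorem Join.compat (h : Join 𝒦 𝒜 ℬ) (hA : A ∈ 𝒜) (hB : B ∈ ℬ) (hA' : A' ∈ 𝒜) (hB' : B' ∈ ℬ) :
    Compat (A ∪ B) (A' ∪ B') := h.coh.compat _ (h.mem A hA B hB) _ (h.mem A' hA' B' hB')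

theorem Join.two_le (h : Join 𝒦 𝒜 ℬ) (hA : A ∈ 𝒜) (hB : B ∈ ℬ) : 2 ≤ (A ∪ B).card :=
  h.coh.two_le _ (h.mem A hA B hB)

theorem Join.card_low (h : Join 𝒦 𝒜 ℬ) (hA : A ∈ 𝒜) (hB : B ∈ ℬ) : (low (A ∪ B)).card = 2 :=
  BVAPaper.card_low (h.two_le hA hB)

theorem Join.low_left (h : Join 𝒦 𝒜 ℬ) (hA : A ∈ 𝒜) (hB : B ∈ ℬ) (hl : low (A ∪ B) ⊆ A) :
    low (A ∪ B) = low A :=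
  (low_eq_low hl Finset.subset_union_left (h.two_le hA hB)).symm

/-- The least labels of every union survive when `Z` and `Z'` are adjoined. -/
def Roles (𝒜 ℬ : Finset (Finset ℕ)) (Z Z' : Finset ℕ) : Prop :=
  ∀ A ∈ 𝒜, ∀ B ∈ ℬ, (∃ A' ∈ 𝒜, low (A' ∪ Z) = low (A ∪ B)) ∨
    ∃ B' ∈ ℬ, low (B' ∪ Z') = low (A ∪ B)

/-- The new literals can be labelled by old labels only. -/
def Absorbed (𝒦 : Set (Finset ℕ)) (𝒜 ℬ : Finset (Finset ℕ)) : Prop :=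
  ∃ Z Z' : Finset ℕ, 2 ≤ Z.card ∧ 2 ≤ Z'.card ∧ Coherent (adj (adj 𝒦 𝒜 Z) ℬ Z') ∧ Roles 𝒜 ℬ Z Z'

/-- One new literal duplicates an old label, the complementary one gets fresh labels. -/
def Duplicated (𝒦 : Set (Finset ℕ)) (𝒜 ℬ : Finset (Finset ℕ)) (ζ : ℕ) : Prop :=
  ∃ b, {b} ∈ ℬ ∧ Coherent (adj (adj 𝒦 𝒜 {b}) ℬ {ζ, ζ + 1}) ∧ Roles 𝒜 ℬ {b} {ζ, ζ + 1}

/-- The new literals get complementary fresh labels. -/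
def Branched (𝒦 : Set (Finset ℕ)) (𝒜 ℬ : Finset (Finset ℕ)) (ζ : ℕ) : Prop :=
  Coherent (adj (adj 𝒦 𝒜 {ζ}) ℬ {ζ + 1}) ∧ (∃ c, {c} ∈ 𝒜) ∧ (∃ d, {d} ∈ ℬ) ∧
    ∀ A ∈ 𝒜, ∀ B ∈ ℬ, (∃ c d, A = {c} ∧ B = {d}) ∨ low (A ∪ {ζ}) = low (A ∪ B) ∨
      low (B ∪ {ζ + 1}) = low (A ∪ B)

/-- The union of the members of `ℬ` that are interchangeable with `B₀`. -/
def twins (𝒜 ℬ : Finset (Finset ℕ)) (B₀ : Finset ℕ) : Finset ℕ :=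
  (ℬ.filter fun B => ∀ A ∈ 𝒜, low (A ∪ B) = low (A ∪ B₀)).biUnion id

theorem subset_twins (hB : B ∈ ℬ) (h : ∀ A ∈ 𝒜, low (A ∪ B) = low (A ∪ B₀)) :
    B ⊆ twins 𝒜 ℬ B₀ :=
  Finset.subset_biUnion_of_mem id (Finset.mem_filter.2 ⟨hB, h⟩)

theorem Join.low_union_twins (h : Join 𝒦 𝒜 ℬ) (hB₀ : B₀ ∈ ℬ) (hA : A ∈ 𝒜) :
    low (A ∪ twins 𝒜 ℬ B₀) = low (A ∪ B₀) ∧ Covered 𝒦 (A ∪ twins 𝒜 ℬ B₀) := by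
  have hne : (A ∪ twins 𝒜 ℬ B₀).Nonempty := (h.nonempty_left A hA).mono Finset.subset_union_left
  have key : ∀ y ∈ A ∪ twins 𝒜 ℬ B₀, ∃ B ∈ ℬ, y ∈ A ∪ B ∧ A ∪ B ⊆ A ∪ twins 𝒜 ℬ B₀ ∧
      low (A ∪ B) = low (A ∪ B₀) := by
    intro y hy
    rcases Finset.mem_union.1 hy with hy | hy
    · exact ⟨B₀, hB₀, Finset.mem_union_left _ hy,
        Finset.union_subset_union_right (subset_twins hB₀ fun _ _ => rfl), rfl⟩
    · obtain ⟨B, hB, hyB⟩ := Finset.mem_biUnion.1 hy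
      obtain ⟨hB, hg⟩ := Finset.mem_filter.1 hB
      exact ⟨B, hB, Finset.mem_union_right _ hyB,
        Finset.union_subset_union_right (subset_twins hB hg), hg A hA⟩
  have hl : low (A ∪ twins 𝒜 ℬ B₀) = low (A ∪ B₀) := by
    refine low_eq_of_cover hne fun y hy => ?_
    obtain ⟨B, hB, h1, h2, h3⟩ := key y hy
    exact ⟨_, h1, h2, h3, h.two_le hA hB⟩
  refine ⟨hl, hne, fun y hy => ?_⟩
  obtain ⟨B, hB, h1, h2, h3⟩ := key y hy
  exact ⟨_, h.mem A hA B hB, h1, h2, h3.trans hl.symm⟩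

theorem Join.absorbed (h : Join 𝒦 𝒜 ℬ) (hA₀ : A₀ ∈ 𝒜) (hB₀ : B₀ ∈ ℬ)
    (hr : ∀ A ∈ 𝒜, ∀ B ∈ ℬ, low (A ∪ B) = low (A ∪ B₀) ∨ low (A ∪ B) = low (A₀ ∪ B))
    (hZ : 2 ≤ (twins 𝒜 ℬ B₀).card) (hZ' : 2 ≤ (twins ℬ 𝒜 A₀).card) : Absorbed 𝒦 𝒜 ℬ := by
  refine ⟨_, _, hZ, hZ', ?_, ?_⟩
  · refine Coherent.union_covered (Coherent.union_covered h.coh ?_) ?_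
    · rintro _ ⟨A, hA, rfl⟩
      exact (h.low_union_twins hB₀ hA).2
    · rintro _ ⟨B, hB, rfl⟩
      obtain ⟨h1, h2⟩ := (h.symm.low_union_twins hA₀ hB).2
      refine ⟨h1, fun y hy => ?_⟩
      obtain ⟨K, hK, h3⟩ := h2 y hy
      exact ⟨K, .inl hK, h3⟩
  · intro A hA B hB
    refine (hr A hA B hB).imp (fun e => ⟨A, hA, ?_⟩) fun e => ⟨B, hB, ?_⟩
    · rw [(h.low_union_twins hB₀ hA).1, e]
    · rw [(h.symm.low_union_twins hA₀ hB).1, e, Finset.union_comm]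

theorem Join.duplicated (h : Join 𝒦 𝒜 ℬ) (hζ : ∀ K ∈ 𝒦, ∀ x ∈ K, x < ζ) (hb : {b} ∈ ℬ)
    (hB : ∀ B ∈ ℬ, B ≠ {b} → 2 ≤ B.card ∧ b ∉ low B ∧ ∃ A ∈ 𝒜, low (A ∪ B) = low B)
    (hd : ∀ B ∈ ℬ, ∀ B' ∈ ℬ, B ≠ {b} → B' ≠ {b} → ¬ Disjoint (low B) (low B') → low B = low B')
    (hr : ∀ A ∈ 𝒜, ∀ B ∈ ℬ, low (A ∪ B) = low (A ∪ {b}) ∨ B ≠ {b} ∧ low (A ∪ B) = low B) :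
    Duplicated 𝒦 𝒜 ℬ ζ := by
  have hne : ∀ B : Finset ℕ, 2 ≤ B.card → B ≠ {b} := by
    rintro B h2 rfl
    simp at h2
  obtain ⟨A₀, hA₀⟩ := h.left_ne
  have hζB : ∀ B ∈ ℬ, ∀ x ∈ B, x < ζ := fun B hB x hx =>
    hζ _ (h.mem A₀ hA₀ B hB) x (Finset.mem_union_right _ hx)
  have hF : ∀ f ∈ ({ζ, ζ + 1} : Finset ℕ), ζ ≤ f := by
    intro f hf
    simp only [Finset.mem_insert, Finset.mem_singleton] at hf
    omega
  refine ⟨b, hb, ?_, ?_⟩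
  · have e : adj 𝒦 𝒜 {b} = 𝒦 := Set.union_eq_left.2 (by
      rintro _ ⟨A, hA, rfl⟩
      exact h.mem A hA _ hb)
    rw [e]
    refine h.coh.adj_fresh h.nonempty_right ⟨?_, ?_, ?_⟩ (by simp)
      (fun K hK x hx f hf => (hζ K hK x hx).trans_le (hF f hf))
      (fun B hB x hx f hf => (hζB B hB x hx).trans_le (hF f hf)) (.inr ?_)
    · intro B hB' h2
      obtain ⟨-, -, A, hA, hl⟩ := hB B hB' (hne B h2)
      exact ⟨_, h.mem A hA B hB', Finset.subset_union_right, hl⟩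
    · intro d hd' B hB' h2
      have : d = b := by
        by_contra hdb
        have := (hB _ hd' (by simpa using hdb)).1
        simp at this
      exact this ▸ (hB B hB' (hne B h2)).2.1
    · exact fun B hB B' hB' h2 h2' => hd B hB B' hB' (hne B h2) (hne B' h2')
    · have : ∀ d, {d} ∈ ℬ → d = b := by
        intro d hd'
        by_contra hdb
        have := (hB _ hd' (by simpa using hdb)).1
        simp at this
      exact fun d d' h1 h2 => (this d h1).trans (this d' h2).symm
  · intro A hA B hB'
    refine (hr A hA B hB').imp (fun e => ⟨A, hA, e.symm⟩) fun e => ⟨B, hB', ?_⟩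
    rw [e.2]
    exact low_union_fresh (hB B hB' e.1).1 fun x hx f hf => (hζB B hB' x hx).trans_le (hF f hf)

/-! ### Families without split unions -/

theorem sup_low_le {S : Finset ℕ} (hA : A ⊆ S) (h2 : 2 ≤ A.card) :
    (low S).sup id ≤ (low A).sup id := by
  by_contra! hlt
  have h2S : 2 ≤ S.card := h2.trans (Finset.card_le_card hA)
  have hne : (low S).Nonempty := Finset.card_pos.1 (by rw [card_low h2S]; omega)
  obtain ⟨s, hs, hs'⟩ := Finset.exists_mem_eq_sup _ hne id
  rw [hs'] at hlt
  have hlow : ∀ x ∈ low A, x < s := fun x hx =>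
    lt_of_le_of_lt (Finset.le_sup (f := id) hx) hlt
  have : insert s (low A) ⊆ low S := by
    intro x hx
    rcases Finset.mem_insert.1 hx with rfl | hx
    · exact hs
    · exact mem_low_of_le hs (hA (low_subset A hx)) (hlow x hx).le
  have := Finset.card_le_card this
  rw [Finset.card_insert_of_notMem fun h => lt_irrefl _ (hlow s h), card_low h2, card_low h2S] at this
  omega

theorem low_eq_of_sup_le {S : Finset ℕ} (hA : A ⊆ S) (h2 : 2 ≤ A.card)
    (h : (low A).sup id ≤ (low S).sup id) : low A = low S := by
  have h2S : 2 ≤ S.card := h2.trans (Finset.card_le_card hA)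
  have hne : (low S).Nonempty := Finset.card_pos.1 (by rw [card_low h2S]; omega)
  obtain ⟨s, hs, hs'⟩ := Finset.exists_mem_eq_sup _ hne id
  refine Finset.eq_of_subset_of_card_le (fun x hx => ?_) (by rw [card_low h2, card_low h2S])
  refine mem_low_of_le hs (hA (low_subset A hx)) ?_
  rw [hs'] at h
  exact (Finset.le_sup (f := id) hx).trans h

/-- A member of `ℬ` whose two least labels come last. -/
structure IsLast (ℬ : Finset (Finset ℕ)) (B₀ : Finset ℕ) : Prop where
  mem : B₀ ∈ ℬ
  le : 2 ≤ B₀.card → ∀ B ∈ ℬ, 2 ≤ B.card ∧ (low B).sup id ≤ (low B₀).sup id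

theorem exists_isLast (h : ℬ.Nonempty) : ∃ B₀, IsLast ℬ B₀ := by
  by_cases h1 : ∃ B ∈ ℬ, B.card < 2
  · obtain ⟨B, hB, h2⟩ := h1
    exact ⟨B, hB, fun h => by omega⟩
  push Not at h1
  obtain ⟨B, hB, hm⟩ := Finset.exists_max_image ℬ (fun B => (low B).sup id) h
  exact ⟨B, hB, fun _ B' hB' => ⟨h1 B' hB', hm B' hB'⟩⟩

/-- No pair of least labels is split between the two sides of a union. -/
def Unsplit (𝒜 ℬ : Finset (Finset ℕ)) : Prop :=
  ∀ A ∈ 𝒜, ∀ B ∈ ℬ, low (A ∪ B) ⊆ A ∨ low (A ∪ B) ⊆ B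

theorem Unsplit.symm (h : Unsplit 𝒜 ℬ) : Unsplit ℬ 𝒜 :=
  fun B hB A hA => Finset.union_comm A B ▸ (h A hA B hB).symm

theorem Join.low_right (h : Join 𝒦 𝒜 ℬ) (hA : A ∈ 𝒜) (hB : B ∈ ℬ) (hl : low (A ∪ B) ⊆ B) :
    low (A ∪ B) = low B := by
  rw [Finset.union_comm] at hl ⊢
  exact h.symm.low_left hB hA hl

theorem Join.two_le_left (h : Join 𝒦 𝒜 ℬ) (hA : A ∈ 𝒜) (hB : B ∈ ℬ) (hl : low (A ∪ B) ⊆ A) :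
    2 ≤ A.card := by
  have := Finset.card_le_card hl
  rwa [h.card_low hA hB] at this

theorem Join.low_last (h : Join 𝒦 𝒜 ℬ) (hU : Unsplit 𝒜 ℬ) (hB₀ : IsLast ℬ B₀) (hA : A ∈ 𝒜)
    (hB : B ∈ ℬ) (hl : low (A ∪ B) ⊆ A) : low (A ∪ B₀) = low A := by
  have hA2 := h.two_le_left hA hB hl
  rcases hU A hA B₀ hB₀.mem with h1 | h1
  · exact h.low_left hA hB₀.mem h1
  have e := h.low_right hA hB₀.mem h1
  have h2 : 2 ≤ B₀.card := h.symm.two_le_left hB₀.mem hA (Finset.union_comm A B₀ ▸ h1)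
  obtain ⟨hB2, hle⟩ := hB₀.le h2 B hB
  refine (low_eq_of_sup_le Finset.subset_union_left hA2 ?_).symm
  rw [e]
  refine le_trans ?_ hle
  rw [← h.low_left hA hB hl]
  exact sup_low_le Finset.subset_union_right hB2

theorem Join.duplicated_of_unsplit (h : Join 𝒦 𝒜 ℬ) (hζ : ∀ K ∈ 𝒦, ∀ x ∈ K, x < ζ)
    (hU : Unsplit 𝒜 ℬ) (hA₀ : IsLast 𝒜 A₀) (hB₀ : B₀ ∈ ℬ)
    (hZ : (twins 𝒜 ℬ B₀).card < 2) : Duplicated 𝒦 𝒜 ℬ ζ := by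
  have hsub := subset_twins (𝒜 := 𝒜) hB₀ fun _ _ => rfl
  have hpos := Finset.card_pos.2 (h.nonempty_right B₀ hB₀)
  have hle := Finset.card_le_card hsub
  obtain ⟨b, hb⟩ := Finset.card_eq_one.1 (show (twins 𝒜 ℬ B₀).card = 1 by omega)
  have hBb : B₀ = {b} := hb ▸ Finset.eq_of_subset_of_card_le hsub (by omega)
  subst hBb
  have hgood : ∀ B ∈ ℬ, B ≠ {b} → ∃ A ∈ 𝒜, low (A ∪ B) ≠ low (A ∪ {b}) := by
    intro B hB hne
    by_contra! hcon
    have := subset_twins hB hcon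
    rw [hb] at this
    exact hne ((Finset.Nonempty.subset_singleton_iff (h.nonempty_right B hB)).1 this)
  have single : ∀ A ∈ 𝒜, ∀ d, {d} ∈ ℬ → low (A ∪ {d}) = low A := by
    intro A hA d hd
    refine h.low_left hA hd ((hU A hA _ hd).resolve_right fun h1 => ?_)
    have := Finset.card_le_card h1
    rw [h.card_low hA hd] at this
    simp at this
  have two : ∀ A ∈ 𝒜, 2 ≤ A.card := by
    intro A hA
    have h2 := h.card_low hA hB₀
    rw [single A hA b hB₀] at h2
    exact two_le_of_card_low h2
  have hlast : ∀ B ∈ ℬ, B ≠ {b} → low (A₀ ∪ B) = low B := by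
    intro B hB hne
    obtain ⟨A, hA, hl⟩ := hgood B hB hne
    rw [single A hA b hB₀] at hl
    rw [Finset.union_comm]
    refine h.symm.low_last hU.symm hA₀ hB hA ?_
    rw [Finset.union_comm]
    exact (hU A hA B hB).resolve_left fun h1 => hl (h.low_left hA hB h1)
  have hB2 : ∀ B ∈ ℬ, B ≠ {b} → 2 ≤ B.card := by
    intro B hB hne
    have := h.card_low hA₀.mem hB
    rw [hlast B hB hne] at this
    exact two_le_of_card_low this
  refine h.duplicated hζ hB₀ (fun B hB hne => ⟨hB2 B hB hne, ?_, A₀, hA₀.mem, hlast B hB hne⟩) ?_ ?_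
  · intro hbB
    obtain ⟨A, hA, hl⟩ := hgood B hB hne
    rw [single A hA b hB₀] at hl
    have e := h.low_right hA hB ((hU A hA B hB).resolve_left fun h1 => hl (h.low_left hA hB h1))
    have hlA : (low A).Nonempty := Finset.card_pos.1 (by rw [BVAPaper.card_low (two A hA)]; omega)
    obtain ⟨a, ha⟩ := hlA
    have hc := h.compat hA hB hA hB₀
    have key : ∀ z ∈ low A, z ∈ low (A ∪ B) := fun z hz =>
      ((hc.mem_iff (x := b) (y := a) (z := z) (by rwa [e]) (by simp)
        (by rwa [single A hA b hB₀]) (by simp [low_subset A ha])).2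
        ⟨by rwa [single A hA b hB₀], by simp [low_subset A hz]⟩).1
    exact hl (Finset.eq_of_subset_of_card_le key
      (by rw [h.card_low hA hB, BVAPaper.card_low (two A hA)])).symm
  · intro B hB B' hB' hne hne' hd
    by_contra hl
    have hc := h.compat hA₀.mem hB hA₀.mem hB'
    have := hc.card_le_one (A := A₀) (by rwa [hlast B hB hne, hlast B' hB' hne'])
      (h.two_le hA₀.mem hB) (h.two_le hA₀.mem hB') (by rwa [hlast B hB hne, hlast B' hB' hne'])
      Finset.subset_union_left Finset.subset_union_left
    have := two A₀ hA₀.mem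
    omega
  · intro A hA B hB
    rw [single A hA b hB₀]
    rcases hU A hA B hB with h1 | h1
    · exact .inl (h.low_left hA hB h1)
    · by_cases hne : B = {b}
      · exact .inl (hne ▸ single A hA b hB₀)
      · exact .inr ⟨hne, h.low_right hA hB h1⟩

theorem Join.classify_of_unsplit (h : Join 𝒦 𝒜 ℬ) (hζ : ∀ K ∈ 𝒦, ∀ x ∈ K, x < ζ)
    (hU : Unsplit 𝒜 ℬ) : Absorbed 𝒦 𝒜 ℬ ∨ Duplicated 𝒦 𝒜 ℬ ζ ∨ Duplicated 𝒦 ℬ 𝒜 ζ := by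
  obtain ⟨A₀, hA₀⟩ := exists_isLast h.left_ne
  obtain ⟨B₀, hB₀⟩ := exists_isLast h.right_ne
  by_cases hZ : (twins 𝒜 ℬ B₀).card < 2
  · exact .inr (.inl (h.duplicated_of_unsplit hζ hU hA₀ hB₀.mem hZ))
  by_cases hZ' : (twins ℬ 𝒜 A₀).card < 2
  · exact .inr (.inr (h.symm.duplicated_of_unsplit hζ hU.symm hB₀ hA₀.mem hZ'))
  refine .inl (h.absorbed hA₀.mem hB₀.mem (fun A hA B hB => ?_) (by omega) (by omega))
  refine (hU A hA B hB).imp (fun h1 => ?_) fun h1 => ?_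
  · rw [h.low_last hU hB₀ hA hB h1, h.low_left hA hB h1]
  · rw [h.low_right hA hB h1, Finset.union_comm A₀]
    rw [Finset.union_comm] at h1
    exact (h.symm.low_last hU.symm hA₀ hB hA h1).symm

end

section
variable {K K' A A₀ A' B B₀ B' : Finset ℕ} {𝒦 : Set (Finset ℕ)} {𝒜 ℬ : Finset (Finset ℕ)}
  {S T : Finset ℕ → Finset ℕ} {ζ b c d : ℕ}

/-! ### Families with a split union -/

/-- The traces of the least labels of the unions on the two sides, relative to a split union. -/
structure Split (𝒦 : Set (Finset ℕ)) (𝒜 ℬ : Finset (Finset ℕ)) (A₀ B₀ : Finset ℕ)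
    (S T : Finset ℕ → Finset ℕ) : Prop where
  join : Join 𝒦 𝒜 ℬ
  mem_left : A₀ ∈ 𝒜
  mem_right : B₀ ∈ ℬ
  sub_left : ∀ A ∈ 𝒜, S A ⊆ A
  sub_right : ∀ B ∈ ℬ, T B ⊆ B
  card_left : ∀ A ∈ 𝒜, (S A).card = 1 ∨ (S A).card = 2
  card_right : ∀ B ∈ ℬ, (T B).card = 1 ∨ (T B).card = 2
  left : ∀ A ∈ 𝒜, ∀ B ∈ ℬ, low (A ∪ B) ∩ A = ∅ ∨ low (A ∪ B) ∩ A = S A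
  right : ∀ A ∈ 𝒜, ∀ B ∈ ℬ, low (A ∪ B) ∩ B = ∅ ∨ low (A ∪ B) ∩ B = T B
  one_left : (S A₀).card = 1
  one_right : (T B₀).card = 1

theorem Split.symm (h : Split 𝒦 𝒜 ℬ A₀ B₀ S T) : Split 𝒦 ℬ 𝒜 B₀ A₀ T S where
  join := h.join.symm
  mem_left := h.mem_right
  mem_right := h.mem_left
  sub_left := h.sub_right
  sub_right := h.sub_left
  card_left := h.card_right
  card_right := h.card_left
  left B hB A hA := Finset.union_comm A B ▸ h.right A hA B hB
  right B hB A hA := Finset.union_comm A B ▸ h.left A hA B hB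
  one_left := h.one_right
  one_right := h.one_left

theorem Join.left_trace (h : Join 𝒦 𝒜 ℬ) (hA₀ : A₀ ∈ 𝒜) (hB₀ : B₀ ∈ ℬ)
    (h1 : ¬ low (A₀ ∪ B₀) ⊆ A₀) (h2 : ¬ low (A₀ ∪ B₀) ⊆ B₀) (hA : A ∈ 𝒜) :
    (low (A ∪ B₀) ∩ A).Nonempty := by
  by_contra hne
  rw [Finset.not_nonempty_iff_eq_empty] at hne
  have hsub : low (A ∪ B₀) ⊆ B₀ := fun x hx =>
    (Finset.mem_union.1 (low_subset _ hx)).resolve_left fun hxA => by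
      have := Finset.mem_inter.2 ⟨hx, hxA⟩
      simp [hne] at this
  obtain ⟨d, hd, hdA⟩ := Finset.not_subset.1 h1
  have hdB := (Finset.mem_union.1 (low_subset _ hd)).resolve_left hdA
  obtain ⟨x, hx⟩ : (low (A ∪ B₀)).Nonempty :=
    Finset.card_pos.1 (by rw [h.card_low hA hB₀]; omega)
  have hc := h.compat hA hB₀ hA₀ hB₀
  have key : low (A ∪ B₀) ⊆ low (A₀ ∪ B₀) := fun z hz =>
    ((hc.mem_iff hx (by simp [hsub hx]) hd (by simp [hdB])).1 ⟨hz, by simp [hsub hz]⟩).1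
  have := Finset.eq_of_subset_of_card_le key (by rw [h.card_low hA hB₀, h.card_low hA₀ hB₀])
  exact h2 (this ▸ hsub)

theorem Join.trace_eq (h : Join 𝒦 𝒜 ℬ) (hA : A ∈ 𝒜) (hB : B ∈ ℬ) (hB' : B' ∈ ℬ)
    (h1 : (low (A ∪ B) ∩ A).Nonempty) (h2 : (low (A ∪ B') ∩ A).Nonempty) :
    low (A ∪ B) ∩ A = low (A ∪ B') ∩ A := by
  obtain ⟨x, hx⟩ := h1
  obtain ⟨y, hy⟩ := h2
  rw [Finset.mem_inter] at hx hy
  have hc := h.compat hA hB hA hB'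
  ext z
  simp only [Finset.mem_inter]
  have := hc.mem_iff hx.1 (by simp [hx.2]) hy.1 (by simp [hy.2]) (z := z)
  simp only [Finset.mem_union] at this
  tauto

theorem Join.split (h : Join 𝒦 𝒜 ℬ) (hA₀ : A₀ ∈ 𝒜) (hB₀ : B₀ ∈ ℬ)
    (h1 : ¬ low (A₀ ∪ B₀) ⊆ A₀) (h2 : ¬ low (A₀ ∪ B₀) ⊆ B₀) :
    Split 𝒦 𝒜 ℬ A₀ B₀ (fun A => low (A ∪ B₀) ∩ A) fun B => low (A₀ ∪ B) ∩ B := by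
  have h1' : ¬ low (B₀ ∪ A₀) ⊆ A₀ := by rwa [Finset.union_comm]
  have h2' : ¬ low (B₀ ∪ A₀) ⊆ B₀ := by rwa [Finset.union_comm]
  have cl : ∀ A ∈ 𝒜, (low (A ∪ B₀) ∩ A).card ≤ 2 := fun A hA =>
    (Finset.card_le_card Finset.inter_subset_left).trans (h.card_low hA hB₀).le
  have cr : ∀ B ∈ ℬ, (low (A₀ ∪ B) ∩ B).card ≤ 2 := fun B hB =>
    (Finset.card_le_card Finset.inter_subset_left).trans (h.card_low hA₀ hB).le
  have nl : ∀ A ∈ 𝒜, (low (A ∪ B₀) ∩ A).Nonempty := fun A hA => h.left_trace hA₀ hB₀ h1 h2 hA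
  have nr : ∀ B ∈ ℬ, (low (A₀ ∪ B) ∩ B).Nonempty := fun B hB => by
    rw [Finset.union_comm]
    exact h.symm.left_trace hB₀ hA₀ h2' h1' hB
  have one : ∀ {M A : Finset ℕ}, M.card = 2 → ¬ M ⊆ A → (M ∩ A).Nonempty → (M ∩ A).card = 1 := by
    intro M A hM hMA hne
    have := Finset.card_pos.2 hne
    have : M ∩ A ⊂ M := ⟨Finset.inter_subset_left, fun h => hMA (Finset.subset_inter_iff.1 h).2⟩
    have := Finset.card_lt_card this
    omega
  refine ⟨h, hA₀, hB₀, fun _ _ => Finset.inter_subset_right, fun _ _ => Finset.inter_subset_right,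
    fun A hA => ?_, fun B hB => ?_, fun A hA B hB => ?_, fun A hA B hB => ?_,
    one (h.card_low hA₀ hB₀) h1 (nl _ hA₀), one (h.card_low hA₀ hB₀) h2 (nr _ hB₀)⟩
  · have := Finset.card_pos.2 (nl A hA)
    have := cl A hA
    omega
  · have := Finset.card_pos.2 (nr B hB)
    have := cr B hB
    omega
  · rcases Finset.eq_empty_or_nonempty (low (A ∪ B) ∩ A) with e | e
    · exact .inl e
    · exact .inr (h.trace_eq hA hB hB₀ e (nl A hA))
  · rcases Finset.eq_empty_or_nonempty (low (A ∪ B) ∩ B) with e | e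
    · exact .inl e
    · refine .inr ?_
      have n' := nr B hB
      have := h.symm.trace_eq hB hA hA₀
      rw [Finset.union_comm B A, Finset.union_comm B A₀] at this
      exact this e n'

theorem low_union_eq_inter (A B : Finset ℕ) :
    low (A ∪ B) = low (A ∪ B) ∩ A ∪ low (A ∪ B) ∩ B := by
  rw [← Finset.inter_union_distrib_left, Finset.inter_eq_left.2 (low_subset _)]

theorem Split.low_one_one (h : Split 𝒦 𝒜 ℬ A₀ B₀ S T) (hA : A ∈ 𝒜) (hB : B ∈ ℬ)
    (hc : S A = {c}) (hd : T B = {d}) : low (A ∪ B) = {c, d} ∧ c ≠ d := by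
  have e := low_union_eq_inter A B
  have h2 := h.join.card_low hA hB
  have key : low (A ∪ B) = {c, d} := by
    rcases h.left A hA B hB with e1 | e1 <;> rcases h.right A hA B hB with e2 | e2 <;>
      rw [e1, e2] at e
    · simp [e] at h2
    · simp [e, hd] at h2
    · simp [e, hc] at h2
    · rw [e, hc, hd]; rfl
  refine ⟨key, ?_⟩
  rintro rfl
  rw [key] at h2
  simp at h2

theorem Split.low_one_two (h : Split 𝒦 𝒜 ℬ A₀ B₀ S T) (hA : A ∈ 𝒜) (hB : B ∈ ℬ)
    (h1 : (S A).card = 1) (h2 : (T B).card = 2) : low (A ∪ B) = T B := by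
  have e := low_union_eq_inter A B
  have hc := h.join.card_low hA hB
  have key : T B ⊆ low (A ∪ B) := by
    rcases h.left A hA B hB with e1 | e1 <;> rcases h.right A hA B hB with e2 | e2 <;>
      rw [e1, e2] at e
    · simp [e] at hc
    · simp [e]
    · simp [e, h1] at hc
    · rw [e]; exact Finset.subset_union_right
  exact (Finset.eq_of_subset_of_card_le key (by omega)).symm

theorem Split.low_two_one (h : Split 𝒦 𝒜 ℬ A₀ B₀ S T) (hA : A ∈ 𝒜) (hB : B ∈ ℬ)
    (h1 : (S A).card = 2) (h2 : (T B).card = 1) : low (A ∪ B) = S A :=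
  Finset.union_comm A B ▸ h.symm.low_one_two hB hA h2 h1

theorem Split.low_two_two (h : Split 𝒦 𝒜 ℬ A₀ B₀ S T) (hA : A ∈ 𝒜) (hB : B ∈ ℬ)
    (h1 : (S A).card = 2) (h2 : (T B).card = 2) : low (A ∪ B) = S A ∨ low (A ∪ B) = T B := by
  have e := low_union_eq_inter A B
  have hc := h.join.card_low hA hB
  rcases h.left A hA B hB with e1 | e1
  · rcases h.right A hA B hB with e2 | e2
    · rw [e1, e2] at e
      simp [e] at hc
    · exact .inr (Finset.eq_of_subset_of_card_le (e2 ▸ Finset.inter_subset_left) (by omega)).symm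
  · exact .inl (Finset.eq_of_subset_of_card_le (e1 ▸ Finset.inter_subset_left) (by omega)).symm

theorem Split.low_left (h : Split 𝒦 𝒜 ℬ A₀ B₀ S T) (hA : A ∈ 𝒜) (h1 : (S A).card = 2) :
    low A = S A := by
  have e := h.low_two_one hA h.mem_right h1 h.one_right
  rw [← e]
  exact (h.join.low_left hA h.mem_right (e ▸ h.sub_left A hA)).symm

theorem Split.two_le (h : Split 𝒦 𝒜 ℬ A₀ B₀ S T) (hA : A ∈ 𝒜) (h1 : (S A).card = 2) :
    2 ≤ A.card := h1 ▸ Finset.card_le_card (h.sub_left A hA)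

theorem Split.eq_singleton (h : Split 𝒦 𝒜 ℬ A₀ B₀ S T) {d₁ d₂ : ℕ} {B₁ B₂ : Finset ℕ}
    (hB₁ : B₁ ∈ ℬ) (hB₂ : B₂ ∈ ℬ) (h₁ : T B₁ = {d₁}) (h₂ : T B₂ = {d₂}) (hne : d₁ ≠ d₂)
    (hA : A ∈ 𝒜) (hc : S A = {c}) : A = {c} := by
  obtain ⟨l1, n1⟩ := h.low_one_one hA hB₁ hc h₁
  obtain ⟨l2, n2⟩ := h.low_one_one hA hB₂ hc h₂
  have hcA : c ∈ A := h.sub_left A hA (by simp [hc])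
  have hdA : ∀ {d B}, B ∈ ℬ → low (A ∪ B) = {c, d} → c ≠ d → d ∉ A := by
    intro d B hB hl hn hdA
    have : d ∈ low (A ∪ B) ∩ A := by simp [hl, hdA]
    rcases h.left A hA B hB with e | e
    · simp [e] at this
    · rw [e, hc] at this
      exact hn (Finset.mem_singleton.1 this).symm
  refine Finset.eq_singleton_iff_unique_mem.2 ⟨hcA, fun y hy => ?_⟩
  by_contra hyc
  have := (h.join.compat hA hB₁ hA hB₂).low_eq y (by simp [hy]) (by simp [hy])
    (by rw [l1]; simp only [Finset.mem_insert, Finset.mem_singleton, not_or]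
        exact ⟨hyc, fun e => hdA hB₁ l1 n1 (e ▸ hy)⟩)
    (by rw [l2]; simp only [Finset.mem_insert, Finset.mem_singleton, not_or]
        exact ⟨hyc, fun e => hdA hB₂ l2 n2 (e ▸ hy)⟩)
    (by rw [l1, l2]; simp)
  rw [l1, l2] at this
  have : d₁ ∈ ({c, d₂} : Finset ℕ) := by rw [← this]; simp
  simp only [Finset.mem_insert, Finset.mem_singleton] at this
  omega

theorem Split.extendable (h : Split 𝒦 𝒜 ℬ A₀ B₀ S T) {d₁ d₂ : ℕ} {B₁ B₂ : Finset ℕ}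
    (hB₁ : B₁ ∈ ℬ) (hB₂ : B₂ ∈ ℬ) (h₁ : T B₁ = {d₁}) (h₂ : T B₂ = {d₂}) (hne : d₁ ≠ d₂) :
    Extendable 𝒦 𝒜 := by
  have two : ∀ A ∈ 𝒜, 2 ≤ A.card → (S A).card = 2 := by
    intro A hA h2
    refine (h.card_left A hA).resolve_left fun h1 => ?_
    obtain ⟨c, hc⟩ := Finset.card_eq_one.1 h1
    rw [h.eq_singleton hB₁ hB₂ h₁ h₂ hne hA hc] at h2
    simp at h2
  have one₁ : (T B₁).card = 1 := by simp [h₁]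
  have one₂ : (T B₂).card = 1 := by simp [h₂]
  have hd₁ : d₁ ∈ B₁ := h.sub_right B₁ hB₁ (by simp [h₁])
  have hd₂ : d₂ ∈ B₂ := h.sub_right B₂ hB₂ (by simp [h₂])
  constructor
  · intro A hA h2
    refine ⟨_, h.join.mem A hA B₁ hB₁, Finset.subset_union_left, ?_⟩
    rw [h.low_left hA (two A hA h2), h.low_two_one hA hB₁ (two A hA h2) one₁]
  · intro c hc A hA h2 hcA
    have hSA := two A hA h2
    rw [h.low_left hA hSA] at hcA
    have hSc : S {c} = {c} := by
      rcases h.card_left _ hc with h1 | h1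
      · exact Finset.eq_of_subset_of_card_le (h.sub_left _ hc) (by simp [h1])
      · have := Finset.card_le_card (h.sub_left _ hc)
        simp [h1] at this
    have mem : ∀ {d B}, B ∈ ℬ → d ∈ B → T B = {d} → d ∈ S A ∧ c ≠ d := by
      intro d B hB hd hT
      obtain ⟨l, n⟩ := h.low_one_one hc hB hSc hT
      have l' := h.low_two_one hA hB hSA (by simp [hT])
      have hcAA := h.sub_left A hA hcA
      have := ((h.join.compat hc hB hA hB).mem_iff (x := c) (y := c) (z := d) (by rw [l]; simp)
        (by simp [hcAA]) (by rwa [l']) (by simp)).1 ⟨by rw [l]; simp, by simp [hd]⟩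
      rw [l'] at this
      exact ⟨this.1, n⟩
    obtain ⟨m1, n1⟩ := mem hB₁ hd₁ h₁
    obtain ⟨m2, n2⟩ := mem hB₂ hd₂ h₂
    have hsub : ({c, d₁, d₂} : Finset ℕ) ⊆ S A := by
      intro x hx
      simp only [Finset.mem_insert, Finset.mem_singleton] at hx
      rcases hx with rfl | rfl | rfl <;> assumption
    have := Finset.card_le_card hsub
    rw [hSA, Finset.card_eq_three.2 ⟨c, d₁, d₂, n1, n2, hne, rfl⟩] at this
    omega
  · intro A hA A' hA' h2 h2' hd
    have hS := two A hA h2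
    have hS' := two A' hA' h2'
    rw [h.low_left hA hS, h.low_left hA' hS'] at hd ⊢
    by_contra hn
    have mem : ∀ {d B}, B ∈ ℬ → d ∈ B → T B = {d} → d ∈ S A ∧ d ∈ S A' := by
      intro d B hB hd' hT
      have l := h.low_two_one hA hB hS (by simp [hT])
      have l' := h.low_two_one hA' hB hS' (by simp [hT])
      have := (h.join.compat hA hB hA' hB).mem_of_ne (y := d) (by rwa [l, l']) (by rwa [l, l'])
        (by simp [hd']) (by simp [hd'])
      rwa [l, l'] at this
    obtain ⟨m1, m1'⟩ := mem hB₁ hd₁ h₁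
    obtain ⟨m2, m2'⟩ := mem hB₂ hd₂ h₂
    have hp := Finset.card_pair hne
    have e1 : {d₁, d₂} = S A := Finset.eq_of_subset_of_card_le
      (by simp [Finset.insert_subset_iff, m1, m2]) (by omega)
    have e2 : {d₁, d₂} = S A' := Finset.eq_of_subset_of_card_le
      (by simp [Finset.insert_subset_iff, m1', m2']) (by omega)
    exact hn (e1.symm.trans e2)

end

section
variable {K K' A A₀ A' B B₀ B' : Finset ℕ} {𝒦 : Set (Finset ℕ)} {𝒜 ℬ : Finset (Finset ℕ)}
  {S T : Finset ℕ → Finset ℕ} {ζ b c d : ℕ}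

theorem Split.branched (h : Split 𝒦 𝒜 ℬ A₀ B₀ S T) (hζ : ∀ K ∈ 𝒦, ∀ x ∈ K, x < ζ)
    (hl : ∀ A ∈ 𝒜, ∀ c, S A = {c} → A = {c}) (hr : ∀ B ∈ ℬ, ∀ d, T B = {d} → B = {d})
    (hEl : Extendable 𝒦 𝒜) (hEr : Extendable 𝒦 ℬ) : Branched 𝒦 𝒜 ℬ ζ := by
  have hζA : ∀ A ∈ 𝒜, ∀ x ∈ A, x < ζ := fun A hA x hx =>
    hζ _ (h.join.mem A hA _ h.mem_right) x (Finset.mem_union_left _ hx)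
  have hζB : ∀ B ∈ ℬ, ∀ x ∈ B, x < ζ := fun B hB x hx =>
    hζ _ (h.join.mem _ h.mem_left B hB) x (Finset.mem_union_right _ hx)
  have lowA : ∀ A ∈ 𝒜, (S A).card = 2 → low (A ∪ {ζ}) = S A := by
    intro A hA h2
    rw [low_union_fresh (h.two_le hA h2) (by simpa using hζA A hA), h.low_left hA h2]
  have lowB : ∀ B ∈ ℬ, (T B).card = 2 → low (B ∪ {ζ + 1}) = T B := by
    intro B hB h2
    rw [low_union_fresh (h.symm.two_le hB h2) (by simpa using fun x hx => (hζB B hB x hx).le),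
      h.symm.low_left hB h2]
  refine ⟨?_, ?_, ?_, ?_⟩
  · have h1 : Coherent (adj 𝒦 𝒜 {ζ}) := h.join.coh.adj_fresh h.join.nonempty_left hEl (by simp)
      (by simpa using hζ) (by simpa using hζA) (by simp)
    refine h1.adj_fresh h.join.nonempty_right ⟨fun B hB h2 => ?_, hEr.not_mem, hEr.low_eq⟩
      (by simp) ?_ (by simpa using fun B hB x hx => (hζB B hB x hx).le) (by simp)
    · obtain ⟨K, hK, h3⟩ := hEr.dom B hB h2
      exact ⟨K, .inl hK, h3⟩
    · rintro K (hK | ⟨A, hA, rfl⟩) x hx f hf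
      · have := hζ K hK x hx
        simp only [Finset.mem_singleton] at hf
        omega
      · simp only [Finset.mem_singleton, Finset.mem_union] at hf hx
        rcases hx with hx | hx
        · have := hζA A hA x hx
          omega
        · omega
  · obtain ⟨c, hc⟩ := Finset.card_eq_one.1 h.one_left
    exact ⟨c, hl _ h.mem_left c hc ▸ h.mem_left⟩
  · obtain ⟨c, hc⟩ := Finset.card_eq_one.1 h.one_right
    exact ⟨c, hr _ h.mem_right c hc ▸ h.mem_right⟩
  · intro A hA B hB
    rcases h.card_left A hA with h1 | h1 <;> rcases h.card_right B hB with h2 | h2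
    · obtain ⟨c, hc⟩ := Finset.card_eq_one.1 h1
      obtain ⟨d, hd⟩ := Finset.card_eq_one.1 h2
      exact .inl ⟨c, d, hl A hA c hc, hr B hB d hd⟩
    · rw [lowB B hB h2, h.low_one_two hA hB h1 h2]
      simp
    · rw [lowA A hA h1, h.low_two_one hA hB h1 h2]
      simp
    · rw [lowA A hA h1, lowB B hB h2]
      rcases h.low_two_two hA hB h1 h2 with e | e <;> simp [e]

theorem Split.low_singleton (h : Split 𝒦 𝒜 ℬ A₀ B₀ S T) (hc : {c} ∈ 𝒜) : S {c} = {c} := by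
  have h1 := h.card_left _ hc
  exact Finset.eq_of_subset_of_card_le (h.sub_left _ hc) (by rw [Finset.card_singleton]; omega)

theorem Split.duplicated (h : Split 𝒦 𝒜 ℬ A₀ B₀ S T) (hζ : ∀ K ∈ 𝒦, ∀ x ∈ K, x < ζ)
    (hb : {b} ∈ ℬ) (h2 : ∀ B ∈ ℬ, B ≠ {b} → (T B).card = 2 ∧ b ∉ T B)
    (hd : ∀ B ∈ ℬ, ∀ B' ∈ ℬ, B ≠ {b} → B' ≠ {b} → ¬ Disjoint (T B) (T B') → T B = T B') :
    Duplicated 𝒦 𝒜 ℬ ζ := by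
  have hlow : ∀ B ∈ ℬ, B ≠ {b} → low B = T B := fun B hB hne => h.symm.low_left hB (h2 B hB hne).1
  have hTb := h.symm.low_singleton hb
  refine h.join.duplicated hζ hb (fun B hB hne => ⟨h.symm.two_le hB (h2 B hB hne).1, ?_, A₀,
    h.mem_left, ?_⟩) ?_ ?_
  · rw [hlow B hB hne]
    exact (h2 B hB hne).2
  · rw [hlow B hB hne, h.low_one_two h.mem_left hB h.one_left (h2 B hB hne).1]
  · intro B hB B' hB' hne hne'
    rw [hlow B hB hne, hlow B' hB' hne']
    exact hd B hB B' hB' hne hne'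
  · intro A hA B hB
    by_cases hne : B = {b}
    · exact .inl (by rw [hne])
    have hT := (h2 B hB hne).1
    rw [hlow B hB hne]
    rcases h.card_left A hA with h1 | h1
    · exact .inr ⟨hne, h.low_one_two hA hB h1 hT⟩
    · rw [h.low_two_one hA hb h1 (by simp [hTb])]
      exact (h.low_two_two hA hB h1 hT).imp id fun e => ⟨hne, e⟩

theorem Split.duplicated_of_extendable (h : Split 𝒦 𝒜 ℬ A₀ B₀ S T)
    (hζ : ∀ K ∈ 𝒦, ∀ x ∈ K, x < ζ) (hE : Extendable 𝒦 ℬ)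
    (hs : ∀ B ∈ ℬ, ∀ d, T B = {d} → B = {d}) (hu : ∀ B ∈ ℬ, ∀ d, T B = {d} → d = b) :
    Duplicated 𝒦 𝒜 ℬ ζ := by
  obtain ⟨d, hd⟩ := Finset.card_eq_one.1 h.one_right
  have hb : {b} ∈ ℬ := by
    rw [← hu _ h.mem_right d hd, ← hs _ h.mem_right d hd]
    exact h.mem_right
  have two : ∀ B ∈ ℬ, B ≠ {b} → (T B).card = 2 := by
    refine fun B hB hne => (h.card_right B hB).resolve_left fun h1 => ?_
    obtain ⟨d, hd⟩ := Finset.card_eq_one.1 h1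
    exact hne (hu B hB d hd ▸ hs B hB d hd)
  refine h.duplicated hζ hb (fun B hB hne => ⟨two B hB hne, ?_⟩) ?_
  · rw [← h.symm.low_left hB (two B hB hne)]
    exact hE.not_mem b hb B hB (h.symm.two_le hB (two B hB hne))
  · intro B hB B' hB' hne hne'
    rw [← h.symm.low_left hB (two B hB hne), ← h.symm.low_left hB' (two B' hB' hne')]
    exact hE.low_eq B hB B' hB' (h.symm.two_le hB (two B hB hne))
      (h.symm.two_le hB' (two B' hB' hne'))

theorem Split.twin_of_mem (h : Split 𝒦 𝒜 ℬ A₀ B₀ S T) (hS : ∀ A ∈ 𝒜, (S A).card = 1 → S A = {c})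
    (hT : ∀ B ∈ ℬ, (T B).card = 1 → T B = {b}) (hB : B ∈ ℬ) (hb : b ∈ T B) (hA : A ∈ 𝒜) :
    low (A ∪ B) = low (A ∪ B₀) := by
  have hS₀ := hS _ h.mem_left h.one_left
  have hT₀ := hT _ h.mem_right h.one_right
  have hc₀ : c ∈ A₀ := h.sub_left _ h.mem_left (by simp [hS₀])
  have hb₀ : b ∈ B₀ := h.sub_right _ h.mem_right (by simp [hT₀])
  rcases h.card_right B hB with h1 | h1
  · have hTB := hT B hB h1
    rcases h.card_left A hA with h2 | h2
    · rw [(h.low_one_one hA hB (hS A hA h2) hTB).1,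
        (h.low_one_one hA h.mem_right (hS A hA h2) hT₀).1]
    · rw [h.low_two_one hA hB h2 h1, h.low_two_one hA h.mem_right h2 h.one_right]
  obtain ⟨l, n⟩ := h.low_one_one h.mem_left h.mem_right hS₀ hT₀
  have l' := h.low_one_two h.mem_left hB h.one_left h1
  have hbB : b ∈ B := h.sub_right B hB hb
  have hcT : c ∈ T B := by
    have := ((h.join.compat h.mem_left hB h.mem_left h.mem_right).mem_iff (x := b) (y := c)
      (z := c) (by rwa [l']) (by simp [hb₀]) (by rw [l]; simp) (by simp [hc₀])).2
      ⟨by rw [l]; simp, by simp [hc₀]⟩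
    rw [l'] at this
    exact this.1
  have hTB : T B = {c, b} := (Finset.eq_of_subset_of_card_le
    (by simp [Finset.insert_subset_iff, hb, hcT]) (by rw [Finset.card_pair n, h1])).symm
  rcases h.card_left A hA with h2 | h2
  · rw [h.low_one_two hA hB h2 h1, hTB, (h.low_one_one hA h.mem_right (hS A hA h2) hT₀).1]
  have l2 := h.low_two_one hA h.mem_right h2 h.one_right
  rw [l2]
  refine (h.low_two_two hA hB h2 h1).elim id fun e => ?_
  rw [e]
  obtain ⟨a, ha⟩ : (S A).Nonempty := Finset.card_pos.1 (by omega)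
  have key : S A ⊆ T B := fun z hz => by
    have := ((h.join.compat hA hB hA h.mem_right).mem_iff (x := b) (y := a) (z := z)
      (by rwa [e]) (by simp [hb₀]) (by rwa [l2]) (by simp [h.sub_left A hA ha])).2
      ⟨by rwa [l2], by simp [h.sub_left A hA hz]⟩
    rw [e] at this
    exact this.1
  exact (Finset.eq_of_subset_of_card_le key (by omega)).symm

/-- Two members with distinct but intersecting traces confine a member with a one-element trace. -/
theorem Split.eq_pair (h : Split 𝒦 𝒜 ℬ A₀ B₀ S T) (hB : B ∈ ℬ) (hB' : B' ∈ ℬ)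
    (h1 : (T B).card = 2) (h1' : (T B').card = 2) (hd : ¬ Disjoint (T B) (T B')) (hne : T B ≠ T B')
    (hA : A ∈ 𝒜) (hSA : S A = {c}) : A = {c} ∧ c ∈ T B ∧ c ∈ T B' := by
  have l := h.low_one_two hA hB (by simp [hSA]) h1
  have l' := h.low_one_two hA hB' (by simp [hSA]) h1'
  rw [← l, ← l'] at hd hne ⊢
  have hcA : c ∈ A := h.sub_left A hA (by simp [hSA])
  have hc := h.join.compat hA hB hA hB'
  have h1 := hc.card_le_one hne (h.join.two_le hA hB) (h.join.two_le hA hB') hd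
    (Finset.subset_union_left (s₁ := A)) Finset.subset_union_left
  refine ⟨?_, hc.mem_of_ne hne hd (by simp [hcA]) (by simp [hcA])⟩
  exact (Finset.eq_of_subset_of_card_le (by simpa using hcA) (by simpa using h1)).symm

theorem Split.duplicated_or (h : Split 𝒦 𝒜 ℬ A₀ B₀ S T) (hζ : ∀ K ∈ 𝒦, ∀ x ∈ K, x < ζ)
    (hS : ∀ A ∈ 𝒜, (S A).card = 1 → S A = {c}) (hT : ∀ B ∈ ℬ, (T B).card = 1 → T B = {b})
    (hZ : (twins 𝒜 ℬ B₀).card < 2) : Duplicated 𝒦 𝒜 ℬ ζ ∨ Duplicated 𝒦 ℬ 𝒜 ζ := by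
  have hS₀ := hS _ h.mem_left h.one_left
  have hT₀ := hT _ h.mem_right h.one_right
  have hb₀ : b ∈ B₀ := h.sub_right _ h.mem_right (by simp [hT₀])
  have hbZ : b ∈ twins 𝒜 ℬ B₀ := subset_twins (𝒜 := 𝒜) h.mem_right (fun _ _ => rfl) hb₀
  have hZb : twins 𝒜 ℬ B₀ = {b} :=
    (Finset.eq_of_subset_of_card_le (by simpa using hbZ) (by simp; omega)).symm
  have small : ∀ B ∈ ℬ, (∀ A ∈ 𝒜, low (A ∪ B) = low (A ∪ B₀)) → B = {b} := fun B hB hg =>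
    (Finset.Nonempty.subset_singleton_iff (h.join.nonempty_right B hB)).1 (hZb ▸ subset_twins hB hg)
  have hBb : B₀ = {b} := small B₀ h.mem_right fun _ _ => rfl
  have hb : {b} ∈ ℬ := hBb ▸ h.mem_right
  have two : ∀ B ∈ ℬ, B ≠ {b} → (T B).card = 2 ∧ b ∉ T B := by
    intro B hB hne
    have hbT : b ∉ T B := fun hbT => hne (small B hB fun A hA => h.twin_of_mem hS hT hB hbT hA)
    refine ⟨(h.card_right B hB).resolve_left fun h1 => hbT ?_, hbT⟩
    simp [hT B hB h1]
  by_cases hd : ∀ B ∈ ℬ, ∀ B' ∈ ℬ, B ≠ {b} → B' ≠ {b} → ¬ Disjoint (T B) (T B') → T B = T B'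
  · exact .inl (h.duplicated hζ hb two hd)
  right
  push Not at hd
  obtain ⟨B₁, hB₁, B₂, hB₂, ne₁, ne₂, hdis, hne⟩ := hd
  obtain ⟨t1, bt1⟩ := two B₁ hB₁ ne₁
  obtain ⟨t2, bt2⟩ := two B₂ hB₂ ne₂
  obtain ⟨hA₀, c1, c2⟩ := h.eq_pair hB₁ hB₂ t1 t2 hdis hne h.mem_left hS₀
  have hc : {c} ∈ 𝒜 := hA₀ ▸ h.mem_left
  obtain ⟨-, hcb⟩ := h.low_one_one h.mem_left h.mem_right hS₀ hT₀
  have twoA : ∀ A ∈ 𝒜, A ≠ {c} → (S A).card = 2 := fun A hA hn =>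
    (h.card_left A hA).resolve_left fun h1 =>
      hn (h.eq_pair hB₁ hB₂ t1 t2 hdis hne hA (hS A hA h1)).1
  have hcS : ∀ A ∈ 𝒜, A ≠ {c} → c ∉ S A := by
    intro A hA hn hcS
    have h2 := twoA A hA hn
    have l := h.low_two_one hA h.mem_right h2 h.one_right
    have l' := (h.low_one_one h.mem_left h.mem_right hS₀ hT₀).1
    have hcA := h.sub_left A hA hcS
    have hbS : b ∈ S A := by
      have := ((h.join.compat hA h.mem_right h.mem_left h.mem_right).mem_iff (x := c) (y := c)
        (z := b) (by rwa [l]) (by simp [hA₀]) (by rw [l']; simp) (by simp [hcA])).2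
        ⟨by rw [l']; simp, by simp [hb₀]⟩
      rw [l] at this
      exact this.1
    have hcB := h.sub_right B₁ hB₁ c1
    rcases h.low_two_two hA hB₁ h2 t1 with e | e
    · have m : c ∈ low (A ∪ B₁) ∩ B₁ := by simp [e, hcS, hcB]
      rcases h.right A hA B₁ hB₁ with e2 | e2
      · simp [e2] at m
      · have : T B₁ ⊆ S A := by rw [← e2, ← e]; exact Finset.inter_subset_left
        have := Finset.eq_of_subset_of_card_le this (by omega)
        exact bt1 (this ▸ hbS)
    · have m : c ∈ low (A ∪ B₁) ∩ A := by simp [e, c1, hcA]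
      rcases h.left A hA B₁ hB₁ with e2 | e2
      · simp [e2] at m
      · have : b ∈ low (A ∪ B₁) ∩ A := by rwa [e2]
        rw [e] at this
        exact bt1 (Finset.mem_inter.1 this).1
  refine h.symm.duplicated hζ hc (fun A hA hn => ⟨twoA A hA hn, hcS A hA hn⟩) ?_
  intro A₁ hA₁ A₂ hA₂ n₁ n₂ hdA
  by_contra hneA
  have s1 := twoA A₁ hA₁ n₁
  have s2 := twoA A₂ hA₂ n₂
  have cs1 := hcS A₁ hA₁ n₁
  have cs2 := hcS A₂ hA₂ n₂
  obtain ⟨-, b1, b2⟩ := h.symm.eq_pair hA₁ hA₂ s1 s2 hdA hneA h.mem_right hT₀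
  have bA₁ := h.sub_left A₁ hA₁ b1
  have bA₂ := h.sub_left A₂ hA₂ b2
  have cB₁ := h.sub_right B₁ hB₁ c1
  have cB₂ := h.sub_right B₂ hB₂ c2
  rcases lt_or_gt_of_ne hcb with hlt | hlt
  · have key : ∀ B ∈ ℬ, c ∈ B → (T B).card = 2 → low (A₁ ∪ B) = T B := fun B hB hcB h2 =>
      (h.low_two_two hA₁ hB s1 h2).resolve_left fun e =>
        cs1 (e ▸ mem_low_of_le (x := b) (by rwa [e]) (by simp [hcB]) hlt.le)
    have e1 := key B₁ hB₁ cB₁ t1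
    have e2 := key B₂ hB₂ cB₂ t2
    have := (h.join.compat hA₁ hB₁ hA₁ hB₂).low_eq b (by simp [bA₁]) (by simp [bA₁]) (by rwa [e1])
      (by rwa [e2]) (by rwa [e1, e2])
    rw [e1, e2] at this
    exact hne this
  · have key : ∀ A ∈ 𝒜, b ∈ A → (S A).card = 2 → low (A ∪ B₁) = S A := fun A hA hbA h2 =>
      (h.low_two_two hA hB₁ h2 t1).resolve_right fun e =>
        bt1 (e ▸ mem_low_of_le (x := c) (by rwa [e]) (by simp [hbA]) hlt.le)
    have e1 := key A₁ hA₁ bA₁ s1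
    have e2 := key A₂ hA₂ bA₂ s2
    have := (h.join.compat hA₁ hB₁ hA₂ hB₁).low_eq c (by simp [cB₁]) (by simp [cB₁]) (by rwa [e1])
      (by rwa [e2]) (by rwa [e1, e2])
    rw [e1, e2] at this
    exact hneA this

theorem Split.classify (h : Split 𝒦 𝒜 ℬ A₀ B₀ S T) (hζ : ∀ K ∈ 𝒦, ∀ x ∈ K, x < ζ) :
    Absorbed 𝒦 𝒜 ℬ ∨ Duplicated 𝒦 𝒜 ℬ ζ ∨ Duplicated 𝒦 ℬ 𝒜 ζ ∨ Branched 𝒦 𝒜 ℬ ζ := by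
  obtain ⟨c, hc⟩ := Finset.card_eq_one.1 h.one_left
  obtain ⟨b, hb⟩ := Finset.card_eq_one.1 h.one_right
  by_cases hS : ∀ A ∈ 𝒜, ∀ c', S A = {c'} → c' = c <;>
    by_cases hT : ∀ B ∈ ℬ, ∀ d, T B = {d} → d = b
  · have hS' : ∀ A ∈ 𝒜, (S A).card = 1 → S A = {c} := by
      intro A hA h1
      obtain ⟨c', hc'⟩ := Finset.card_eq_one.1 h1
      rw [hc', hS A hA c' hc']
    have hT' : ∀ B ∈ ℬ, (T B).card = 1 → T B = {b} := by
      intro B hB h1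
      obtain ⟨c', hc'⟩ := Finset.card_eq_one.1 h1
      rw [hc', hT B hB c' hc']
    by_cases hZ : (twins 𝒜 ℬ B₀).card < 2
    · exact .inr ((h.duplicated_or hζ hS' hT' hZ).imp id .inl)
    by_cases hZ' : (twins ℬ 𝒜 A₀).card < 2
    · exact .inr ((h.symm.duplicated_or hζ hT' hS' hZ').symm.imp id .inl)
    refine .inl (h.join.absorbed h.mem_left h.mem_right (fun A hA B hB => ?_) (by omega) (by omega))
    rcases h.card_left A hA with h1 | h1 <;> rcases h.card_right B hB with h2 | h2
    · rw [(h.low_one_one hA hB (hS' A hA h1) (hT' B hB h2)).1,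
        (h.low_one_one hA h.mem_right (hS' A hA h1) hb).1]
      exact .inl rfl
    · rw [h.low_one_two hA hB h1 h2, h.low_one_two h.mem_left hB h.one_left h2]
      exact .inr rfl
    · rw [h.low_two_one hA hB h1 h2, h.low_two_one hA h.mem_right h1 h.one_right]
      exact .inl rfl
    · rw [h.low_one_two h.mem_left hB h.one_left h2, h.low_two_one hA h.mem_right h1 h.one_right]
      exact h.low_two_two hA hB h1 h2
  · push Not at hT
    obtain ⟨B, hB, d, hd, hdb⟩ := hT
    exact .inr (.inr (.inl (h.symm.duplicated_of_extendable hζ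
      (h.extendable hB h.mem_right hd hb hdb)
      (fun A hA c' hc' => h.eq_singleton hB h.mem_right hd hb hdb hA hc') hS)))
  · push Not at hS
    obtain ⟨A, hA, d, hd, hdc⟩ := hS
    exact .inr (.inl (h.duplicated_of_extendable hζ
      (h.symm.extendable hA h.mem_left hd hc hdc)
      (fun B hB c' hc' => h.symm.eq_singleton hA h.mem_left hd hc hdc hB hc') hT))
  · push Not at hS hT
    obtain ⟨A, hA, d', hd', hdc⟩ := hS
    obtain ⟨B, hB, d, hd, hdb⟩ := hT
    exact .inr (.inr (.inr (h.branched hζ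
      (fun A hA c' hc' => h.eq_singleton hB h.mem_right hd hb hdb hA hc')
      (fun B hB c' hc' => h.symm.eq_singleton hA h.mem_left hd' hc hdc hB hc')
      (h.extendable hB h.mem_right hd hb hdb) (h.symm.extendable hA h.mem_left hd' hc hdc))))

theorem Join.classify (h : Join 𝒦 𝒜 ℬ) (hζ : ∀ K ∈ 𝒦, ∀ x ∈ K, x < ζ) :
    Absorbed 𝒦 𝒜 ℬ ∨ Duplicated 𝒦 𝒜 ℬ ζ ∨ Duplicated 𝒦 ℬ 𝒜 ζ ∨ Branched 𝒦 𝒜 ℬ ζ := by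
  by_cases hU : Unsplit 𝒜 ℬ
  · exact (h.classify_of_unsplit hζ hU).imp id (Or.imp id .inl)
  unfold Unsplit at hU
  push Not at hU
  obtain ⟨A, hA, B, hB, h1, h2⟩ := hU
  exact (h.split hA hB h1 h2).classify hζ

end

section
variable {φ φ' : Formula} {𝒞 𝒟 : Finset Clause} {z w : Lit} {lab lab' : Lit → Finset ℕ}
  {X Mu Z Z' : Finset ℕ} {L : Finset (Sym2 ℕ)} {C D K : Clause}

/-- All labels of the literals of a clause. -/
def labels (lab : Lit → Finset ℕ) (K : Clause) : Finset ℕ := K.biUnion lab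

/-- Every literal of the clause carries a label. -/
def Labelled (lab : Lit → Finset ℕ) (K : Clause) : Prop := ∀ r ∈ K, (lab r).Nonempty

/-- Every literal of the clause carries exactly one label. -/
def Rigid (lab : Lit → Finset ℕ) (K : Clause) : Prop := ∀ r ∈ K, (lab r).card = 1

/-- The label sets of the labelled clauses of a formula. -/
def labelSets (lab : Lit → Finset ℕ) (φ : Formula) : Set (Finset ℕ) :=
  {S | ∃ K ∈ φ, Labelled lab K ∧ S = labels lab K}

theorem labels_union : labels lab (C ∪ D) = labels lab C ∪ labels lab D :=
  Finset.union_biUnion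

theorem labelled_union : Labelled lab (C ∪ D) ↔ Labelled lab C ∧ Labelled lab D := by
  simp only [Labelled, Finset.mem_union, or_imp, forall_and]

theorem subset_labels {r : Lit} (hr : r ∈ K) : lab r ⊆ labels lab K :=
  Finset.subset_biUnion_of_mem lab hr

theorem Labelled.eq_singleton (hK : Labelled lab K) {b : ℕ} (hb : labels lab K = {b}) {r : Lit}
    (hr : r ∈ K) : lab r = {b} :=
  (Finset.Nonempty.subset_singleton_iff (hK r hr)).1 (hb ▸ subset_labels hr)

/-- The invariant of idealized BVA: a labelling of the literals in which the pairs of least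
labels of the clauses contain the edges of a network and a private edge for each of its
multiple labels. -/
structure Labelling (X Mu : Finset ℕ) (L : Finset (Sym2 ℕ)) (lab : Lit → Finset ℕ)
    (φ : Formula) : Prop where
  coh : Coherent (labelSets lab φ)
  edge : ∀ a b, s(a, b) ∈ L → a ≠ b ∧ ∃ K ∈ φ, Labelled lab K ∧ low (labels lab K) = {a, b}
  mem_edge : ∀ K ∈ φ, Labelled lab K → Rigid lab K → ∀ a b, labels lab K = {a, b} → a ≠ b →
    s(a, b) ∈ L
  uniq : ∀ K ∈ φ, Labelled lab K → ∀ K' ∈ φ, Labelled lab K' → ∀ r ∈ K, ∀ r' ∈ K', ∀ l ∉ Mu,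
    lab r = {l} → lab r' = {l} → r = r'
  mark : ∀ b ∈ Mu, ∃ ζ, b < ζ ∧ (∃ K ∈ φ, Labelled lab K ∧ low (labels lab K) = {b, ζ}) ∧
    ∀ a, s(ζ, a) ∉ L
  net : Network X Mu L

theorem Labelling.card_le (h : Labelling X Mu L lab φ) : L.card + Mu.card ≤ φ.card := by
  have hm := h.mark
  choose! ζ hlt hK hL using hm
  have hinj : Set.InjOn (fun b => s(b, ζ b)) (Mu : Set ℕ) := by
    intro b hb b' hb' e
    rcases Sym2.eq_iff.1 e with ⟨e, -⟩ | ⟨e, e'⟩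
    · exact e
    · have := hlt b hb
      have := hlt b' hb'
      omega
  have hdis : Disjoint L (Mu.image fun b => s(b, ζ b)) := by
    rw [Finset.disjoint_left]
    intro e he he'
    obtain ⟨b, hb, rfl⟩ := Finset.mem_image.1 he'
    exact hL b hb b (Sym2.eq_swap ▸ he)
  rw [← Finset.card_image_of_injOn hinj, ← Finset.card_union_of_disjoint hdis]
  have hf : Function.Injective (Sym2.toFinset : Sym2 ℕ → Finset ℕ) := by
    intro e e' he
    refine Sym2.ext fun x => ?_
    rw [← Sym2.mem_toFinset, he, Sym2.mem_toFinset]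
  rw [← Finset.card_image_of_injective _ hf]
  refine (Finset.card_le_card ?_).trans (Finset.card_image_le (f := fun K => low (labels lab K)))
  intro S hS
  obtain ⟨e, he, rfl⟩ := Finset.mem_image.1 hS
  have pair : ∀ a b : ℕ, (s(a, b)).toFinset = {a, b} := fun a b => by
    ext x
    simp
  rcases Finset.mem_union.1 he with he | he
  · induction e with
    | h a b =>
      obtain ⟨-, K, hK, -, hl⟩ := h.edge a b he
      exact Finset.mem_image.2 ⟨K, hK, by rw [hl, pair]⟩
  · obtain ⟨b, hb, rfl⟩ := Finset.mem_image.1 he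
    obtain ⟨K, hK, -, hl⟩ := hK b hb
    exact Finset.mem_image.2 ⟨K, hK, by rw [hl, pair]⟩

/-- The formula `φ'` arises from `φ` by replacing `𝒞 ⋈ 𝒟` using the new literals `z` and `w`. -/
structure Factoring (φ φ' : Formula) (𝒞 𝒟 : Finset Clause) (z w : Lit) : Prop where
  ne : z ≠ w
  fresh : ∀ K ∈ φ, z ∉ K ∧ w ∉ K
  nonempty_left : ∀ C ∈ 𝒞, C.Nonempty
  nonempty_right : ∀ D ∈ 𝒟, D.Nonempty
  union_mem : ∀ C ∈ 𝒞, ∀ D ∈ 𝒟, C ∪ D ∈ φ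
  mem_iff : ∀ K, K ∈ φ' ↔ (K ∈ φ ∧ ∀ C ∈ 𝒞, ∀ D ∈ 𝒟, K ≠ C ∪ D) ∨ (∃ C ∈ 𝒞, K = insert z C) ∨
    ∃ D ∈ 𝒟, K = insert w D

theorem Factoring.symm (h : Factoring φ φ' 𝒞 𝒟 z w) : Factoring φ φ' 𝒟 𝒞 w z where
  ne := h.ne.symm
  fresh K hK := (h.fresh K hK).symm
  nonempty_left := h.nonempty_right
  nonempty_right := h.nonempty_left
  union_mem D hD C hC := Finset.union_comm C D ▸ h.union_mem C hC D hD
  mem_iff K := by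
    rw [h.mem_iff, or_comm (a := ∃ C ∈ 𝒞, K = insert z C)]
    refine or_congr_left (and_congr_right fun _ => ?_)
    exact ⟨fun h D hD C hC => Finset.union_comm C D ▸ h C hC D hD,
      fun h C hC D hD => Finset.union_comm D C ▸ h D hD C hC⟩

theorem BVAStep.factoring (h : BVAStep φ φ') : ∃ 𝒞 𝒟 z w, Factoring φ φ' 𝒞 𝒟 z w := by
  obtain ⟨𝒞, 𝒟, y, h𝒞, h𝒟, hJ, hy, rfl⟩ := h
  have hmem : ∀ K, K ∈ JoinClauses 𝒞 𝒟 ↔ ∃ C ∈ 𝒞, ∃ D ∈ 𝒟, K = C ∪ D := by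
    intro K
    simp only [JoinClauses, Finset.mem_image, Finset.mem_product, Prod.exists]
    constructor
    · rintro ⟨C, D, ⟨hC, hD⟩, rfl⟩
      exact ⟨C, hC, D, hD, rfl⟩
    · rintro ⟨C, hC, D, hD, rfl⟩
      exact ⟨C, D, ⟨hC, hD⟩, rfl⟩
  have hv : ∀ K ∈ φ, ∀ s, (y, s) ∉ K := fun K hK s hs =>
    hy (Finset.mem_biUnion.2 ⟨K, hK, Finset.mem_image.2 ⟨_, hs, rfl⟩⟩)
  refine ⟨𝒞, 𝒟, (y, true), (y, false), by simp, fun K hK => ⟨hv K hK _, hv K hK _⟩,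
    fun C hC => (h𝒞 C hC).2, fun D hD => (h𝒟 D hD).2,
    fun C hC D hD => hJ ((hmem _).2 ⟨C, hC, D, hD, rfl⟩), fun K => ?_⟩
  rw [Finset.mem_union, Finset.mem_union, Finset.mem_sdiff, hmem, Finset.mem_image,
    Finset.mem_image, or_assoc]
  push Not
  simp only [eq_comm]

/-- `lab'` relabels the literals `z` and `w` by `Z` and `Z'`. -/
structure Relabels (lab lab' : Lit → Finset ℕ) (z w : Lit) (Z Z' : Finset ℕ) : Prop where
  left : lab' z = Z
  right : lab' w = Z'
  other : ∀ r, r ≠ z → r ≠ w → lab' r = lab r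

theorem exists_relabels (lab : Lit → Finset ℕ) (h : z ≠ w) (Z Z' : Finset ℕ) :
    ∃ lab', Relabels lab lab' z w Z Z' :=
  ⟨Function.update (Function.update lab z Z) w Z', by simp [h], by simp,
    fun r h1 h2 => by simp [h1, h2]⟩

theorem Relabels.symm (h : Relabels lab lab' z w Z Z') : Relabels lab lab' w z Z' Z :=
  ⟨h.right, h.left, fun r h1 h2 => h.other r h2 h1⟩

theorem Relabels.labels_eq (h : Relabels lab lab' z w Z Z') (hz : z ∉ K) (hw : w ∉ K) :
    labels lab' K = labels lab K :=
  Finset.biUnion_congr rfl fun r hr =>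
    h.other r (fun e => hz (e ▸ hr)) fun e => hw (e ▸ hr)

theorem Relabels.labelled_iff (h : Relabels lab lab' z w Z Z') (hz : z ∉ K) (hw : w ∉ K) :
    Labelled lab' K ↔ Labelled lab K :=
  forall₂_congr fun r hr => by
    rw [h.other r (fun e => hz (e ▸ hr)) fun e => hw (e ▸ hr)]

theorem Relabels.rigid_iff (h : Relabels lab lab' z w Z Z') (hz : z ∉ K) (hw : w ∉ K) :
    Rigid lab' K ↔ Rigid lab K :=
  forall₂_congr fun r hr => by
    rw [h.other r (fun e => hz (e ▸ hr)) fun e => hw (e ▸ hr)]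

/-- If one side of the factored clauses is unlabelled, the new literals stay unlabelled. -/
theorem Labelling.of_unlabelled (h : Labelling X Mu L lab φ) (hF : Factoring φ φ' 𝒞 𝒟 z w)
    (hR : Relabels lab lab' z w ∅ ∅)
    (h0 : ∀ C ∈ 𝒞, ∀ D ∈ 𝒟, ¬ (Labelled lab C ∧ Labelled lab D)) : Labelling X Mu L lab' φ' := by
  have old : ∀ K ∈ φ', Labelled lab' K → K ∈ φ ∧ Labelled lab K := by
    intro K hK hl
    rcases (hF.mem_iff K).1 hK with ⟨h1, -⟩ | ⟨C, hC, rfl⟩ | ⟨D, hD, rfl⟩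
    · exact ⟨h1, (hR.labelled_iff (hF.fresh K h1).1 (hF.fresh K h1).2).1 hl⟩
    · have := hl z (Finset.mem_insert_self _ _)
      simp [hR.left] at this
    · have := hl w (Finset.mem_insert_self _ _)
      simp [hR.right] at this
  have lab_eq : ∀ K ∈ φ, labels lab' K = labels lab K := fun K hK =>
    hR.labels_eq (hF.fresh K hK).1 (hF.fresh K hK).2
  have new : ∀ S, (∃ K ∈ φ, Labelled lab K ∧ low (labels lab K) = S) →
      ∃ K ∈ φ', Labelled lab' K ∧ low (labels lab' K) = S := by
    rintro S ⟨K, hK, hl, rfl⟩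
    refine ⟨K, (hF.mem_iff K).2 (.inl ⟨hK, ?_⟩),
      (hR.labelled_iff (hF.fresh K hK).1 (hF.fresh K hK).2).2 hl, by rw [lab_eq K hK]⟩
    rintro C hC D hD rfl
    exact h0 C hC D hD (labelled_union.1 hl)
  have other : ∀ K ∈ φ, ∀ r ∈ K, lab' r = lab r := fun K hK r hr =>
    hR.other r (fun e => (hF.fresh K hK).1 (e ▸ hr)) fun e => (hF.fresh K hK).2 (e ▸ hr)
  refine ⟨⟨?_, ?_⟩, fun a b hab => ⟨(h.edge a b hab).1, new _ (h.edge a b hab).2⟩, ?_, ?_,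
    fun b hb => ?_, h.net⟩
  · rintro _ ⟨K, hK, hl, rfl⟩
    obtain ⟨h1, h2⟩ := old K hK hl
    exact lab_eq K h1 ▸ h.coh.two_le _ ⟨K, h1, h2, rfl⟩
  · rintro _ ⟨K, hK, hl, rfl⟩ _ ⟨K', hK', hl', rfl⟩
    obtain ⟨h1, h2⟩ := old K hK hl
    obtain ⟨h1', h2'⟩ := old K' hK' hl'
    rw [lab_eq K h1, lab_eq K' h1']
    exact h.coh.compat _ ⟨K, h1, h2, rfl⟩ _ ⟨K', h1', h2', rfl⟩
  · intro K hK hl hr a b hab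
    obtain ⟨h1, h2⟩ := old K hK hl
    exact h.mem_edge K h1 h2 ((hR.rigid_iff (hF.fresh K h1).1 (hF.fresh K h1).2).1 hr) a b
      (lab_eq K h1 ▸ hab)
  · intro K hK hl K' hK' hl' r hr r' hr' l hM
    obtain ⟨h1, h2⟩ := old K hK hl
    obtain ⟨h1', h2'⟩ := old K' hK' hl'
    rw [other K h1 r hr, other K' h1' r' hr']
    exact h.uniq K h1 h2 K' h1' h2' r hr r' hr' l hM
  · obtain ⟨ζ, h1, h2, h3⟩ := h.mark b hb
    exact ⟨ζ, h1, new _ h2, h3⟩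

/-! ### Relabelling the new literals -/

/-- A factoring step with labelled clauses on both sides, and nonempty new labels. -/
structure Relabelling (φ φ' : Formula) (𝒞 𝒟 : Finset Clause) (z w : Lit)
    (lab lab' : Lit → Finset ℕ) (Z Z' : Finset ℕ) (𝒜 ℬ : Finset (Finset ℕ)) : Prop where
  fac : Factoring φ φ' 𝒞 𝒟 z w
  rel : Relabels lab lab' z w Z Z'
  left_ne : Z.Nonempty
  right_ne : Z'.Nonempty
  exists_left : ∃ C ∈ 𝒞, Labelled lab C
  exists_right : ∃ D ∈ 𝒟, Labelled lab D
  mem_left : ∀ A, A ∈ 𝒜 ↔ ∃ C ∈ 𝒞, Labelled lab C ∧ labels lab C = A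
  mem_right : ∀ B, B ∈ ℬ ↔ ∃ D ∈ 𝒟, Labelled lab D ∧ labels lab D = B

section
variable {𝒜 ℬ : Finset (Finset ℕ)}

theorem Relabelling.symm (h : Relabelling φ φ' 𝒞 𝒟 z w lab lab' Z Z' 𝒜 ℬ) :
    Relabelling φ φ' 𝒟 𝒞 w z lab lab' Z' Z ℬ 𝒜 :=
  ⟨h.fac.symm, h.rel.symm, h.right_ne, h.left_ne, h.exists_right, h.exists_left, h.mem_right,
    h.mem_left⟩

theorem Relabelling.not_mem (h : Relabelling φ φ' 𝒞 𝒟 z w lab lab' Z Z' 𝒜 ℬ) (hC : C ∈ 𝒞) :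
    z ∉ C ∧ w ∉ C := by
  obtain ⟨D, hD, -⟩ := h.exists_right
  have := h.fac.fresh _ (h.fac.union_mem C hC D hD)
  simp only [Finset.mem_union, not_or] at this
  exact ⟨this.1.1, this.2.1⟩

theorem Relabelling.labels_insert (h : Relabelling φ φ' 𝒞 𝒟 z w lab lab' Z Z' 𝒜 ℬ) (hC : C ∈ 𝒞) :
    labels lab' (insert z C) = labels lab C ∪ Z := by
  have e := h.rel.labels_eq (h.not_mem hC).1 (h.not_mem hC).2
  rw [← e, labels, Finset.biUnion_insert, h.rel.left, Finset.union_comm]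
  rfl

theorem Relabelling.labelled_insert (h : Relabelling φ φ' 𝒞 𝒟 z w lab lab' Z Z' 𝒜 ℬ)
    (hC : C ∈ 𝒞) : Labelled lab' (insert z C) ↔ Labelled lab C := by
  rw [← h.rel.labelled_iff (h.not_mem hC).1 (h.not_mem hC).2]
  simp [Labelled, h.rel.left, h.left_ne]

theorem Relabelling.cases (h : Relabelling φ φ' 𝒞 𝒟 z w lab lab' Z Z' 𝒜 ℬ) (hK : K ∈ φ')
    (hl : Labelled lab' K) :
    (K ∈ φ ∧ Labelled lab K ∧ labels lab' K = labels lab K ∧ ∀ C ∈ 𝒞, ∀ D ∈ 𝒟, K ≠ C ∪ D) ∨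
    (∃ C ∈ 𝒞, K = insert z C ∧ Labelled lab C ∧ labels lab' K = labels lab C ∪ Z) ∨
    ∃ D ∈ 𝒟, K = insert w D ∧ Labelled lab D ∧ labels lab' K = labels lab D ∪ Z' := by
  rcases (h.fac.mem_iff K).1 hK with ⟨h1, h2⟩ | ⟨C, hC, rfl⟩ | ⟨D, hD, rfl⟩
  · have hf := h.fac.fresh K h1
    exact .inl ⟨h1, (h.rel.labelled_iff hf.1 hf.2).1 hl, h.rel.labels_eq hf.1 hf.2, h2⟩
  · exact .inr (.inl ⟨C, hC, rfl, (h.labelled_insert hC).1 hl, h.labels_insert hC⟩)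
  · exact .inr (.inr ⟨D, hD, rfl, (h.symm.labelled_insert hD).1 hl, h.symm.labels_insert hD⟩)

theorem Relabelling.coherent (h : Relabelling φ φ' 𝒞 𝒟 z w lab lab' Z Z' 𝒜 ℬ)
    (hc : Coherent (adj (adj (labelSets lab φ) 𝒜 Z) ℬ Z')) : Coherent (labelSets lab' φ') := by
  have key : ∀ S ∈ labelSets lab' φ', S ∈ adj (adj (labelSets lab φ) 𝒜 Z) ℬ Z' := by
    rintro _ ⟨K, hK, hl, rfl⟩
    rcases h.cases hK hl with ⟨h1, h2, h3, -⟩ | ⟨C, hC, -, h2, h3⟩ | ⟨D, hD, -, h2, h3⟩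
    · exact .inl (.inl ⟨K, h1, h2, h3⟩)
    · exact .inl (.inr ⟨_, (h.mem_left _).2 ⟨C, hC, h2, rfl⟩, h3⟩)
    · exact .inr ⟨_, (h.mem_right _).2 ⟨D, hD, h2, rfl⟩, h3⟩
  exact ⟨fun S hS => hc.two_le S (key S hS), fun S hS T hT => hc.compat S (key S hS) T (key T hT)⟩

theorem Relabelling.exists_insert (h : Relabelling φ φ' 𝒞 𝒟 z w lab lab' Z Z' 𝒜 ℬ)
    {A : Finset ℕ} (hA : A ∈ 𝒜) : ∃ K ∈ φ', Labelled lab' K ∧ labels lab' K = A ∪ Z := by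
  obtain ⟨C, hC, hl, rfl⟩ := (h.mem_left A).1 hA
  exact ⟨_, (h.fac.mem_iff _).2 (.inr (.inl ⟨C, hC, rfl⟩)), (h.labelled_insert hC).2 hl,
    h.labels_insert hC⟩

theorem Relabelling.exists_low (h : Relabelling φ φ' 𝒞 𝒟 z w lab lab' Z Z' 𝒜 ℬ)
    {S : Finset ℕ} (hS : ∃ K ∈ φ, Labelled lab K ∧ low (labels lab K) = S) :
    (∃ K ∈ φ', Labelled lab' K ∧ low (labels lab' K) = S) ∨
      ∃ A ∈ 𝒜, ∃ B ∈ ℬ, low (A ∪ B) = S := by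
  obtain ⟨K, hK, hl, rfl⟩ := hS
  by_cases hJ : ∀ C ∈ 𝒞, ∀ D ∈ 𝒟, K ≠ C ∪ D
  · have hf := h.fac.fresh K hK
    exact .inl ⟨K, (h.fac.mem_iff K).2 (.inl ⟨hK, hJ⟩), (h.rel.labelled_iff hf.1 hf.2).2 hl,
      by rw [h.rel.labels_eq hf.1 hf.2]⟩
  · push Not at hJ
    obtain ⟨C, hC, D, hD, rfl⟩ := hJ
    obtain ⟨lC, lD⟩ := labelled_union.1 hl
    exact .inr ⟨_, (h.mem_left _).2 ⟨C, hC, lC, rfl⟩, _, (h.mem_right _).2 ⟨D, hD, lD, rfl⟩,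
      by rw [labels_union]⟩

theorem Relabelling.exists_low_of_roles (h : Relabelling φ φ' 𝒞 𝒟 z w lab lab' Z Z' 𝒜 ℬ)
    (hr : Roles 𝒜 ℬ Z Z') {S : Finset ℕ}
    (hS : ∃ K ∈ φ, Labelled lab K ∧ low (labels lab K) = S) :
    ∃ K ∈ φ', Labelled lab' K ∧ low (labels lab' K) = S := by
  refine (h.exists_low hS).elim id ?_
  rintro ⟨A, hA, B, hB, rfl⟩
  rcases hr A hA B hB with ⟨A', hA', e⟩ | ⟨B', hB', e⟩
  · obtain ⟨K, h1, h2, h3⟩ := h.exists_insert hA'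
    exact ⟨K, h1, h2, by rw [h3, e]⟩
  · obtain ⟨K, h1, h2, h3⟩ := h.symm.exists_insert hB'
    exact ⟨K, h1, h2, by rw [h3, e]⟩

theorem Relabelling.exists_old (h : Relabelling φ φ' 𝒞 𝒟 z w lab lab' Z Z' 𝒜 ℬ) (hK : K ∈ φ')
    (hl : Labelled lab' K) {r : Lit} (hr : r ∈ K) (hz : r ≠ z) (hw : r ≠ w) :
    ∃ K' ∈ φ, Labelled lab K' ∧ r ∈ K' ∧ lab' r = lab r := by
  obtain ⟨C₀, hC₀, lC₀⟩ := h.exists_left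
  obtain ⟨D₀, hD₀, lD₀⟩ := h.exists_right
  have e := h.rel.other r hz hw
  rcases h.cases hK hl with ⟨h1, h2, -⟩ | ⟨C, hC, rfl, h2, -⟩ | ⟨D, hD, rfl, h2, -⟩
  · exact ⟨K, h1, h2, hr, e⟩
  · exact ⟨_, h.fac.union_mem C hC D₀ hD₀, labelled_union.2 ⟨h2, lD₀⟩,
      Finset.mem_union_left _ ((Finset.mem_insert.1 hr).resolve_left hz), e⟩
  · exact ⟨_, h.fac.union_mem C₀ hC₀ D hD, labelled_union.2 ⟨lC₀, h2⟩,
      Finset.mem_union_right _ ((Finset.mem_insert.1 hr).resolve_left hw), e⟩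

theorem Relabelling.join (h : Relabelling φ φ' 𝒞 𝒟 z w lab lab' Z Z' 𝒜 ℬ)
    (hc : Coherent (labelSets lab φ)) : Join (labelSets lab φ) 𝒜 ℬ := by
  have ne : ∀ C : Clause, C.Nonempty → Labelled lab C → (labels lab C).Nonempty := by
    rintro C ⟨r, hr⟩ hl
    exact (hl r hr).mono (subset_labels hr)
  obtain ⟨C₀, hC₀, lC₀⟩ := h.exists_left
  obtain ⟨D₀, hD₀, lD₀⟩ := h.exists_right
  refine ⟨hc, ⟨_, (h.mem_left _).2 ⟨C₀, hC₀, lC₀, rfl⟩⟩, ⟨_, (h.mem_right _).2 ⟨D₀, hD₀, lD₀, rfl⟩⟩,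
    ?_, ?_, ?_⟩
  · intro A hA
    obtain ⟨C, hC, lC, rfl⟩ := (h.mem_left A).1 hA
    exact ne C (h.fac.nonempty_left C hC) lC
  · intro A hA
    obtain ⟨C, hC, lC, rfl⟩ := (h.mem_right A).1 hA
    exact ne C (h.fac.nonempty_right C hC) lC
  · intro A hA B hB
    obtain ⟨C, hC, lC, rfl⟩ := (h.mem_left A).1 hA
    obtain ⟨D, hD, lD, rfl⟩ := (h.mem_right B).1 hB
    exact ⟨_, h.fac.union_mem C hC D hD, labelled_union.2 ⟨lC, lD⟩, labels_union.symm⟩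

theorem Labelling.of_absorbed (hL : Labelling X Mu L lab φ)
    (h : Relabelling φ φ' 𝒞 𝒟 z w lab lab' Z Z' 𝒜 ℬ) (hZ : 2 ≤ Z.card) (hZ' : 2 ≤ Z'.card)
    (hc : Coherent (adj (adj (labelSets lab φ) 𝒜 Z) ℬ Z')) (hr : Roles 𝒜 ℬ Z Z') :
    Labelling X Mu L lab' φ' := by
  have old : ∀ r, (lab' r).card = 1 → r ≠ z ∧ r ≠ w := by
    refine fun r hr => ⟨?_, ?_⟩ <;> rintro rfl
    · rw [h.rel.left] at hr; omega
    · rw [h.rel.right] at hr; omega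
  refine ⟨h.coherent hc, fun a b hab => ⟨(hL.edge a b hab).1,
    h.exists_low_of_roles hr (hL.edge a b hab).2⟩, ?_, ?_, fun b hb => ?_, hL.net⟩
  · intro K hK hl hR a b hab
    rcases h.cases hK hl with ⟨h1, h2, h3, -⟩ | ⟨C, hC, rfl, -⟩ | ⟨D, hD, rfl, -⟩
    · have hf := h.fac.fresh K h1
      exact hL.mem_edge K h1 h2 ((h.rel.rigid_iff hf.1 hf.2).1 hR) a b (h3 ▸ hab)
    · exact absurd rfl (old z (hR z (Finset.mem_insert_self _ _))).1
    · exact absurd rfl (old w (hR w (Finset.mem_insert_self _ _))).2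
  · intro K hK hl K' hK' hl' r hr r' hr' l hM e e'
    obtain ⟨n1, n2⟩ := old r (by simp [e])
    obtain ⟨n1', n2'⟩ := old r' (by simp [e'])
    obtain ⟨K₁, g1, g2, g3, g4⟩ := h.exists_old hK hl hr n1 n2
    obtain ⟨K₂, k1, k2, k3, k4⟩ := h.exists_old hK' hl' hr' n1' n2'
    exact hL.uniq K₁ g1 g2 K₂ k1 k2 r g3 r' k3 l hM (g4 ▸ e) (k4 ▸ e')
  · obtain ⟨ζ, h1, h2, h3⟩ := hL.mark b hb
    exact ⟨ζ, h1, h.exists_low_of_roles hr h2, h3⟩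

theorem Labelling.of_duplicated (hL : Labelling X Mu L lab φ) {b ζ : ℕ}
    (h : Relabelling φ φ' 𝒞 𝒟 z w lab lab' {b} {ζ, ζ + 1} 𝒜 ℬ) (hbζ : b < ζ)
    (hζ : ∀ a, s(ζ, a) ∉ L) (hb : {b} ∈ ℬ)
    (hc : Coherent (adj (adj (labelSets lab φ) 𝒜 {b}) ℬ {ζ, ζ + 1}))
    (hr : Roles 𝒜 ℬ {b} {ζ, ζ + 1}) :
    Labelling X (insert b Mu) L lab' φ' := by
  have old : ∀ r, (lab' r).card = 1 → r ≠ w := by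
    rintro r hr rfl
    rw [h.rel.right, Finset.card_pair (by omega)] at hr
    omega
  refine ⟨h.coherent hc, fun a b hab => ⟨(hL.edge a b hab).1,
    h.exists_low_of_roles hr (hL.edge a b hab).2⟩, ?_, ?_, fun b' hb' => ?_,
    hL.net.mono_multi (Finset.subset_insert _ _)⟩
  · intro K hK hl hR a b' hab
    rcases h.cases hK hl with ⟨h1, h2, h3, -⟩ | ⟨C, hC, rfl, lC, h3⟩ | ⟨D, hD, rfl, -⟩
    · have hf := h.fac.fresh K h1
      exact hL.mem_edge K h1 h2 ((h.rel.rigid_iff hf.1 hf.2).1 hR) a b' (h3 ▸ hab)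
    · obtain ⟨D, hD, lD, hDb⟩ := (h.mem_right _).1 hb
      refine hL.mem_edge _ (h.fac.union_mem C hC D hD) (labelled_union.2 ⟨lC, lD⟩) ?_ a b'
        (by rw [labels_union, hDb, ← h3, hab])
      intro r hr
      rcases Finset.mem_union.1 hr with hr | hr
      · have hn := h.not_mem hC
        exact (h.rel.rigid_iff hn.1 hn.2).1
          (fun r hr => hR r (Finset.mem_insert_of_mem hr)) r hr
      · rw [lD.eq_singleton hDb hr, Finset.card_singleton]
    · exact absurd rfl (old w (hR w (Finset.mem_insert_self _ _)))
  · intro K hK hl K' hK' hl' r hr r' hr' l hM e e'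
    rw [Finset.mem_insert, not_or] at hM
    have nz : ∀ r, lab' r = {l} → r ≠ z := by
      rintro r hr rfl
      rw [h.rel.left, Finset.singleton_inj] at hr
      exact hM.1 hr.symm
    obtain ⟨K₁, g1, g2, g3, g4⟩ := h.exists_old hK hl hr (nz r e) (old r (by simp [e]))
    obtain ⟨K₂, k1, k2, k3, k4⟩ := h.exists_old hK' hl' hr' (nz r' e') (old r' (by simp [e']))
    exact hL.uniq K₁ g1 g2 K₂ k1 k2 r g3 r' k3 l hM.2 (g4 ▸ e) (k4 ▸ e')
  · by_cases hbb : b' = b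
    · subst hbb
      refine ⟨ζ, hbζ, ?_, hζ⟩
      obtain ⟨K, h1, h2, h3⟩ := h.symm.exists_insert hb
      refine ⟨K, h1, h2, ?_⟩
      rw [h3, low_singleton_union_fresh (by simp) (by simp; omega)]
      congr 1
      simp [Finset.min'_insert, Finset.min'_singleton]
    · obtain ⟨ζ', h1, h2, h3⟩ := hL.mark b' ((Finset.mem_insert.1 hb').resolve_left hbb)
      exact ⟨ζ', h1, h.exists_low_of_roles hr h2, h3⟩

end
end

section
variable {φ φ' : Formula} {𝒞 𝒟 : Finset Clause} {z w : Lit} {lab lab' : Lit → Finset ℕ}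
  {X Mu Z Z' : Finset ℕ} {L : Finset (Sym2 ℕ)} {C D K : Clause} {𝒜 ℬ : Finset (Finset ℕ)}

/-! ### Branching labels -/

theorem toFinset_pair (a b : ℕ) : (s(a, b)).toFinset = {a, b} := by
  ext x
  simp

theorem pair_eq_pair {a b c d : ℕ} : ({a, b} : Finset ℕ) = {c, d} ↔ s(a, b) = s(c, d) := by
  refine ⟨fun h => Sym2.ext fun x => ?_, fun h => ?_⟩
  · rw [← Sym2.mem_toFinset, toFinset_pair, h, ← toFinset_pair, Sym2.mem_toFinset]
  · rw [← toFinset_pair, h, toFinset_pair]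

/-- Some clause carries exactly the two ends of the edge `e` as labels, one for each literal. -/
def Held (lab : Lit → Finset ℕ) (φ : Formula) (e : Sym2 ℕ) : Prop :=
  ∃ K ∈ φ, Labelled lab K ∧ Rigid lab K ∧ labels lab K = e.toFinset

theorem Labelling.singleton_mem (hL : Labelling X Mu L lab φ)
    (h : Relabelling φ φ' 𝒞 𝒟 z w lab lab' Z Z' 𝒜 ℬ) {c d : ℕ} (hc : {c} ∈ 𝒜) (hd : {d} ∈ ℬ) :
    s(c, d) ∈ L := by
  obtain ⟨C, hC, lC, eC⟩ := (h.mem_left _).1 hc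
  obtain ⟨D, hD, lD, eD⟩ := (h.mem_right _).1 hd
  have hl := labelled_union.2 ⟨lC, lD⟩
  have hm := h.fac.union_mem C hC D hD
  have e : labels lab (C ∪ D) = {c, d} := by rw [labels_union, eC, eD]; rfl
  refine hL.mem_edge _ hm hl (fun r hr => ?_) c d e ?_
  · rcases Finset.mem_union.1 hr with hr | hr
    · rw [lC.eq_singleton eC hr, Finset.card_singleton]
    · rw [lD.eq_singleton eD hr, Finset.card_singleton]
  · rintro rfl
    have := hL.coh.two_le _ ⟨_, hm, hl, rfl⟩
    simp [e] at this

/-- A clause whose literals carry exactly the labels `c` and `d` is the one removed. -/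
theorem Labelling.not_held (hL : Labelling X Mu L lab φ)
    (h : Relabelling φ φ' 𝒞 𝒟 z w lab lab' Z Z' 𝒜 ℬ) {c d : ℕ} (hc : {c} ∈ 𝒜) (hd : {d} ∈ ℬ)
    (hcM : c ∉ Mu) (hdM : d ∉ Mu) (hZ : ¬ Z ⊆ {c, d}) (hZ' : ¬ Z' ⊆ {c, d}) :
    ¬ Held lab' φ' s(c, d) := by
  rintro ⟨K, hK, hl, hR, hK'⟩
  rw [toFinset_pair] at hK'
  rcases h.cases hK hl with ⟨h1, h2, h3, h4⟩ | ⟨_, _, _, _, h3⟩ | ⟨_, _, _, _, h3⟩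
  · obtain ⟨C, hC, lC, eC⟩ := (h.mem_left _).1 hc
    obtain ⟨D, hD, lD, eD⟩ := (h.mem_right _).1 hd
    have hf := h.fac.fresh K h1
    have hR' := (h.rel.rigid_iff hf.1 hf.2).1 hR
    have hm := h.fac.union_mem C hC D hD
    have hlu := labelled_union.2 ⟨lC, lD⟩
    have e : labels lab K = {c, d} := h3 ▸ hK'
    have single : ∀ r ∈ K, ∀ x ∈ lab r, lab r = {x} := fun r hr x hx => by
      obtain ⟨y, hy⟩ := Finset.card_eq_one.1 (hR' r hr)
      rw [hy, Finset.mem_singleton] at hx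
      rw [hy, hx]
    have find : ∀ x ∈ ({c, d} : Finset ℕ), ∃ r ∈ K, lab r = {x} := fun x hx => by
      obtain ⟨r, hr, hxr⟩ := Finset.mem_biUnion.1 (e ▸ hx : x ∈ labels lab K)
      exact ⟨r, hr, single r hr x hxr⟩
    refine h4 C hC D hD (Finset.Subset.antisymm (fun r hr => ?_) fun r hr => ?_)
    · obtain ⟨x, hx⟩ := h2 r hr
      have hxm : x ∈ ({c, d} : Finset ℕ) := e ▸ subset_labels hr hx
      have hrx := single r hr x hx
      rcases Finset.mem_insert.1 hxm with rfl | hxd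
      · obtain ⟨r', hr'⟩ := h.fac.nonempty_left C hC
        have hu := Finset.mem_union_left D hr'
        exact hL.uniq K h1 h2 _ hm hlu r hr r' hu _ hcM hrx (lC.eq_singleton eC hr') ▸ hu
      · rw [Finset.mem_singleton] at hxd
        subst hxd
        obtain ⟨r', hr'⟩ := h.fac.nonempty_right D hD
        have hu := Finset.mem_union_right C hr'
        exact hL.uniq K h1 h2 _ hm hlu r hr r' hu _ hdM hrx (lD.eq_singleton eD hr') ▸ hu
    · rcases Finset.mem_union.1 hr with hr' | hr'
      · obtain ⟨r', hK', e'⟩ := find c (by simp)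
        exact hL.uniq K h1 h2 _ hm hlu r' hK' r hr _ hcM e' (lC.eq_singleton eC hr') ▸ hK'
      · obtain ⟨r', hK', e'⟩ := find d (by simp)
        exact hL.uniq K h1 h2 _ hm hlu r' hK' r hr _ hdM e' (lD.eq_singleton eD hr') ▸ hK'
  · exact hZ (hK' ▸ h3 ▸ Finset.subset_union_right)
  · exact hZ' (hK' ▸ h3 ▸ Finset.subset_union_right)

/-- The edges after branching: the biclique is rerouted through `ζ`, except for held edges. -/
theorem exists_rerouted (L : Finset (Sym2 ℕ)) (P : Sym2 ℕ → Prop) (𝒜 ℬ : Finset (Finset ℕ))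
    (ζ : ℕ) : ∃ L' : Finset (Sym2 ℕ), ∀ e, e ∈ L' ↔
      (e ∈ L ∧ ((∃ c d, {c} ∈ 𝒜 ∧ {d} ∈ ℬ ∧ e = s(c, d)) → P e)) ∨
      (∃ c, {c} ∈ 𝒜 ∧ e = s(c, ζ)) ∨ ∃ d, {d} ∈ ℬ ∧ e = s(d, ζ + 1) := by
  classical
  refine ⟨L.filter (fun e => (∃ c d, {c} ∈ 𝒜 ∧ {d} ∈ ℬ ∧ e = s(c, d)) → P e) ∪
    (((𝒜.biUnion id).filter fun c => {c} ∈ 𝒜).image fun c => s(c, ζ)) ∪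
    (((ℬ.biUnion id).filter fun d => {d} ∈ ℬ).image fun d => s(d, ζ + 1)), fun e => ?_⟩
  have key : ∀ (𝒮 : Finset (Finset ℕ)) (y : ℕ),
      (e ∈ ((𝒮.biUnion id).filter fun c => {c} ∈ 𝒮).image fun c => s(c, y)) ↔
        ∃ c, {c} ∈ 𝒮 ∧ e = s(c, y) := by
    intro 𝒮 y
    rw [Finset.mem_image]
    refine exists_congr fun c => ?_
    rw [Finset.mem_filter, eq_comm]
    exact and_congr_left fun _ => ⟨fun hc => hc.2,
      fun hc => ⟨Finset.mem_biUnion.2 ⟨_, hc, Finset.mem_singleton_self c⟩, hc⟩⟩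
  rw [Finset.mem_union, Finset.mem_union, Finset.mem_filter, key, key, or_assoc]

theorem Labelling.of_branched (hL : Labelling X Mu L lab φ) {ζ : ℕ}
    (h : Relabelling φ φ' 𝒞 𝒟 z w lab lab' {ζ} {ζ + 1} 𝒜 ℬ) (he : ng ζ = ζ + 1)
    (hφ : ∀ K ∈ labelSets lab φ, ∀ x ∈ K, x < ζ) (hX : ∀ x ∈ X, x < ζ)
    (hb : Branched (labelSets lab φ) 𝒜 ℬ ζ) : ∃ L', Labelling X Mu L' lab' φ' := by
  obtain ⟨hcoh, hA, hB, hlow⟩ := hb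
  have ltA : ∀ A ∈ 𝒜, ∀ c ∈ A, c < ζ := fun A hA c hc =>
    (h.join hL.coh).mem A hA _ (h.join hL.coh).right_ne.choose_spec |> fun hm =>
      hφ _ hm c (Finset.mem_union_left _ hc)
  have ltB : ∀ B ∈ ℬ, ∀ c ∈ B, c < ζ := fun B hB c hc =>
    (h.join hL.coh).mem _ (h.join hL.coh).left_ne.choose_spec B hB |> fun hm =>
      hφ _ hm c (Finset.mem_union_right _ hc)
  have ltc : ∀ c, {c} ∈ 𝒜 → c < ζ := fun c hc => ltA _ hc c (Finset.mem_singleton_self c)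
  have ltd : ∀ c, {c} ∈ ℬ → c < ζ := fun c hc => ltB _ hc c (Finset.mem_singleton_self c)
  have pair := fun c d (hc : {c} ∈ 𝒜) (hd : {d} ∈ ℬ) => hL.singleton_mem h hc hd
  have ltL : ∀ a b, s(a, b) ∈ L → a < ζ := by
    intro a b hab
    obtain ⟨-, K, hK, hl, e⟩ := hL.edge a b hab
    exact hφ _ ⟨K, hK, hl, rfl⟩ a (low_subset _ (e ▸ by simp))
  obtain ⟨L', hL'⟩ := exists_rerouted L (Held lab' φ') 𝒜 ℬ ζ
  have reroute : ∀ S, (∃ K ∈ φ, Labelled lab K ∧ low (labels lab K) = S) →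
      (∃ K ∈ φ', Labelled lab' K ∧ low (labels lab' K) = S) ∨
        ∃ c d, {c} ∈ 𝒜 ∧ {d} ∈ ℬ ∧ S = {c, d} := by
    intro S hS
    refine (h.exists_low hS).imp_right ?_ |>.elim .inl id
    rintro ⟨A, hA, B, hB, rfl⟩
    rcases hlow A hA B hB with ⟨c, d, rfl, rfl⟩ | e | e
    · exact .inr ⟨c, d, hA, hB, low_pair (hL.edge c d (pair c d hA hB)).1⟩
    · obtain ⟨K, h1, h2, h3⟩ := h.exists_insert hA
      exact .inl ⟨K, h1, h2, by rw [h3, e]⟩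
    · obtain ⟨K, h1, h2, h3⟩ := h.symm.exists_insert hB
      exact .inl ⟨K, h1, h2, by rw [h3, e]⟩
  refine ⟨L', h.coherent hcoh, ?_, ?_, ?_, ?_, ?_⟩
  · intro a b hab
    have new : ∀ c y, c < y → s(a, b) = s(c, y) →
        (∃ K ∈ φ', Labelled lab' K ∧ labels lab' K = {c} ∪ {y}) →
        a ≠ b ∧ ∃ K ∈ φ', Labelled lab' K ∧ low (labels lab' K) = {a, b} := by
      rintro c y hcy e ⟨K, h1, h2, h3⟩
      have e' := pair_eq_pair.2 e
      refine ⟨?_, K, h1, h2, ?_⟩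
      · rintro rfl
        rcases Sym2.eq_iff.1 e with ⟨rfl, rfl⟩ | ⟨rfl, rfl⟩ <;> exact lt_irrefl _ hcy
      · rw [h3, e', ← low_pair hcy.ne]
        rfl
    rcases (hL' _).1 hab with ⟨h1, h2⟩ | ⟨c, hc, e⟩ | ⟨d, hd, e⟩
    · refine ⟨(hL.edge a b h1).1, (reroute _ (hL.edge a b h1).2).elim id ?_⟩
      rintro ⟨c, d, hc, hd, e⟩
      obtain ⟨K, k1, k2, -, k3⟩ := h2 ⟨c, d, hc, hd, pair_eq_pair.1 e⟩
      exact ⟨K, k1, k2, by rw [k3, toFinset_pair, low_pair (hL.edge a b h1).1]⟩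
    · exact new c ζ (ltc c hc) e (h.exists_insert hc)
    · exact new d (ζ + 1) ((ltd d hd).trans (Nat.lt_succ_self ζ)) e (h.symm.exists_insert hd)
  · intro K hK hl hR a b hab hne
    have new : ∀ (S : Finset ℕ) (y : ℕ), S.Nonempty → (∀ x ∈ S, x < y) →
        S ∪ {y} = {a, b} → ∃ c, S = {c} ∧ s(a, b) = s(c, y) := by
      intro S y hS hlt e
      have hy : y ∉ S := fun hy => lt_irrefl y (hlt y hy)
      have hcard : (S ∪ {y}).card = S.card + 1 := by
        rw [Finset.union_comm]
        exact Finset.card_insert_of_notMem hy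
      rw [e, Finset.card_pair hne] at hcard
      obtain ⟨c, rfl⟩ := Finset.card_eq_one.1 (by omega : S.card = 1)
      exact ⟨c, rfl, pair_eq_pair.1 e.symm⟩
    rw [hL']
    rcases h.cases hK hl with ⟨h1, h2, h3, -⟩ | ⟨C, hC, -, lC, h3⟩ | ⟨D, hD, -, lD, h3⟩
    · have hf := h.fac.fresh K h1
      exact .inl ⟨hL.mem_edge K h1 h2 ((h.rel.rigid_iff hf.1 hf.2).1 hR) a b (h3 ▸ hab) hne,
        fun _ => ⟨K, hK, hl, hR, by rw [hab, toFinset_pair]⟩⟩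
    · have hm := (h.mem_left _).2 ⟨C, hC, lC, rfl⟩
      obtain ⟨c, e, e'⟩ := new _ ζ ((h.join hL.coh).nonempty_left _ hm) (ltA _ hm) (h3 ▸ hab)
      exact .inr (.inl ⟨c, e ▸ hm, e'⟩)
    · have hm := (h.mem_right _).2 ⟨D, hD, lD, rfl⟩
      obtain ⟨c, e, e'⟩ := new _ (ζ + 1) ((h.join hL.coh).nonempty_right _ hm)
        (fun x hx => (ltB _ hm x hx).trans (Nat.lt_succ_self ζ)) (h3 ▸ hab)
      exact .inr (.inr ⟨c, e ▸ hm, e'⟩)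
  · have role : ∀ K ∈ φ', Labelled lab' K → ∀ r ∈ K, ∀ l, lab' r = {l} →
        (r = z ∧ l = ζ) ∨ (r = w ∧ l = ζ + 1) ∨
          (l < ζ ∧ ∃ K' ∈ φ, Labelled lab K' ∧ r ∈ K' ∧ lab r = {l}) := by
      intro K hK hl r hr l e
      by_cases hz : r = z
      · subst hz
        rw [h.rel.left, Finset.singleton_inj] at e
        exact .inl ⟨rfl, e.symm⟩
      by_cases hw : r = w
      · subst hw
        rw [h.rel.right, Finset.singleton_inj] at e
        exact .inr (.inl ⟨rfl, e.symm⟩)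
      obtain ⟨K', k1, k2, k3, k4⟩ := h.exists_old hK hl hr hz hw
      rw [k4] at e
      exact .inr (.inr ⟨hφ _ ⟨K', k1, k2, rfl⟩ l (subset_labels k3 (e ▸ by simp)),
        K', k1, k2, k3, e⟩)
    intro K hK hl K' hK' hl' r hr r' hr' l hM e e'
    rcases role K hK hl r hr l e with ⟨g, g'⟩ | ⟨g, g'⟩ | ⟨g, K₁, k1, k2, k3, k4⟩ <;>
    rcases role K' hK' hl' r' hr' l e' with ⟨i, i'⟩ | ⟨i, i'⟩ | ⟨i, K₂, j1, j2, j3, j4⟩ <;>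
    first
    | exact g.trans i.symm
    | exact hL.uniq K₁ k1 k2 K₂ j1 j2 r k3 r' j3 l hM k4 j4
    | omega
  · intro b hb
    obtain ⟨ζ', h1, h2, h3⟩ := hL.mark b hb
    have hlt : ζ' < ζ := by
      obtain ⟨K, hK, hl, e⟩ := h2
      exact hφ _ ⟨K, hK, hl, rfl⟩ ζ' (low_subset _ (e ▸ by simp))
    refine ⟨ζ', h1, (reroute _ h2).elim id ?_, fun a ha => ?_⟩
    · rintro ⟨c, d, hc, hd, e⟩
      have := pair c d hc hd
      rw [← pair_eq_pair.1 e, Sym2.eq_swap] at this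
      exact absurd this (h3 b)
    · obtain ⟨c₀, hc₀⟩ := hA
      obtain ⟨d₀, hd₀⟩ := hB
      rcases (hL' _).1 ha with ⟨h4, -⟩ | ⟨c, hc, e⟩ | ⟨d, hd, e⟩
      · exact h3 a h4
      · rcases Sym2.eq_iff.1 e with ⟨rfl, -⟩ | ⟨rfl, -⟩
        · exact h3 _ (pair _ _ hc hd₀)
        · omega
      · rcases Sym2.eq_iff.1 e with ⟨rfl, -⟩ | ⟨rfl, -⟩
        · exact h3 c₀ (Sym2.eq_swap ▸ pair _ _ hc₀ hd)
        · omega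
  · have mem : ∀ (𝒮 : Finset (Finset ℕ)) (c : ℕ),
        c ∈ (𝒮.biUnion id).filter (fun c => {c} ∈ 𝒮) ↔ {c} ∈ 𝒮 := by
      intro 𝒮 c
      rw [Finset.mem_filter]
      exact ⟨fun hc => hc.2,
        fun hc => ⟨Finset.mem_biUnion.2 ⟨_, hc, Finset.mem_singleton_self c⟩, hc⟩⟩
    obtain ⟨c₀, hc₀⟩ := hA
    obtain ⟨d₀, hd₀⟩ := hB
    refine hL.net.biclique (A := (𝒜.biUnion id).filter (fun c => {c} ∈ 𝒜))
      (B := (ℬ.biUnion id).filter (fun c => {c} ∈ ℬ)) (ζ := ζ) ⟨c₀, (mem _ _).2 hc₀⟩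
      ⟨d₀, (mem _ _).2 hd₀⟩ ?_ (fun a ha => (hL.edge a a ha).1 rfl) (fun a => ⟨fun ha => ?_,
      fun ha => ?_⟩) ⟨fun hx => ?_, fun hx => ?_⟩ ?_ ?_ ?_ ?_ ?_
    · exact fun c hc d hd => pair c d ((mem _ _).1 hc) ((mem _ _).1 hd)
    · exact lt_irrefl _ (ltL _ _ ha)
    · have := ltL _ _ ha
      omega
    · exact lt_irrefl _ (hX _ hx)
    · have := hX _ hx
      omega
    · intro e hm
      rcases (hL' e).1 hm with ⟨h1, -⟩ | ⟨c, hc, e⟩ | ⟨d, hd, e⟩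
      · exact .inl h1
      · exact .inr (.inl ⟨c, (mem _ _).2 hc, e⟩)
      · exact .inr (.inr ⟨d, (mem _ _).2 hd, he ▸ e⟩)
    · intro e hm
      by_cases hJ : ∃ c d, {c} ∈ 𝒜 ∧ {d} ∈ ℬ ∧ e = s(c, d)
      · obtain ⟨c, d, hc, hd, e⟩ := hJ
        exact .inr ⟨c, (mem _ _).2 hc, d, (mem _ _).2 hd, e⟩
      · exact .inl ((hL' e).2 (.inl ⟨hm, fun hJ' => absurd hJ' hJ⟩))
    · exact fun c hc => (hL' _).2 (.inr (.inl ⟨c, (mem _ _).1 hc, rfl⟩))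
    · exact fun d hd => (hL' _).2 (.inr (.inr ⟨d, (mem _ _).1 hd, by rw [he]⟩))
    · intro c hc d hd hcM hdM hcd
      rw [mem] at hc hd
      have hc' := ltc c hc
      have hd' := ltd d hd
      rcases (hL' _).1 hcd with ⟨-, h2⟩ | ⟨c', -, e⟩ | ⟨d', -, e⟩
      · refine hL.not_held h hc hd hcM hdM ?_ ?_ (h2 ⟨c, d, hc, hd, rfl⟩) <;>
        · intro hs
          have := hs (Finset.mem_singleton_self _)
          simp only [Finset.mem_insert, Finset.mem_singleton] at this
          omega
      · rcases Sym2.eq_iff.1 e with ⟨-, e⟩ | ⟨e, -⟩ <;> omega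
      · rcases Sym2.eq_iff.1 e with ⟨-, e⟩ | ⟨e, -⟩ <;> omega

/-! ### The invariant is preserved -/

theorem Labelling.step (hL : Labelling X Mu L lab φ) (hs : BVAStep φ φ') :
    ∃ Mu' L' lab', Labelling X Mu' L' lab' φ' := by
  classical
  obtain ⟨𝒞, 𝒟, z, w, hF⟩ := hs.factoring
  by_cases h0 : ∀ C ∈ 𝒞, ∀ D ∈ 𝒟, ¬ (Labelled lab C ∧ Labelled lab D)
  · obtain ⟨lab', hR⟩ := exists_relabels lab hF.ne ∅ ∅
    exact ⟨Mu, L, lab', hL.of_unlabelled hF hR h0⟩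
  push Not at h0
  obtain ⟨C₀, hC₀, D₀, hD₀, lC₀, lD₀⟩ := h0
  have mem : ∀ (𝒮 : Finset Clause) (A : Finset ℕ),
      A ∈ (𝒮.filter (Labelled lab)).image (labels lab) ↔
        ∃ C ∈ 𝒮, Labelled lab C ∧ labels lab C = A := fun 𝒮 A => by
    simp only [Finset.mem_image, Finset.mem_filter, and_assoc]
  have relabel : ∀ Z Z' : Finset ℕ, Z.Nonempty → Z'.Nonempty → ∃ lab',
      Relabelling φ φ' 𝒞 𝒟 z w lab lab' Z Z' ((𝒞.filter (Labelled lab)).image (labels lab))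
        ((𝒟.filter (Labelled lab)).image (labels lab)) := fun Z Z' hZ hZ' => by
    obtain ⟨lab', hR⟩ := exists_relabels lab hF.ne Z Z'
    exact ⟨lab', hF, hR, hZ, hZ', ⟨C₀, hC₀, lC₀⟩, ⟨D₀, hD₀, lD₀⟩, mem 𝒞, mem 𝒟⟩
  set 𝒜 := (𝒞.filter (Labelled lab)).image (labels lab)
  set ℬ := (𝒟.filter (Labelled lab)).image (labels lab)
  obtain ⟨m, hm⟩ : ∃ m, ∀ x ∈ X ∪ φ.biUnion (labels lab), x ≤ m :=
    ⟨_, fun x hx => Finset.le_sup (f := id) hx⟩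
  have hX : ∀ x ∈ X, x < 2 * m + 2 := fun x hx => by
    have := hm x (Finset.mem_union_left _ hx)
    omega
  have hφ : ∀ K ∈ labelSets lab φ, ∀ x ∈ K, x < 2 * m + 2 := by
    rintro _ ⟨K, hK, hl, rfl⟩ x hx
    have := hm x (Finset.mem_union_right _ (Finset.mem_biUnion.2 ⟨K, hK, hx⟩))
    omega
  have hζL : ∀ a, s(2 * m + 2, a) ∉ L := by
    intro a ha
    obtain ⟨-, K, hK, hl, e⟩ := hL.edge _ a ha
    exact lt_irrefl _ (hφ _ ⟨K, hK, hl, rfl⟩ (2 * m + 2) (low_subset _ (e ▸ by simp)))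
  have he : ng (2 * m + 2) = 2 * m + 2 + 1 := if_pos (by omega)
  generalize 2 * m + 2 = ζ at *
  have hJ : Join (labelSets lab φ) 𝒜 ℬ := by
    obtain ⟨lab', h⟩ := relabel {0} {0} (by simp) (by simp)
    exact h.join hL.coh
  rcases hJ.classify hφ with h | h | h | h
  · obtain ⟨Z, Z', h1, h2, h3, h4⟩ := h
    obtain ⟨lab', h⟩ := relabel Z Z' (Finset.card_pos.1 (by omega)) (Finset.card_pos.1 (by omega))
    exact ⟨Mu, L, lab', hL.of_absorbed h h1 h2 h3 h4⟩
  · obtain ⟨b, h1, h2, h3⟩ := h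
    obtain ⟨lab', h⟩ := relabel {b} {ζ, ζ + 1} (by simp) (by simp)
    have hbζ := hφ _ (hJ.mem _ hJ.left_ne.choose_spec _ h1) b (by simp)
    exact ⟨insert b Mu, L, lab', hL.of_duplicated h hbζ hζL h1 h2 h3⟩
  · obtain ⟨b, h1, h2, h3⟩ := h
    obtain ⟨lab', h⟩ := relabel {ζ, ζ + 1} {b} (by simp) (by simp)
    have hbζ := hφ _ (hJ.mem _ h1 _ hJ.right_ne.choose_spec) b (by simp)
    exact ⟨insert b Mu, L, lab', hL.of_duplicated h.symm hbζ hζL h1 h2 h3⟩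
  · obtain ⟨lab', h'⟩ := relabel {ζ} {ζ + 1} (by simp) (by simp)
    obtain ⟨L', hL'⟩ := hL.of_branched h' he hφ hX h
    exact ⟨Mu, L', lab', hL'⟩

/-! ### The direct encoding -/

theorem mem_atMostOne {n : ℕ} : K ∈ atMostOne n ↔
    ∃ i j, i < j ∧ j < n ∧ K = {(i, false), (j, false)} := by
  simp only [atMostOne, Finset.mem_image, Finset.mem_filter, Finset.mem_product, Finset.mem_range,
    Prod.exists]
  constructor
  · rintro ⟨i, j, ⟨⟨-, h1⟩, h2⟩, rfl⟩
    exact ⟨i, j, h2, h1, rfl⟩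
  · rintro ⟨i, j, h1, h2, rfl⟩
    exact ⟨i, j, ⟨⟨h1.trans h2, h2⟩, h1⟩, rfl⟩

theorem network_complete {n : ℕ} (hL : ∀ a b, s(a, b) ∈ L ↔
    ∃ i j, i < n ∧ j < n ∧ i ≠ j ∧ a = 2 * i ∧ b = 2 * j) :
    Network ((Finset.range n).image (2 * ·)) ∅ L := by
  have even_left : ∀ a b, s(a, b) ∈ L → a % 2 = 0 := by
    intro a b h
    obtain ⟨i, j, -, -, -, rfl, -⟩ := (hL a b).1 h
    omega
  have ngX : ∀ v, v % 2 = 0 → ng v % 2 = 1 := fun v hv => by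
    rw [ng, if_pos hv]
    omega
  have arc_parity : ∀ a b, Arc L a b → a % 2 = 1 ∧ b % 2 = 0 := by
    intro a b h
    have h1 := even_left _ _ h
    refine ⟨?_, even_left b (ng a) (by rw [Sym2.eq_swap]; exact h)⟩
    rw [← ng_ng a]
    exact ngX _ h1
  have evenX : ∀ v ∈ (Finset.range n).image (2 * ·), v % 2 = 0 := by
    intro v hv
    obtain ⟨i, -, rfl⟩ := Finset.mem_image.1 hv
    omega
  have terminal : ∀ a b, a % 2 = 0 → Relation.ReflTransGen (Arc L) a b → b = a := by
    intro a b ha h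
    rcases Relation.ReflTransGen.cases_head h with e | ⟨c, h1, -⟩
    · exact e.symm
    · have := (arc_parity _ _ h1).1
      omega
  have no : ∀ v w S, ¬ Detour L S v w := by
    rintro v w S ⟨q, r, h1, h2, -, h3⟩
    have hq := even_left q v (Sym2.eq_swap ▸ h1)
    have hr := ngX r (even_left r w (Sym2.eq_swap ▸ h2))
    have := terminal q (ng r) hq (Relation.ReflTransGen.mono (fun _ _ h => h.1) _ _ h3)
    omega
  refine ⟨fun v hv a h => ?_, fun v hv u hu hne => .single ?_, fun v hv h => ?_, fun a h => ?_,
    fun v u _ _ S₁ _ _ h => absurd h (no v u S₁)⟩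
  · have := even_left _ _ h
    have := ngX v (evenX v hv)
    omega
  · obtain ⟨i, hi, rfl⟩ := Finset.mem_image.1 hv
    obtain ⟨j, hj, rfl⟩ := Finset.mem_image.1 hu
    rw [Arc, ng_ng, hL]
    exact ⟨i, j, Finset.mem_range.1 hi, Finset.mem_range.1 hj, fun e => hne (by rw [e]), rfl, rfl⟩
  · rcases Relation.ReflTransGen.cases_head h with e | ⟨c, h1, h2⟩
    · exact ng_ne v e
    · have := terminal c v (arc_parity _ _ h1).2 h2
      subst this
      rw [Arc, ng_ng, hL] at h1
      obtain ⟨i, j, -, -, h3, h4, h5⟩ := h1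
      omega
  · obtain ⟨c, h1, h2⟩ := Relation.TransGen.head'_iff.1 h
    have := terminal c a (arc_parity _ _ h1).2 h2
    have := arc_parity _ _ h1
    omega

theorem exists_labelling_atMostOne (n : ℕ) : ∃ L lab,
    Labelling ((Finset.range n).image (2 * ·)) ∅ L lab (atMostOne n) := by
  classical
  obtain ⟨L, hL⟩ : ∃ L : Finset (Sym2 ℕ), ∀ a b, s(a, b) ∈ L ↔
      ∃ i j, i < n ∧ j < n ∧ i ≠ j ∧ a = 2 * i ∧ b = 2 * j := by
    refine ⟨(((Finset.range n) ×ˢ (Finset.range n)).filter fun p => p.1 ≠ p.2).image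
      fun p => s(2 * p.1, 2 * p.2), fun a b => ?_⟩
    simp only [Finset.mem_image, Finset.mem_filter, Finset.mem_product, Finset.mem_range,
      Prod.exists, Sym2.eq_iff]
    constructor
    · rintro ⟨i, j, ⟨⟨hi, hj⟩, hne⟩, ⟨rfl, rfl⟩ | ⟨rfl, rfl⟩⟩
      · exact ⟨i, j, hi, hj, hne, rfl, rfl⟩
      · exact ⟨j, i, hj, hi, hne.symm, rfl, rfl⟩
    · rintro ⟨i, j, hi, hj, hne, rfl, rfl⟩
      exact ⟨i, j, ⟨⟨hi, hj⟩, hne⟩, .inl ⟨rfl, rfl⟩⟩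
  let lab : Lit → Finset ℕ := fun r => {2 * r.1}
  have lab_pair : ∀ i j, labels lab {(i, false), (j, false)} = {2 * i, 2 * j} := fun i j => by
    rw [labels, Finset.biUnion_insert, Finset.singleton_biUnion]
    rfl
  have hall : ∀ K, Labelled lab K := fun K r _ => Finset.singleton_nonempty _
  have sets : ∀ S ∈ labelSets lab (atMostOne n), S.card = 2 := by
    rintro _ ⟨K, hK, -, rfl⟩
    obtain ⟨i, j, hij, -, rfl⟩ := mem_atMostOne.1 hK
    rw [lab_pair, Finset.card_pair (by omega)]
  have low_self : ∀ S : Finset ℕ, S.card = 2 → low S = S := by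
    intro S hS
    obtain ⟨a, b, hab, rfl⟩ := Finset.card_eq_two.1 hS
    exact low_pair hab
  refine ⟨L, lab, ⟨fun S hS => (sets S hS).ge, fun S hS T hT => ?_⟩, ?_, ?_, ?_, by simp,
    network_complete hL⟩
  · have hS' := low_self S (sets S hS)
    have hT' := low_self T (sets T hT)
    exact ⟨.inr (.inr (by rw [hS', hT', Finset.inter_comm])), fun y hy _ hyl => absurd hy (hS' ▸ hyl)⟩
  · intro a b h
    obtain ⟨i, j, hi, hj, hne, rfl, rfl⟩ := (hL a b).1 h
    refine ⟨by omega, ?_⟩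
    rcases lt_or_gt_of_ne hne with h | h
    · refine ⟨_, mem_atMostOne.2 ⟨i, j, h, hj, rfl⟩, hall _, ?_⟩
      rw [lab_pair, low_pair (by omega)]
    · refine ⟨_, mem_atMostOne.2 ⟨j, i, h, hi, rfl⟩, hall _, ?_⟩
      rw [lab_pair, low_pair (by omega), Finset.pair_comm]
  · intro K hK _ _ a b hab _
    obtain ⟨i, j, hij, hj, rfl⟩ := mem_atMostOne.1 hK
    rw [lab_pair, pair_eq_pair] at hab
    rw [← hab, hL]
    exact ⟨i, j, hij.trans hj, hj, hij.ne, rfl, rfl⟩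
  · have neg : ∀ K ∈ atMostOne n, ∀ r ∈ K, r.2 = false := by
      intro K hK r hr
      obtain ⟨i, j, -, -, rfl⟩ := mem_atMostOne.1 hK
      rcases Finset.mem_insert.1 hr with rfl | hr
      · rfl
      · rw [Finset.mem_singleton.1 hr]
    intro K hK _ K' hK' _ r hr r' hr' l _ e e'
    refine Prod.ext ?_ ((neg K hK r hr).trans (neg K' hK' r' hr').symm)
    have := Finset.singleton_inj.1 (e.trans e'.symm)
    omega

end

/-- idealized BVA cannot encode AtMostOne with fewer than `3n - 6` clauses. -/
theorem amo_lower (n : ℕ) (hn : 3 ≤ n) (φ : Formula)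
    (h : BVAChain (atMostOne n) φ) :
    3 * n - 6 ≤ φ.card := by
  have key : ∃ Mu L lab, Labelling ((Finset.range n).image (2 * ·)) Mu L lab φ := by
    induction h with
    | refl => exact ⟨∅, exists_labelling_atMostOne n⟩
    | tail _ hs ih =>
      obtain ⟨Mu, L, lab, hL⟩ := ih
      exact hL.step hs
  obtain ⟨Mu, L, lab, hL⟩ := key
  have h1 := hL.card_le
  have h2 := hL.net.three_mul_le
  rw [Finset.card_image_of_injective _ fun a b e => by simpa using e, Finset.card_range] at h2
  omega

end BVAPaper
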